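/- arXiv:1910.13378 — 2 statements merged into one kernel-verified Lean document; each statement's English description precedes it below -/
import Mathlib

section
/- Poisson regime: let t > 0 and let a_n, b_n, c_n be sequences of positive integers tending to infinity with a_n b_n / c_n → t. Fix m ≥ 1, distinct positive integers ℓ_1,…,ℓ_m, and nonnegative integers k_1,…,k_m. Then #{π ∈ PP(a_n,b_n,c_n) : c_{ℓ_i}(π) = k_i for all i = 1,…,m} / |PP(a_n,b_n,c_n)| → ∏_{i=1}^{m} e^{−t} t^{k_i} / k_i! as n → ∞. In particular, each c_ℓ(π) converges in distribution to Poisson(t) and the levels become asymptotically independent. -/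
open scoped BigOperators

/-- A plane partition: a matrix of naturals (0-indexed) with weakly decreasing rows and
columns and finitely many nonzero entries. -/
structure PlanePartition where
  entry : ℕ → ℕ → ℕ
  row_decr : ∀ i j, entry i (j + 1) ≤ entry i j
  col_decr : ∀ i j, entry (i + 1) j ≤ entry i j
  finite_support : {p : ℕ × ℕ | entry p.1 p.2 ≠ 0}.Finite

namespace PlanePartition

/-- `π` has at most `b` (nonzero) rows. -/
def rowsLE (π : PlanePartition) (b : ℕ) : Prop := ∀ i j, b ≤ i → π.entry i j = 0

/-- `π` has at most `a` (nonzero) columns. -/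
def colsLE (π : PlanePartition) (a : ℕ) : Prop := ∀ i j, a ≤ j → π.entry i j = 0

/-- all entries of `π` are at most `c`. -/
def entriesLE (π : PlanePartition) (c : ℕ) : Prop := ∀ i j, π.entry i j ≤ c

/-- the number of columns of `π` containing the entry `ℓ`. -/
noncomputable def cCol (π : PlanePartition) (ℓ : ℕ) : ℕ :=
  {j | ∃ i, π.entry i j = ℓ}.ncard

/-- the length of the `i`-th row of `π` (0-indexed); this is the `(i+1)`-st part of
the shape of `π`. -/
noncomputable def rowLen (π : PlanePartition) (i : ℕ) : ℕ :=
  {j | 0 < π.entry i j}.ncard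

/-- `d_{iℓ} = #{j : π_{ij} = ℓ > π_{i+1,j}}`; the row index `i` is 0-indexed
while `ℓ` denotes the actual value. -/
noncomputable def phi (π : PlanePartition) (i ℓ : ℕ) : ℕ :=
  {j | π.entry i j = ℓ ∧ π.entry (i + 1) j < ℓ}.ncard

/-- `Φ(π)` as a 0-indexed matrix: entry `(i, l)` counts `j` with `π_{ij} = l+1 > π_{i+1,j}`. -/
noncomputable def phiMatrix (π : PlanePartition) : ℕ → ℕ → ℕ :=
  fun i l => π.phi i (l + 1)

/-- `π` has shape `μ`. -/
def hasShape (π : PlanePartition) (μ : YoungDiagram) : Prop :=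
  ∀ i j, 0 < π.entry i j ↔ (i, j) ∈ μ

/-- the descent set of `π` (0-indexed positions). -/
def des (π : PlanePartition) : Set (ℕ × ℕ) :=
  {p | π.entry (p.1 + 1) p.2 < π.entry p.1 p.2}

end PlanePartition

/-- the set of plane partitions with at most `a` columns, at most `b` rows
and entries at most `c`. -/
def PP (a b c : ℕ) : Set PlanePartition :=
  {π | π.colsLE a ∧ π.rowsLE b ∧ π.entriesLE c}

/-- `PP(∞, b, c)`: plane partitions with at most `b` rows and entries at most `c`. -/
def PPinf (b c : ℕ) : Set PlanePartition :=
  {π | π.rowsLE b ∧ π.entriesLE c}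

/-- a monotone lattice path (as a list of points) from `s` to `t`. -/
def IsMonPath (L : List (ℕ × ℕ)) (s t : ℕ × ℕ) : Prop :=
  L.head? = some s ∧ L.getLast? = some t ∧
    L.Chain' fun p q => q = (p.1 + 1, p.2) ∨ q = (p.1, p.2 + 1)

/-- the last passage time: the maximal weight of a monotone path from `s` to `t`
in the matrix `d`. -/
noncomputable def lastPassage (d : ℕ → ℕ → ℕ) (s t : ℕ × ℕ) : ℕ :=
  sSup {n | ∃ L, IsMonPath L s t ∧ n = (L.map fun p => d p.1 p.2).sum}

/-- `b×c` matrices of naturals (as functions vanishing off `[0,b) × [0,c)`) whose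
last passage time `G(b,c)` is at most `a`. -/
def BM (a b c : ℕ) : Set (ℕ → ℕ → ℕ) :=
  {d | (∀ i j, b ≤ i → d i j = 0) ∧ (∀ i j, c ≤ j → d i j = 0) ∧
    lastPassage d (0, 0) (b - 1, c - 1) ≤ a}

/-- the rectangular Young diagram of the partition `(a^b)` (with `b` rows of length `a`). -/
def rectDiagram (a b : ℕ) : YoungDiagram where
  cells := Finset.range b ×ˢ Finset.range a
  isLowerSet := by
    intro p q hle hp
    simp only [Finset.coe_product, Set.mem_prod, Finset.mem_coe, Finset.mem_range] at hp ⊢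
    exact ⟨lt_of_le_of_lt hle.1 hp.1, lt_of_le_of_lt hle.2 hp.2⟩

/-- the variables `(1^b, x_1, x_2, …)`: the first `b` variables are specialized to `1`. -/
def oneExtend (b : ℕ) (x : ℕ → ℝ) : ℕ → ℝ :=
  fun i => if i < b then 1 else x (i - b)

/-- the Schur polynomial `s_μ(x_1, …, x_N)` evaluated at real arguments;
variables are 0-indexed (`x ℓ` is the variable `x_{ℓ+1}`), as are tableau entries. -/
noncomputable def schur (μ : YoungDiagram) (N : ℕ) (x : ℕ → ℝ) : ℝ :=
  ∑ᶠ T ∈ {T : SemistandardYoungTableau μ | ∀ i j, (i, j) ∈ μ → T i j < N},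
    ∏ p ∈ μ.cells, x (T p.1 p.2)

/-- the dual symmetric Grothendieck polynomial `g_μ(x_1, …, x_n)` evaluated at real
arguments; variables are 0-indexed (`x ℓ` is the variable `x_{ℓ+1}`). -/
noncomputable def grothG (μ : YoungDiagram) (n : ℕ) (x : ℕ → ℝ) : ℝ :=
  ∑ᶠ π ∈ {π : PlanePartition | π.hasShape μ ∧ π.entriesLE n},
    ∏ ℓ ∈ Finset.range n, x ℓ ^ π.cCol (ℓ + 1)

/-- the elementary symmetric polynomial `e_m(x_1, …, x_n)` evaluated at real arguments. -/
noncomputable def esym (n : ℕ) (x : ℕ → ℝ) (m : ℕ) : ℝ :=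
  ∑ S ∈ (Finset.range n).powersetCard m, ∏ i ∈ S, x i

/-- `e_m` for an integer index `m`, with `e_m = 0` for `m < 0`. -/
noncomputable def esymZ (n : ℕ) (x : ℕ → ℝ) (m : ℤ) : ℝ :=
  if 0 ≤ m then esym n x m.toNat else 0

/-- the weight `∏_{(i,j) ∈ Des(π)} q_{π_{ij}}`; the parameters are 0-indexed
(`q ℓ` is the parameter `q_{ℓ+1}`). -/
noncomputable def desWeight (π : PlanePartition) (q : ℕ → ℝ) : ℝ :=
  ∏ᶠ p ∈ π.des, q (π.entry p.1 p.2 - 1)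

/-- the probability of a configuration `w` of a `b×c` matrix of i.i.d. Geom(q) entries,
where `P(entry = k) = (1-q) qᵏ`. -/
noncomputable def geomWeight (q : ℝ) (b c : ℕ) (w : Fin b × Fin c → ℕ) : ℝ :=
  ∏ p : Fin b × Fin c, ((1 - q) * q ^ w p)

/-- extend a `b×c` matrix to an `ℕ × ℕ`-indexed matrix by zero. -/
def matExt {b c : ℕ} (w : Fin b × Fin c → ℕ) : ℕ → ℕ → ℕ :=
  fun i j => if h : i < b ∧ j < c then w (⟨i, h.1⟩, ⟨j, h.2⟩) else 0

section
open Finset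

def antiF {a : ℕ} (h : Fin a → ℕ) : Finset (Fin a → ℕ) := by
  classical exact (Finset.Iic h).filter Antitone

lemma mem_antiF {a : ℕ} {h h' : Fin a → ℕ} : h' ∈ antiF h ↔ h' ≤ h ∧ Antitone h' := by
  simp [antiF]

lemma antitone_cons {a : ℕ} (m : ℕ) (g : Fin a → ℕ) :
    Antitone (Fin.cons m g : Fin (a+1) → ℕ) ↔ Antitone g ∧ Finset.univ.sup g ≤ m := by
  constructor
  · intro H
    refine ⟨fun i j hij => ?_, ?_⟩
    · have := H (Fin.succ_le_succ_iff.2 hij)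
      simpa using this
    · refine Finset.sup_le fun i _ => ?_
      have := H (Fin.zero_le i.succ)
      simpa using this
  · rintro ⟨H, H2⟩ i j hij
    induction i using Fin.cases with
    | zero =>
      induction j using Fin.cases with
      | zero => exact le_rfl
      | succ j => simpa using (Finset.le_sup (f := g) (Finset.mem_univ j)).trans H2
    | succ i =>
      induction j using Fin.cases with
      | zero => simp at hij
      | succ j => simpa using H (Fin.succ_le_succ_iff.1 hij)

lemma sum_antiF_succ {R : Type*} [AddCommMonoid R] {a : ℕ} (h : Fin (a+1) → ℕ)
    (g : (Fin (a+1) → ℕ) → R) :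
    ∑ h' ∈ antiF h, g h' = ∑ h'' ∈ antiF (Fin.tail h),
      ∑ m ∈ Finset.Icc (Finset.univ.sup h'') (h 0), g (Fin.cons m h'') := by
  rw [Finset.sum_sigma']
  refine Finset.sum_bij' (fun h' _ => ⟨Fin.tail h', h' 0⟩) (fun p _ => Fin.cons p.2 p.1) ?_ ?_ ?_ ?_ ?_
  · intro h' hh
    rw [mem_antiF] at hh
    have h2 := hh.2
    rw [← Fin.cons_self_tail h', antitone_cons] at h2
    simp only [Finset.mem_sigma, mem_antiF, Finset.mem_Icc]
    exact ⟨⟨fun i => hh.1 i.succ, h2.1⟩, h2.2, hh.1 0⟩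
  · rintro ⟨p, m⟩ hh
    simp only [Finset.mem_sigma, mem_antiF, Finset.mem_Icc] at hh
    rw [mem_antiF, antitone_cons]
    refine ⟨fun i => ?_, hh.1.2, hh.2.1⟩
    refine Fin.cases ?_ (fun i => ?_) i
    · simpa using hh.2.2
    · simpa [Fin.tail] using hh.1.1 i
  · intro h' _; simp
  · rintro ⟨p, m⟩ _; simp
  · intro h' _; simp

lemma curry_sum {R V : Type*} [CommRing R] [AddCommGroup V] [Module R V] {a : ℕ}
    (A : V [⋀^Fin (a+1)]→ₗ[R] R) (s : Finset ℕ) (f : ℕ → V) (w : Fin a → V) :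
    (A.curryLeft (∑ m ∈ s, f m)) w = ∑ m ∈ s, (A.curryLeft (f m)) w := by
  induction s using Finset.induction_on with
  | empty => simp
  | insert m s hm ih =>
    rw [Finset.sum_insert hm, Finset.sum_insert hm, map_add, AlternatingMap.add_apply, ih]

lemma step_lemma {R V : Type*} [CommRing R] [AddCommGroup V] [Module R V] (x : R) :
    ∀ (a : ℕ) (A : V [⋀^Fin a]→ₗ[R] R) (u : ℕ → ℕ → V)
      (_ : ∀ i n, u (i+1) (n+1) = u (i+1) n + u i n) (_ : u a 0 = 0)
      (h : Fin a → ℕ) (_ : Antitone h),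
      ∑ h' ∈ antiF h, x ^ (Finset.univ.filter fun j => h' j < h j).card
          * A (fun i => u i (h' i))
        = A (fun i => u i (h i) + x • u (i+1) (h i)) := by
  intro a
  induction a with
  | zero =>
    intro A u hu h0 h hh
    have : antiF h = {h} := by
      ext g; simp only [mem_antiF, Finset.mem_singleton]
      constructor
      · intro _; exact Subsingleton.elim _ _
      · rintro rfl; exact ⟨le_rfl, hh⟩
    rw [this]
    simp
    congr 1
    exact Subsingleton.elim _ _
  | succ a ih =>
    intro A u hu h0 h hh
    rw [sum_antiF_succ]
    have tel : ∀ i l n, l ≤ n → ∑ k ∈ Finset.Ico l n, u i k = u (i+1) n - u (i+1) l := by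
      intro i l n hl
      induction n, hl using Nat.le_induction with
      | base => simp
      | succ n hn ih2 => rw [Finset.sum_Ico_succ_top hn, ih2, hu i n]; abel
    have hht : Antitone (Fin.tail h) := fun i j hij => hh (Fin.succ_le_succ_iff.2 hij)
    have key := ih (A.curryLeft (u 0 (h 0) + x • u 1 (h 0))) (fun i => u (i+1))
      (fun i n => hu (i+1) n) h0 (Fin.tail h) hht
    have e1 : A (fun i : Fin (a+1) => u i (h i) + x • u (i+1) (h i)) =
       (A.curryLeft (u 0 (h 0) + x • u 1 (h 0))) (fun i : Fin a => u (i+1) (Fin.tail h i) + x • u (i+1+1) (Fin.tail h i)) := by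
      rw [AlternatingMap.curryLeft_apply_apply]
      congr 1
      funext i
      refine Fin.cases ?_ (fun i => ?_) i <;> simp [Fin.tail, Matrix.vecCons]
    rw [e1, ← key]
    refine Finset.sum_congr rfl fun h'' hh'' => ?_
    rw [mem_antiF] at hh''
    set l := Finset.univ.sup h'' with hl
    have hl0 : l ≤ h 0 := by
      refine Finset.sup_le fun i _ => (hh''.1 i).trans (hh (Fin.zero_le _))
    -- the card
    have hcard : ∀ m, (Finset.univ.filter fun j => (Fin.cons m h'' : Fin (a+1) → ℕ) j < h j).card
        = (if m < h 0 then 1 else 0) + (Finset.univ.filter fun j => h'' j < Fin.tail h j).card := by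
      intro m
      rw [Finset.card_filter, Finset.card_filter, Fin.sum_univ_succ]
      simp only [Fin.cons_zero, Fin.cons_succ, Fin.tail]
      rfl
    have hA : ∀ m, A (fun i : Fin (a+1) => u i ((Fin.cons m h'' : Fin (a+1) → ℕ) i)) =
        (A.curryLeft (u 0 m)) (fun i : Fin a => u (i+1) (h'' i)) := by
      intro m
      rw [AlternatingMap.curryLeft_apply_apply]
      congr 1
      funext i
      refine Fin.cases ?_ (fun i => ?_) i <;> simp [Matrix.vecCons]
    have hvan : (A.curryLeft (u 1 l)) (fun i : Fin a => u (i+1) (h'' i)) = 0 := by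
      rcases a with _ | a
      · have : l = 0 := by simp [hl]
        rw [this]
        simp at h0
        simp [h0]
      · have : l = h'' 0 := by
          apply le_antisymm
          · exact Finset.sup_le fun i _ => hh''.2 (Fin.zero_le i)
          · exact Finset.le_sup (f := h'') (Finset.mem_univ 0)
        rw [AlternatingMap.curryLeft_apply_apply]
        refine A.map_eq_zero_of_eq _ (i := 0) (j := 1) ?_ (by simp)
        simp [Matrix.vecCons, this]
    have : Finset.Icc l (h 0) = insert (h 0) (Finset.Ico l (h 0)) := by
      rw [Finset.Ico_insert_right hl0]
    rw [this, Finset.sum_insert (by simp)]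
    have e3 : ∀ m ∈ Finset.Ico l (h 0), x ^ (Finset.univ.filter fun j => (Fin.cons m h'' : Fin (a+1) → ℕ) j < h j).card
          * A (fun i => u i ((Fin.cons m h'' : Fin (a+1) → ℕ) i)) =
          x ^ (Finset.univ.filter fun j => h'' j < Fin.tail h j).card * (x * 
            (A.curryLeft (u 0 m)) (fun i : Fin a => u (i+1) (h'' i))) := by
      intro m hm
      rw [Finset.mem_Ico] at hm
      rw [hcard, hA, if_pos hm.2, pow_add]; ring
    rw [Finset.sum_congr rfl e3, hcard, hA, if_neg (lt_irrefl _), ← Finset.mul_sum, zero_add, ← mul_add]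
    congr 1
    rw [← Finset.mul_sum]
    have e4 : ∑ m ∈ Finset.Ico l (h 0), (A.curryLeft (u 0 m)) (fun i : Fin a => u (i+1) (h'' i))
       = (A.curryLeft (u 1 (h 0))) (fun i : Fin a => u (i+1) (h'' i)) := by
      have := tel 0 l (h 0) hl0
      have h2 := congrArg (fun v => (A.curryLeft v) (fun i : Fin a => u (i+1) (h'' i))) this
      simp only [curry_sum, map_sub, AlternatingMap.sub_apply] at h2
      simp only [zero_add] at h2
      rw [hvan, sub_zero] at h2
      exact h2
    rw [e4, map_add, map_smul, AlternatingMap.add_apply, AlternatingMap.smul_apply, smul_eq_mul]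

def Zf {R : Type*} [CommRing R] {a : ℕ} : List R → (Fin a → ℕ) → R
  | [], h => if h = 0 then 1 else 0
  | x :: xs, h => ∑ h' ∈ antiF h,
      x ^ (Finset.univ.filter fun j => h' j < h j).card * Zf xs h'

def Bf (i j : ℕ) : ℕ → ℤ
  | 0 => if i ≤ j then (-1) ^ (j - i) else 0
  | n+1 => if j + 1 ≤ i then (n.choose (i - 1 - j) : ℤ) else 0

lemma Bf_succ (i j n : ℕ) : Bf (i+1) j (n+1) = Bf (i+1) j n + Bf i j n := by
  rcases n with _ | n
  · simp only [Bf]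
    rcases lt_trichotomy i j with h | h | h
    · obtain ⟨d, rfl⟩ := Nat.exists_eq_add_of_lt h
      have e1 : i + d + 1 - (i+1) = d := by omega
      have e2 : i + d + 1 - i = d + 1 := by omega
      rw [if_neg (by omega), if_pos (by omega), if_pos (by omega), e1, e2, pow_succ]; ring
    · subst h; simp
    · obtain ⟨d, rfl⟩ := Nat.exists_eq_add_of_lt h
      have e1 : j + d + 1 + 1 - 1 - j = d + 1 := by omega
      rw [if_pos (by omega), if_neg (by omega), if_neg (by omega), e1]; simp
  · simp only [Bf]
    rcases lt_trichotomy i j with h | h | h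
    · rw [if_neg (by omega), if_neg (by omega), if_neg (by omega)]; simp
    · subst h; simp
    · obtain ⟨d, rfl⟩ := Nat.exists_eq_add_of_lt h
      have e1 : j + d + 1 + 1 - 1 - j = d + 1 := by omega
      have e2 : j + d + 1 - 1 - j = d := by omega
      rw [if_pos (by omega), if_pos (by omega), if_pos (by omega), e1, e2, Nat.choose_succ_succ]
      push_cast; ring

def Pf {R : Type*} [CommRing R] : List R → ℕ → ℕ → ℕ → R
  | [], i, j, n => (Bf i j n : R)
  | x :: xs, i, j, n => Pf xs i j n + x * Pf xs (i+1) j n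

lemma Pf_succ {R : Type*} [CommRing R] (xs : List R) : ∀ i j n : ℕ, 
    Pf xs (i+1) j (n+1) = Pf xs (i+1) j n + Pf xs i j n := by
  induction xs with
  | nil => intro i j n; simp only [Pf]; rw [Bf_succ]; push_cast; ring
  | cons x xs ih => intro i j n; simp only [Pf]; rw [ih, ih]; ring

lemma Pf_zero {R : Type*} [CommRing R] (xs : List R) : ∀ i j : ℕ, j < i → Pf xs i j 0 = 0 := by
  induction xs with
  | nil => intro i j h; simp only [Pf, Bf]; rw [if_neg (by omega)]; simp
  | cons x xs ih => intro i j h; simp only [Pf]; rw [ih _ _ h, ih _ _ (by omega)]; ring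

lemma Pf_perm {R : Type*} [CommRing R] {xs ys : List R} (h : xs.Perm ys) :
    ∀ i j n : ℕ, Pf xs i j n = Pf ys i j n := by
  induction h with
  | nil => intros; rfl
  | cons x _ ih => intro i j n; simp only [Pf]; rw [ih, ih]
  | swap x y l => intro i j n; simp only [Pf]; ring
  | trans _ _ ih1 ih2 => intro i j n; rw [ih1, ih2]

lemma Zf_eq_det {R : Type*} [CommRing R] {a : ℕ} (xs : List R) :
    ∀ h : Fin a → ℕ, Antitone h →
      Zf xs h = Matrix.det (Matrix.of fun i j : Fin a => Pf xs i j (h i)) := by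
  induction xs with
  | nil =>
    intro h hh
    simp only [Zf, Pf]
    split_ifs with h0
    · subst h0
      rw [Matrix.det_of_isUpperTriangular]
      · simp [Bf]
      · intro i j hij
        simp only [id] at hij
        simp only [Matrix.of_apply, Bf]
        rw [if_neg (by simpa using hij)]; simp
    · rcases a with _ | a
      · exact absurd (Subsingleton.elim _ _) h0
      · symm
        apply Matrix.det_eq_zero_of_row_eq_zero 0
        intro j
        have : h 0 ≠ 0 := by
          intro h1; apply h0; funext i
          have := hh (Fin.zero_le i)
          simp; omega
        obtain ⟨n, hn⟩ := Nat.exists_eq_succ_of_ne_zero this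
        simp [hn, Bf]
  | cons x xs ih =>
    intro h hh
    simp only [Zf]
    have key := step_lemma x a (Matrix.detRowAlternating (n := Fin a) (R := R))
      (fun i n => fun j : Fin a => Pf xs i j n) (by intro i n; funext j; simp [Pf_succ])
      (by funext j; simp [Pf_zero xs a j j.2]) h hh
    have e : Matrix.det (Matrix.of fun i j : Fin a => Pf (x::xs) i j (h i)) =
      Matrix.detRowAlternating (fun i : Fin a => (fun j : Fin a => Pf xs i j (h i)) + x • (fun j : Fin a => Pf xs (i+1) j (h i))) := by
      rfl
    rw [e, ← key]
    refine Finset.sum_congr rfl fun h' hh' => ?_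
    rw [ih h' (mem_antiF.1 hh').2]
    rfl

lemma Zf_perm {R : Type*} [CommRing R] {a : ℕ} {xs ys : List R} (hp : xs.Perm ys)
    (h : Fin a → ℕ) (hh : Antitone h) : Zf xs h = Zf ys h := by
  rw [Zf_eq_det xs h hh, Zf_eq_det ys h hh]
  simp only [Pf_perm hp]

end

section
open Finset

namespace PlanePartition

theorem ext' {p q : PlanePartition} (h : ∀ i j, p.entry i j = q.entry i j) : p = q := by
  cases p; cases q
  congr
  funext i j; exact h i j

lemma anti_col (p : PlanePartition) (j : ℕ) : Antitone fun i => p.entry i j :=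
  antitone_nat_of_succ_le fun i => p.col_decr i j

lemma anti_row (p : PlanePartition) (i : ℕ) : Antitone fun j => p.entry i j :=
  antitone_nat_of_succ_le fun j => p.row_decr i j

lemma exists_zero (p : PlanePartition) (j : ℕ) : ∃ i, p.entry i j = 0 := by
  by_contra hcon
  push Not at hcon
  have : Set.Infinite {q : ℕ × ℕ | p.entry q.1 q.2 ≠ 0} := by
    refine Set.infinite_of_injective_forall_mem (f := fun i : ℕ => (i, j)) ?_ ?_
    · intro a b h; simpa using h
    · intro i; exact hcon i
  exact this p.finite_support

open Classical in
noncomputable def hgt (p : PlanePartition) (j : ℕ) : ℕ := Nat.find (p.exists_zero j)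

lemma lt_hgt (p : PlanePartition) (i j : ℕ) : i < p.hgt j ↔ 0 < p.entry i j := by
  classical
  unfold hgt
  rw [Nat.lt_find_iff]
  constructor
  · intro h; exact Nat.pos_of_ne_zero (h i le_rfl)
  · intro h m hm h0
    have := p.anti_col j hm
    simp only at this
    omega

lemma hgt_eq (p : PlanePartition) (j n : ℕ) (h : ∀ i, i < n ↔ 0 < p.entry i j) : p.hgt j = n := by
  apply le_antisymm
  · by_contra hc
    push Not at hc
    rw [lt_hgt, ← h] at hc; omega
  · by_contra hc
    push Not at hc
    rw [h, ← lt_hgt] at hc; omega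

lemma hgt_anti (p : PlanePartition) : Antitone p.hgt := by
  intro i j hij
  by_contra hc
  push Not at hc
  rw [lt_hgt] at hc
  have := p.anti_row (p.hgt i) hij
  simp only at this
  have h2 := (p.lt_hgt (p.hgt i) i).2 (by omega)
  omega

/-- extension of a height function by zero -/
def hext {a : ℕ} (h : Fin a → ℕ) (j : ℕ) : ℕ := if hj : j < a then h ⟨j, hj⟩ else 0

lemma hext_anti {a : ℕ} (h : Fin a → ℕ) (hh : Antitone h) : Antitone (hext h) := by
  intro i j hij
  unfold hext
  split_ifs with h1 h2
  · exact hh hij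
  · omega
  · exact Nat.zero_le _
  · exact le_rfl

/-- add one to each entry over the shape `h`, kill all others -/
def lift {a : ℕ} (h : Fin a → ℕ) (hh : Antitone h) (p : PlanePartition) : PlanePartition where
  entry i j := if i < hext h j then p.entry i j + 1 else 0
  row_decr i j := by
    have h1 := hext_anti h hh (Nat.le_succ j)
    have h2 := p.row_decr i j
    simp only [Nat.succ_eq_add_one] at h1
    split_ifs <;> omega
  col_decr i j := by
    have h2 := p.col_decr i j
    split_ifs <;> omega
  finite_support := by
    refine Set.Finite.subset ((Finset.range (hext h 0) ×ˢ Finset.range a).finite_toSet) ?_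
    rintro ⟨i, j⟩ hij
    simp only [ne_eq, ite_eq_right_iff, Set.mem_ofPred_eq] at hij
    push Not at hij
    have h1 := hext_anti h hh (Nat.zero_le j)
    simp only [Finset.coe_product, Set.mem_prod, Finset.mem_coe, Finset.mem_range]
    refine ⟨lt_of_lt_of_le hij.1 h1, ?_⟩
    by_contra hc
    have : hext h j = 0 := by unfold hext; rw [dif_neg hc]
    omega

def zeroP : PlanePartition where
  entry _ _ := 0
  row_decr _ _ := le_rfl
  col_decr _ _ := le_rfl
  finite_support := by simp

open Classical in
noncomputable def ppf {a : ℕ} : ℕ → (Fin a → ℕ) → Finset PlanePartition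
  | 0, h => if h = 0 then {zeroP} else ∅
  | n+1, h => if hh : Antitone h then
      (antiF h).biUnion fun h' => (ppf n h').image (lift h hh) else ∅

def good {a : ℕ} (n : ℕ) (h : Fin a → ℕ) (p : PlanePartition) : Prop :=
  p.entriesLE n ∧ ∀ j, p.hgt j = hext h j

lemma lift_hgt {a : ℕ} (h : Fin a → ℕ) (hh : Antitone h) (p : PlanePartition) (j : ℕ) :
    (lift h hh p).hgt j = hext h j := by
  apply hgt_eq
  intro i
  simp only [lift]
  split_ifs <;> omega

/-- subtract one from all entries -/
def lower (p : PlanePartition) : PlanePartition where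
  entry i j := p.entry i j - 1
  row_decr i j := Nat.sub_le_sub_right (p.row_decr i j) 1
  col_decr i j := Nat.sub_le_sub_right (p.col_decr i j) 1
  finite_support := p.finite_support.subset (by
    rintro ⟨i, j⟩ h
    simp only [ne_eq, Set.mem_ofPred_eq] at h ⊢
    omega)

lemma hext_inj {a : ℕ} {h h' : Fin a → ℕ} (H : ∀ j, hext h j = hext h' j) : h = h' := by
  funext j
  have := H j
  simpa [hext] using this

lemma lower_lift {a : ℕ} (h : Fin a → ℕ) (hh : Antitone h) (p : PlanePartition)
    (H : ∀ j, p.hgt j ≤ hext h j) : lower (lift h hh p) = p := by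
  apply ext'
  intro i j
  simp only [lower, lift]
  split_ifs with h1
  · simp
  · have := (p.lt_hgt i j).not.1 (by have := H j; omega)
    omega

lemma lift_lower {a : ℕ} (h : Fin a → ℕ) (hh : Antitone h) (p : PlanePartition)
    (H : ∀ j, p.hgt j = hext h j) : lift h hh (lower p) = p := by
  apply ext'
  intro i j
  simp only [lower, lift]
  have := p.lt_hgt i j
  rw [H j] at this
  split_ifs with h1
  · have := this.1 h1; omega
  · have := this.not.1 h1; omega

lemma hext_mono {a : ℕ} {h h' : Fin a → ℕ} (H : h' ≤ h) (j : ℕ) : hext h' j ≤ hext h j := by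
  unfold hext
  split_ifs with h1
  · exact H _
  · exact le_rfl

lemma mem_ppf {a : ℕ} (n : ℕ) : ∀ (h : Fin a → ℕ) (_ : Antitone h) (p : PlanePartition),
    p ∈ ppf n h ↔ good n h p := by
  classical
  induction n with
  | zero =>
    intro h hh p
    simp only [ppf]
    constructor
    · split_ifs with h0
      · intro hp
        rw [Finset.mem_singleton] at hp
        subst hp; subst h0
        refine ⟨fun i j => le_rfl, fun j => ?_⟩
        apply hgt_eq
        intro i
        simp [hext, zeroP]
      · simp
    · rintro ⟨h1, h2⟩
      have e : p = zeroP := ext' fun i j => by have := h1 i j; simp [zeroP]; omega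
      have h0 : h = 0 := by
        apply hext_inj
        intro j
        rw [← h2 j]
        subst e
        apply hgt_eq
        intro i
        simp [hext, zeroP]
      rw [if_pos h0, e, Finset.mem_singleton]
  | succ n ih =>
    intro h hh p
    simp only [ppf, dif_pos hh, Finset.mem_biUnion, Finset.mem_image]
    constructor
    · rintro ⟨h', hh', q, hq, rfl⟩
      rw [mem_antiF] at hh'
      rw [ih h' hh'.2] at hq
      refine ⟨fun i j => ?_, lift_hgt h hh q⟩
      have := hq.1 i j
      simp only [lift]; split_ifs <;> omega
    · rintro ⟨h1, h2⟩
      have hz : ∀ j, a ≤ j → p.hgt j = 0 := by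
        intro j hj; rw [h2, hext, dif_neg (by omega)]
      have hle : ∀ j, (lower p).hgt j ≤ p.hgt j := by
        intro j
        by_contra hc
        push Not at hc
        rw [lt_hgt] at hc
        simp only [lower] at hc
        have := (p.lt_hgt (p.hgt j) j).2 (by omega)
        omega
      have hex : ∀ j, (lower p).hgt j = hext (fun j : Fin a => (lower p).hgt j) j := by
        intro j
        unfold hext
        split_ifs with hj
        · rfl
        · have := hle j; have := hz j (by omega); omega
      have han : Antitone (fun j : Fin a => (lower p).hgt j) := fun i j hij => (lower p).hgt_anti hij
      refine ⟨fun j => (lower p).hgt j, ?_, lower p, ?_, lift_lower h hh p h2⟩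
      · rw [mem_antiF]
        refine ⟨fun j => ?_, han⟩
        have h3 := hle j
        rw [h2 j] at h3
        simpa [hext] using h3
      · rw [ih _ han]
        refine ⟨fun i j => ?_, hex⟩
        have := h1 i j
        simp only [lower]; omega

lemma cCol_lift_one {a : ℕ} (h h' : Fin a → ℕ) (hh : Antitone h) (p : PlanePartition)
    (H : ∀ j, p.hgt j = hext h' j) :
    (lift h hh p).cCol 1 = (Finset.univ.filter fun j => h' j < h j).card := by
  classical
  unfold cCol
  have : {j | ∃ i, (lift h hh p).entry i j = 1} =
      (((Finset.univ.filter fun j => h' j < h j).map Fin.valEmbedding : Finset ℕ) : Set ℕ) := by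
    ext j
    simp only [Set.mem_ofPred_eq, lift, Finset.coe_map, Finset.coe_filter, Finset.mem_univ,
      true_and, Set.mem_image, Fin.valEmbedding_apply]
    constructor
    · rintro ⟨i, hi⟩
      split_ifs at hi with h1
      have h2 : ¬ i < p.hgt j := by rw [lt_hgt]; omega
      rw [H j] at h2
      have hj : j < a := by
        by_contra hc
        rw [hext, dif_neg hc] at h1; omega
      rw [hext, dif_pos hj] at h1 h2
      exact ⟨⟨j, hj⟩, by omega, rfl⟩
    · rintro ⟨j, hj, rfl⟩
      refine ⟨h' j, ?_⟩
      rw [if_pos (by simpa [hext] using hj)]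
      have h2 : ¬ h' j < p.hgt j := by rw [H j]; simp [hext]
      rw [lt_hgt] at h2
      omega
  rw [this, Set.ncard_coe_finset, Finset.card_map]

lemma cCol_lift_succ {a : ℕ} (h : Fin a → ℕ) (hh : Antitone h) (p : PlanePartition)
    (H : ∀ j, p.hgt j ≤ hext h j) (v : ℕ) :
    (lift h hh p).cCol (v+2) = p.cCol (v+1) := by
  unfold cCol
  congr 1
  ext j
  simp only [Set.mem_ofPred_eq, lift]
  refine exists_congr fun i => ?_
  have h1 := p.lt_hgt i j
  have h2 := H j
  split_ifs with h3
  · omega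
  · constructor
    · intro h5; exact h5.elim
    · intro h4
      have := h1.2 (by omega)
      omega

lemma sum_ppf {R : Type*} [CommRing R] {a : ℕ} (n : ℕ) :
    ∀ (x : ℕ → R) (h : Fin a → ℕ) (_ : Antitone h),
    ∑ p ∈ ppf n h, ∏ v ∈ Finset.range n, x v ^ p.cCol (v+1)
      = Zf ((List.range n).map x) h := by
  classical
  induction n with
  | zero =>
    intro x h hh
    simp only [ppf, Finset.range_zero, Finset.prod_empty, List.range_zero, List.map_nil, Zf]
    split_ifs <;> simp
  | succ n ih =>
    intro x h hh
    rw [List.range_succ_eq_map, List.map_cons, List.map_map]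
    simp only [ppf, dif_pos hh, Zf]
    rw [Finset.sum_biUnion]
    · refine Finset.sum_congr rfl fun h' hh' => ?_
      rw [mem_antiF] at hh'
      have hle : ∀ q ∈ ppf n h', ∀ j, q.hgt j ≤ hext h j := by
        intro q hq j
        rw [((mem_ppf n h' hh'.2 q).1 hq).2 j]
        exact hext_mono hh'.1 j
      rw [Finset.sum_image, ← ih _ h' hh'.2, Finset.mul_sum]
      · refine Finset.sum_congr rfl fun q hq => ?_
        rw [Finset.prod_range_succ', mul_comm, zero_add,
          cCol_lift_one h h' hh q ((mem_ppf n h' hh'.2 q).1 hq).2]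
        congr 1
        refine Finset.prod_congr rfl fun v _ => ?_
        rw [cCol_lift_succ h hh q (hle q hq)]; rfl
      · intro q hq q' hq' e
        rw [← lower_lift h hh q (hle q hq), ← lower_lift h hh q' (hle q' hq'), e]
    · intro h1 hh1 h2 hh2 hne
      rw [Finset.mem_coe, mem_antiF] at hh1 hh2
      rw [Function.onFun, Finset.disjoint_left]
      intro p hp1 hp2
      rw [Finset.mem_image] at hp1 hp2
      obtain ⟨q, hq, rfl⟩ := hp1
      obtain ⟨q', hq', e⟩ := hp2
      rw [mem_ppf n _ hh1.2] at hq
      rw [mem_ppf n _ hh2.2] at hq'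
      have e2 := congrArg lower e
      rw [lower_lift h hh q (fun j => by rw [hq.2 j]; exact hext_mono hh1.1 j),
        lower_lift h hh q' (fun j => by rw [hq'.2 j]; exact hext_mono hh2.1 j)] at e2
      subst e2
      exact hne (hext_inj fun j => by rw [← hq.2 j, ← hq'.2 j])

open Classical in
/-- finset version of `PP` -/
noncomputable def PPfin (a b c : ℕ) : Finset PlanePartition :=
  (antiF (fun _ : Fin a => b)).biUnion fun h => ppf c h

lemma mem_PPfin (a b c : ℕ) (p : PlanePartition) : p ∈ PPfin a b c ↔ p ∈ PP a b c := by
  classical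
  simp only [PPfin, Finset.mem_biUnion]
  constructor
  · rintro ⟨h, hh, hp⟩
    rw [mem_antiF] at hh
    rw [mem_ppf c h hh.2] at hp
    refine ⟨fun i j hj => ?_, fun i j hi => ?_, hp.1⟩
    · have := (p.lt_hgt i j).not.1 (by rw [hp.2 j, hext, dif_neg (by omega)]; omega)
      omega
    · have := (p.lt_hgt i j).not.1 (by
        rw [hp.2 j, hext]; split_ifs with hj
        · have := hh.1 ⟨j, hj⟩; simp only at this; omega
        · omega)
      omega
  · rintro ⟨h1, h2, h3⟩
    have han : Antitone (fun j : Fin a => p.hgt j) := fun i j hij => p.hgt_anti hij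
    refine ⟨fun j => p.hgt j, ?_, ?_⟩
    · rw [mem_antiF]
      refine ⟨fun j => ?_, han⟩
      by_contra hc
      simp only [not_le] at hc
      rw [lt_hgt, h2 b j le_rfl] at hc
      omega
    · rw [mem_ppf c _ han]
      refine ⟨h3, fun j => ?_⟩
      unfold hext
      split_ifs with hj
      · rfl
      · apply hgt_eq
        intro i
        rw [h1 i j (by omega)]; omega

lemma coe_PPfin (a b c : ℕ) : (PPfin a b c : Set PlanePartition) = PP a b c := by
  ext p; simp [mem_PPfin]

lemma sum_PPfin {R : Type*} [CommRing R] (a b c : ℕ) (x : ℕ → R) :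
    ∑ p ∈ PPfin a b c, ∏ v ∈ Finset.range c, x v ^ p.cCol (v+1)
      = Zf (1 :: (List.range c).map x) (fun _ : Fin a => b) := by
  classical
  unfold PPfin
  rw [Finset.sum_biUnion]
  · simp only [Zf, one_pow, one_mul]
    refine Finset.sum_congr rfl fun h hh => ?_
    exact sum_ppf c x h (mem_antiF.1 hh).2
  · intro h1 hh1 h2 hh2 hne
    rw [Finset.mem_coe, mem_antiF] at hh1 hh2
    rw [Function.onFun, Finset.disjoint_left]
    intro p hp1 hp2
    rw [mem_ppf _ _ hh1.2] at hp1
    rw [mem_ppf _ _ hh2.2] at hp2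
    exact hne (hext_inj fun j => by rw [← hp1.2 j, ← hp2.2 j])

lemma list_perm_aux {R : Type*} [CommRing R] (c m : ℕ) (l : Fin m → ℕ)
    (hl : Function.Injective l) (hc : ∀ i, l i < c) (x : Fin m → R) :
    ((List.range c).map (Function.extend l x 1)).Perm
      (List.ofFn x ++ List.replicate (c - m) 1) := by
  classical
  rw [← Multiset.coe_eq_coe, ← Multiset.coe_add, ← Multiset.map_coe]
  have h1 : ((List.range c : List ℕ) : Multiset ℕ) = (Finset.range c).val := rfl
  have hsub : Finset.univ.image l ⊆ Finset.range c := by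
    intro v hv; simp at hv; obtain ⟨i, rfl⟩ := hv; simpa using hc i
  have h2 : (Finset.range c).val = (Finset.univ.image l).val + (Finset.range c \ Finset.univ.image l).val := by
    rw [← Finset.disjUnion_val _ _ Finset.disjoint_sdiff]
    congr 1
    rw [Finset.disjUnion_eq_union, Finset.union_sdiff_of_subset hsub]
  rw [h1, h2, Multiset.map_add]
  congr 1
  · rw [Finset.image_val_of_injOn hl.injOn, Multiset.map_map]
    have : (Function.extend l x 1) ∘ l = x := by
      funext i; exact hl.extend_apply _ _ _
    rw [this]
    have h3 : (Finset.univ : Finset (Fin m)).val = ((List.finRange m : List (Fin m)) : Multiset (Fin m)) := rfl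
    rw [h3, Multiset.map_coe, List.ofFn_eq_map]
  · rw [Multiset.coe_replicate]
    have h4 : (Finset.range c \ Finset.univ.image l).card = c - m := by
      rw [Finset.card_sdiff_of_subset hsub, Finset.card_range, Finset.card_image_of_injective _ hl]
      simp
    rw [← h4, Multiset.eq_replicate]
    refine ⟨by rw [Multiset.card_map]; rfl, ?_⟩
    intro y hy
    rw [Multiset.mem_map] at hy
    obtain ⟨v, hv, rfl⟩ := hy
    rw [Finset.mem_val, Finset.mem_sdiff] at hv
    rw [Function.extend_apply', Pi.one_apply]
    rintro ⟨i, rfl⟩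
    exact hv.2 (Finset.mem_image_of_mem _ (Finset.mem_univ _))

/-- generating function with weights on finitely many levels -/
lemma sum_levels {R : Type*} [CommRing R] (a b c m : ℕ) (l : Fin m → ℕ)
    (hl : Function.Injective l) (hc : ∀ i, 1 ≤ l i ∧ l i ≤ c) (x : Fin m → R) :
    ∑ p ∈ PPfin a b c, ∏ i, x i ^ p.cCol (l i)
      = Zf (List.ofFn x ++ List.replicate (c - m + 1) 1) (fun _ : Fin a => b) := by
  classical
  set l' : Fin m → ℕ := fun i => l i - 1 with hl'
  have hinj : Function.Injective l' := by
    intro i j hij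
    apply hl
    have := hc i; have := hc j
    simp only [hl'] at hij; omega
  have e := sum_PPfin a b c (Function.extend l' x 1)
  have hp : (1 :: (List.range c).map (Function.extend l' x 1)).Perm
      (List.ofFn x ++ List.replicate (c - m + 1) 1) := by
    refine ((list_perm_aux c m l' hinj (fun i => by have := hc i; simp only [hl']; omega) x).cons 1).trans ?_
    rw [List.replicate_succ]
    exact List.perm_middle.symm
  rw [Zf_perm hp _ (fun _ _ _ => le_rfl)] at e
  rw [← e]
  refine Finset.sum_congr rfl fun p _ => ?_
  have hsub : Finset.univ.image l' ⊆ Finset.range c := by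
    intro v hv
    simp only [Finset.mem_image, Finset.mem_univ, true_and] at hv
    obtain ⟨i, rfl⟩ := hv
    have := hc i; simp only [Finset.mem_range, hl']; omega
  rw [← Finset.prod_subset hsub, Finset.prod_image (fun i _ j _ h => hinj h)]
  · refine Finset.prod_congr rfl fun i _ => ?_
    rw [hinj.extend_apply]
    have := hc i
    congr 2
    simp only [hl']; omega
  · intro v _ hv
    rw [Function.extend_apply', Pi.one_apply, one_pow]
    rintro ⟨i, rfl⟩
    exact hv (Finset.mem_image_of_mem _ (Finset.mem_univ _))

end PlanePartition

end

section
open Finset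

def sk (p i : ℕ) : ℕ := if i < p then i else i + 1
def sk2 (p q i : ℕ) : ℕ := if i < p then i else if i + 1 < q then i + 1 else i + 2

lemma exp1 {R V : Type*} [CommRing R] [AddCommGroup V] [Module R V] (x : R) :
    ∀ (m : ℕ) (A : V [⋀^Fin m]→ₗ[R] R) (U : ℕ → V),
      A (fun i : Fin m => U i + x • U (i+1)) =
        ∑ p ∈ range (m+1), x ^ (m - p) * A (fun i => U (sk p i)) := by
  intro m
  induction m with
  | zero => 
    intro A U
    simp
    congr 1
    exact Subsingleton.elim _ _
  | succ m ih =>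
    intro A U
    have e0 : ∀ (w : V) (f : Fin m → V), A (Matrix.vecCons w f) = A.curryLeft w f := fun w f => by
      rw [AlternatingMap.curryLeft_apply_apply]
    have e1 : (fun i : Fin (m+1) => U i + x • U (i+1)) =
        Matrix.vecCons (U 0 + x • U 1) (fun i : Fin m => U (i+1) + x • U (i+1+1)) := by
      funext i
      refine Fin.cases ?_ (fun i => ?_) i <;> simp [Matrix.vecCons]
    rw [e1, e0, map_add, map_smul, AlternatingMap.add_apply, AlternatingMap.smul_apply, smul_eq_mul,
      ih (A.curryLeft (U 0)) (fun i => U (i+1)), ih (A.curryLeft (U 1)) (fun i => U (i+1)),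
      Finset.sum_range_succ' _ (m+1)]
    congr 1
    · refine Finset.sum_congr rfl fun p hp => ?_
      rw [← e0, Nat.add_sub_add_right]
      congr 2
      funext i
      refine Fin.cases ?_ (fun i => ?_) i
      · simp [Matrix.vecCons, sk]
      · simp only [Matrix.vecCons, Fin.cons_succ, sk, Fin.val_succ]
        congr 1; split_ifs <;> omega
    · rw [Finset.sum_eq_single 0]
      · rw [← e0, Nat.sub_zero, Nat.sub_zero, pow_succ, ← mul_assoc, mul_comm x]
        congr 2
        funext i
        refine Fin.cases ?_ (fun i => ?_) i <;> simp [Matrix.vecCons, sk]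
      · intro p hp hp0
        rw [mem_range] at hp
        rw [← e0]
        have : A (Matrix.vecCons (U 1) fun i : Fin m => U (sk p i + 1)) = 0 := by
          rcases m with _ | m
          · omega
          · refine A.map_eq_zero_of_eq _ (i := 0) (j := 1) ?_ (by simp)
            have : 0 < p := by omega
            simp [Matrix.vecCons, sk, this]
        rw [this, mul_zero]
      · simp

lemma exp2 {R V : Type*} [CommRing R] [AddCommGroup V] [Module R V] (y : R) :
    ∀ (m : ℕ) (A : V [⋀^Fin m]→ₗ[R] R) (U : ℕ → V) (s : ℕ) (_ : s ≤ m),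
      A (fun i : Fin m => U (sk s i) + y • U (sk s i + 1)) =
        ∑ p ∈ range (s+1), ∑ q ∈ Ioc s (m+1), y ^ ((s - p) + (m + 1 - q)) *
          A (fun i => U (sk2 p q i)) := by
  intro m
  induction m with
  | zero => 
    intro A U s hs
    have : s = 0 := by omega
    subst this
    simp
    congr 1
    exact Subsingleton.elim _ _
  | succ m ih =>
    intro A U s hs
    rcases s with _ | s
    · have := exp1 y (m+1) A (fun i => U (i+1))
      have e : (fun i : Fin (m+1) => U (sk 0 i) + y • U (sk 0 i + 1)) =
        (fun i : Fin (m+1) => U (i+1) + y • U (i + 1 + 1)) := by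
        funext i; simp [sk]
      rw [e, this]
      simp only [zero_add, range_one, sum_singleton]
      refine Finset.sum_bij' (fun p _ => p + 1) (fun q _ => q - 1) ?_ ?_ ?_ ?_ ?_
      · intro p hp; simp at hp ⊢; omega
      · intro p hp; simp at hp ⊢; omega
      · intro p hp; simp
      · intro p hp; simp at hp ⊢; omega
      · intro p hp
        congr 2
        · omega
        · funext i
          congr 1
          simp only [sk, sk2]; split_ifs <;> omega
    · have e0 : ∀ (w : V) (f : Fin m → V), A (Matrix.vecCons w f) = A.curryLeft w f := fun w f => by
        rw [AlternatingMap.curryLeft_apply_apply]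
      have e1 : (fun i : Fin (m+1) => U (sk (s+1) i) + y • U (sk (s+1) i + 1)) =
          Matrix.vecCons (U 0 + y • U 1) (fun i : Fin m => U (sk s i+1) + y • U (sk s i+1+1)) := by
        funext i
        refine Fin.cases ?_ (fun i => ?_) i
        · simp [Matrix.vecCons, sk]
        · have : sk (s+1) (i+1) = sk s i + 1 := by simp only [sk]; split_ifs <;> omega
          simp [Matrix.vecCons, this]
      rw [e1, e0, map_add, map_smul, AlternatingMap.add_apply, AlternatingMap.smul_apply, smul_eq_mul,
        ih (A.curryLeft (U 0)) (fun i => U (i+1)) s (by omega),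
        ih (A.curryLeft (U 1)) (fun i => U (i+1)) s (by omega),
        Finset.sum_range_succ' _ (s+1)]
      have hq : ∀ g : ℕ → R, ∑ q ∈ Ioc (s+1) (m+1+1), g q = ∑ q ∈ Ioc s (m+1), g (q+1) := by
        intro g
        rw [← Finset.sum_image (s := Ioc s (m+1)) (g := fun q => q + 1) (by intro a _ b _; simp), Finset.image_add_right_Ioc]
      congr 1
      · refine Finset.sum_congr rfl fun p hp => ?_
        rw [hq]
        refine Finset.sum_congr rfl fun q hq => ?_
        rw [← e0, Nat.add_sub_add_right, Nat.add_sub_add_right]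
        congr 2
        funext i
        refine Fin.cases ?_ (fun i => ?_) i
        · simp [Matrix.vecCons, sk2]
        · simp only [Matrix.vecCons, Fin.cons_succ, sk2, Fin.val_succ]
          congr 1; split_ifs <;> omega
      · rw [Finset.sum_eq_single 0]
        · rw [hq, Finset.mul_sum]
          refine Finset.sum_congr rfl fun q hq => ?_
          rw [mem_Ioc] at hq
          rw [← e0, Nat.sub_zero, Nat.sub_zero, Nat.add_sub_add_right, ← mul_assoc, ← pow_succ']
          congr 2
          · omega
          · funext i
            refine Fin.cases ?_ (fun i => ?_) i
            · have : 1 < q + 1 := by omega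
              simp [Matrix.vecCons, sk2, this]
            · simp only [Matrix.vecCons, Fin.cons_succ, sk2, Fin.val_succ]
              congr 1; split_ifs <;> omega
        · intro p hp hp0
          rw [mem_range] at hp
          refine Finset.sum_eq_zero fun q hq => ?_
          rw [← e0]
          have : A (Matrix.vecCons (U 1) fun i : Fin m => U (sk2 p q i + 1)) = 0 := by
            rcases m with _ | m
            · omega
            · refine A.map_eq_zero_of_eq _ (i := 0) (j := 1) ?_ (by simp)
              have : 0 < p := by omega
              simp [Matrix.vecCons, sk2, this]
          rw [this, mul_zero]
        · simp

def Vn (M b r j : ℕ) : ℕ := if r ≤ b + 1 + j then M.choose (b + 1 + j - r) else 0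

lemma Pf_replicate {R : Type*} [CommRing R] (b s : ℕ) : ∀ i j : ℕ,
    Pf (List.replicate s (1 : R)) i j (b+1) = (Vn (b + s) b i j : R) := by
  induction s with
  | zero =>
    intro i j
    simp only [List.replicate_zero, Pf, Bf, Vn, add_zero]
    by_cases h1 : j + 1 ≤ i
    · rw [if_pos h1]
      split_ifs with h2
      · rw [Int.cast_natCast]
        congr 1
        rw [← Nat.choose_symm_of_eq_add]; omega
      · rw [Nat.choose_eq_zero_of_lt (by omega)]; simp
    · rw [if_neg h1, if_pos (by omega), Nat.choose_eq_zero_of_lt (by omega)]; simp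
  | succ s ih =>
    intro i j
    rw [List.replicate_succ]
    simp only [Pf]
    rw [ih, ih, one_mul, ← Nat.cast_add]
    congr 1
    simp only [Vn, ← add_assoc]
    split_ifs with h1 h2 h3
    · obtain ⟨d, hd⟩ : ∃ d, b + 1 + j - i = d + 1 := ⟨b + j - i, by omega⟩
      have : b + 1 + j - (i+1) = d := by omega
      rw [hd, this, Nat.choose_succ_succ]; ring
    · have : b + 1 + j - i = 0 := by omega
      simp [this]
    · omega
    · rfl

/-- the two-gap minors -/
def Dd (a M b p q : ℕ) : ℤ := Matrix.det (Matrix.of fun i j : Fin a => (Vn M b (sk2 p q i) j : ℤ))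

lemma Dd_cast {R : Type*} [CommRing R] (a M b p q : ℕ) :
    ((Dd a M b p q : ℤ) : R) = Matrix.detRowAlternating (fun i : Fin a => (fun j : Fin a => (Vn M b (sk2 p q i) j : R))) := by
  have := (Int.castRingHom R).map_det (Matrix.of fun i j : Fin a => (Vn M b (sk2 p q i) j : ℤ))
  simp only [eq_intCast] at this
  rw [Dd, this]
  change _ = Matrix.det _
  congr 1
  ext i j
  simp

lemma Zf_two {R : Type*} [CommRing R] (a b s : ℕ) (x y : R) :
    Zf ([x, y] ++ List.replicate s 1) (fun _ : Fin a => b+1) =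
    ∑ u ∈ range (a+1), ∑ p ∈ range (u+1), ∑ q ∈ Ioc u (a+1), 
      x ^ (a - u) * y ^ ((u - p) + (a + 1 - q)) * (Dd a (b+s) b p q : R) := by
  rw [Zf_eq_det _ _ (fun _ _ _ => le_rfl)]
  simp only [List.cons_append, List.nil_append]
  set U : ℕ → (Fin a → R) := fun i j => Pf (y :: List.replicate s 1) i j (b+1) with hU
  set V : ℕ → (Fin a → R) := fun i j => Pf (List.replicate s 1) i j (b+1) with hV
  have hUV : ∀ i, U i = V i + y • V (i+1) := by intro i; funext j; rfl
  have e : Matrix.det (Matrix.of fun i j : Fin a => Pf (x :: y :: List.replicate s 1) i j (b+1)) =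
      Matrix.detRowAlternating (fun i : Fin a => U i + x • U (i+1)) := rfl
  rw [e, exp1]
  refine Finset.sum_congr rfl fun u hu => ?_
  rw [mem_range] at hu
  simp only [hUV]
  rw [exp2 y a Matrix.detRowAlternating V u (by omega), Finset.mul_sum]
  refine Finset.sum_congr rfl fun p _ => ?_
  rw [Finset.mul_sum]
  refine Finset.sum_congr rfl fun q _ => ?_
  rw [mul_assoc, Dd_cast]
  simp only [hV, Pf_replicate]

lemma coeff_count {Ω : Type*} (S : Finset Ω) (m : ℕ) (f : Ω → Fin m → ℕ) (k : Fin m → ℕ) :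
    MvPolynomial.coeff (Finsupp.equivFunOnFinite.symm k)
      (∑ w ∈ S, ∏ i, (MvPolynomial.X i : MvPolynomial (Fin m) ℤ) ^ f w i) =
      ((S.filter fun w => ∀ i, f w i = k i).card : ℤ) := by
  classical
  rw [MvPolynomial.coeff_sum, Finset.card_filter]
  push_cast
  refine Finset.sum_congr rfl fun w _ => ?_
  have : ∏ i, (MvPolynomial.X i : MvPolynomial (Fin m) ℤ) ^ f w i
     = MvPolynomial.monomial (Finsupp.equivFunOnFinite.symm (f w)) 1 := by
    rw [MvPolynomial.monomial_eq, Finsupp.prod_fintype _ _ (by simp)]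
    simp
  rw [this, MvPolynomial.coeff_monomial]
  congr 1
  simp [funext_iff]

namespace PlanePartition

lemma exch (a b c m : ℕ) (l l' : Fin m → ℕ)
    (hl : Function.Injective l) (hc : ∀ i, 1 ≤ l i ∧ l i ≤ c) 
    (hl' : Function.Injective l') (hc' : ∀ i, 1 ≤ l' i ∧ l' i ≤ c) (k : Fin m → ℕ) :
    ((PPfin a b c).filter fun p => ∀ i, p.cCol (l i) = k i).card =
      ((PPfin a b c).filter fun p => ∀ i, p.cCol (l' i) = k i).card := by
  have h1 := coeff_count (PPfin a b c) m (fun p i => p.cCol (l i)) k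
  have h2 := coeff_count (PPfin a b c) m (fun p i => p.cCol (l' i)) k
  rw [sum_levels a b c m l hl hc] at h1
  rw [sum_levels a b c m l' hl' hc'] at h2
  rw [h1] at h2
  exact_mod_cast h2

lemma two_point (a b c : ℕ) (l : Fin 2 → ℕ)
    (hl : Function.Injective l) (hc : ∀ i, 1 ≤ l i ∧ l i ≤ c) (j k : ℕ) (hjk : j + k ≤ a) :
    (((PPfin a (b+1) c).filter fun p => ∀ i, p.cCol (l i) = ![j, k] i).card : ℤ) =
      ∑ β ∈ range (min j k + 1), Dd a (b + (c - 2 + 1)) b (a - j - k + β) (a + 1 - β) := by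
  classical
  have h1 := coeff_count (PPfin a (b+1) c) 2 (fun p i => p.cCol (l i)) ![j, k]
  rw [sum_levels a (b+1) c 2 l hl hc] at h1
  have h2 : (List.ofFn fun i : Fin 2 => (MvPolynomial.X i : MvPolynomial (Fin 2) ℤ)) =
    [MvPolynomial.X 0, MvPolynomial.X 1] := by simp
  rw [h2, Zf_two] at h1
  rw [← h1]
  have h3 : ∀ (u v : ℕ) (D : ℤ), MvPolynomial.coeff (Finsupp.equivFunOnFinite.symm ![j, k])
      ((MvPolynomial.X 0 : MvPolynomial (Fin 2) ℤ) ^ u * MvPolynomial.X 1 ^ v * (D : MvPolynomial (Fin 2) ℤ)) =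
      if u = j ∧ v = k then D else 0 := by
    intro u v D
    have : (MvPolynomial.X 0 : MvPolynomial (Fin 2) ℤ) ^ u * MvPolynomial.X 1 ^ v * (D : MvPolynomial (Fin 2) ℤ)
       = MvPolynomial.monomial (Finsupp.equivFunOnFinite.symm ![u, v]) D := by
      rw [MvPolynomial.monomial_eq, Finsupp.prod_fintype _ _ (by simp)]
      simp [mul_comm]
    rw [this, MvPolynomial.coeff_monomial]
    congr 1
    simp [funext_iff, Fin.forall_fin_two]
  simp only [MvPolynomial.coeff_sum, h3]
  rw [Finset.sum_eq_single (a - j)]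
  · rw [Finset.sum_sigma', ← Finset.sum_filter_ne_zero]
    symm
    rw [← Finset.sum_filter_ne_zero]
    refine Finset.sum_bij' (fun β _ => ⟨a - j - k + β, a + 1 - β⟩) (fun x _ => a + 1 - x.2) ?_ ?_ ?_ ?_ ?_
    · intro β hβ
      simp only [mem_filter, mem_range, mem_sigma, mem_Ioc] at hβ ⊢
      refine ⟨by omega, ?_⟩
      rw [if_pos (by omega)]
      exact hβ.2
    · rintro ⟨p, q⟩ hx
      simp only [mem_filter, mem_range, mem_sigma, mem_Ioc] at hx ⊢
      obtain ⟨hx1, hx2⟩ := hx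
      split_ifs at hx2 with h5
      · refine ⟨by omega, ?_⟩
        have e1 : a - j - k + (a + 1 - q) = p := by omega
        have e2 : a + 1 - (a + 1 - q) = q := by omega
        rw [e1, e2]; exact hx2
      · exact absurd rfl hx2
    · intro β hβ
      simp only [mem_filter, mem_range] at hβ ⊢
      omega
    · rintro ⟨p, q⟩ hx
      simp only [mem_filter, mem_range, mem_sigma, mem_Ioc] at hx ⊢
      obtain ⟨hx1, hx2⟩ := hx
      split_ifs at hx2 with h5
      · have e1 : a - j - k + (a + 1 - q) = p := by omega
        have e2 : a + 1 - (a + 1 - q) = q := by omega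
        rw [e1, e2]
      · exact absurd rfl hx2
    · intro β hβ
      simp only [mem_filter, mem_range] at hβ ⊢
      rw [if_pos (by omega)]
  · intro u hu hne
    rw [mem_range] at hu
    refine Finset.sum_eq_zero fun p _ => Finset.sum_eq_zero fun q _ => ?_
    rw [if_neg (by omega)]
  · intro h; simp at h

end PlanePartition

end

section
open Finset

lemma vand_remove (n : ℕ) (v : Fin (n+1) → ℝ) (p : Fin (n+1)) :
    |(Matrix.vandermonde v).det| = (∏ i, |v (p.succAbove i) - v p|) *
      |(Matrix.vandermonde (v ∘ p.succAbove)).det| := by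
  have h1 : |(Matrix.vandermonde v).det| =
      |(Matrix.vandermonde (fun i => v (p.cycleRange.symm i))).det| := by
    have : Matrix.vandermonde (fun i => v (p.cycleRange.symm i)) =
        (Matrix.vandermonde v).submatrix p.cycleRange.symm id := by
      ext i j; simp [Matrix.vandermonde]
    rw [this, Matrix.det_permute]
    rw [abs_mul]
    have : |((Equiv.Perm.sign p.cycleRange.symm : ℤ) : ℝ)| = 1 := by
      rcases Int.units_eq_one_or (Equiv.Perm.sign p.cycleRange.symm) with h | h <;> simp [h]
    rw [this, one_mul]
  rw [h1, Matrix.det_vandermonde, Fin.prod_univ_succ, abs_mul]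
  congr 1
  · rw [Finset.abs_prod]
    have : Finset.Ioi (0 : Fin (n+1)) = Finset.univ.map (Fin.succEmb n) := by
      exact Fin.Ioi_zero_eq_map
    rw [this, Finset.prod_map]
    simp [Fin.cycleRange_symm_succ]
  · rw [Matrix.det_vandermonde]
    congr 1
    refine Finset.prod_congr rfl fun i _ => ?_
    rw [Fin.Ioi_succ, Finset.prod_map]
    simp [Fin.cycleRange_symm_succ]

lemma prod_dist (p d : ℕ) :
    ∏ r ∈ range (p + d + 1), (if r = p then (1:ℝ) else |(r:ℝ) - p|) = p.factorial * d.factorial := by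
  induction d with
  | zero =>
    rw [add_zero, Finset.prod_range_succ, if_pos rfl, ← Finset.prod_range_reflect,
      ← Finset.prod_range_add_one_eq_factorial]
    push_cast
    simp only [mul_one, Nat.factorial_zero, Nat.cast_one]
    refine Finset.prod_congr rfl fun r hr => ?_
    rw [mem_range] at hr
    rw [if_neg (by omega)]
    have : p = (p - 1 - r) + (r + 1) := by omega
    have h2 : (p : ℝ) = ((p - 1 - r : ℕ) : ℝ) + (r + 1) := by exact_mod_cast this
    rw [h2]
    rw [show ((p - 1 - r : ℕ) : ℝ) - (((p - 1 - r : ℕ) : ℝ) + (r + 1)) = -((r:ℝ) + 1) by ring, abs_neg, abs_of_pos (by positivity)]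
  | succ d ih =>
    rw [Finset.prod_range_succ, ← add_assoc, ih, if_neg (by omega), Nat.factorial_succ]
    push_cast
    rw [show (p:ℝ) + d + 1 - p = d + 1 by ring, abs_of_pos (by positivity)]
    ring

lemma prod_dist' (n : ℕ) (p : Fin (n+1)) :
    ∏ i, |((p.succAbove i : ℕ) : ℝ) - (p:ℕ)| = (p : ℕ).factorial * (n - p : ℕ).factorial := by
  have h := prod_dist p (n - p)
  have hp := p.2
  rw [show (p:ℕ) + (n - p) + 1 = n + 1 by omega, ← Fin.prod_univ_eq_prod_range (fun r => if r = (p:ℕ) then (1:ℝ) else |(r:ℝ) - (p:ℕ)|) (n+1),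
    Fin.prod_univ_succAbove _ p, if_pos rfl, one_mul] at h
  rw [← h]
  refine Finset.prod_congr rfl fun i _ => ?_
  rw [if_neg]
  intro h2
  exact Fin.succAbove_ne p i (Fin.ext h2)

lemma sk2_strictMono (p q : ℕ) : StrictMono (sk2 p q) := by
  intro i j h
  simp only [sk2]; split_ifs <;> omega

lemma sk2_eq (a : ℕ) (p : Fin (a+1)) (q : Fin (a+2)) (h : (p:ℕ) < q) (i : Fin a) :
    ((q.succAbove (p.succAbove i) : Fin (a+2)) : ℕ) = sk2 p q i := by
  simp only [Fin.succAbove, Fin.lt_def, sk2]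
  split_ifs <;> simp_all <;> omega

lemma vand_pos {n : ℕ} (v : Fin n → ℝ) (hv : StrictMono v) : 0 < (Matrix.vandermonde v).det := by
  rw [Matrix.det_vandermonde]
  refine Finset.prod_pos fun i _ => Finset.prod_pos fun j hj => ?_
  rw [Finset.mem_Ioi] at hj
  exact sub_pos.2 (hv hj)

lemma vand_sk2 (a p q : ℕ) (hpq : p < q) (hq : q ≤ a + 1) :
    (Matrix.vandermonde fun i : Fin a => (sk2 p q i : ℝ)).det *
      ((p.factorial * (a + 1 - p).factorial) * (q.factorial * (a + 1 - q).factorial))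
     = (Matrix.vandermonde fun i : Fin (a+2) => ((i : ℕ) : ℝ)).det * ((q : ℝ) - p) := by
  set q' : Fin (a+2) := ⟨q, by omega⟩
  set p' : Fin (a+1) := ⟨p, by omega⟩
  set p'' : Fin (a+2) := ⟨p, by omega⟩
  have e1 := vand_remove (a+1) (fun i : Fin (a+2) => ((i : ℕ) : ℝ)) q'
  have e2 := vand_remove a ((fun i : Fin (a+2) => ((i : ℕ) : ℝ)) ∘ q'.succAbove) p'
  have e3 := prod_dist' (a+1) q'
  have e4 := prod_dist (p'' : ℕ) (a + 1 - p)
  have hqp : q'.succAbove p' = p'' := by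
    rw [Fin.succAbove_of_castSucc_lt]
    · rfl
    · exact hpq
  rw [show (p'':ℕ) + (a + 1 - p) + 1 = a + 2 by simp [p'']; omega,
    ← Fin.prod_univ_eq_prod_range (fun r => if r = (p'':ℕ) then (1:ℝ) else |(r:ℝ) - (p'':ℕ)|) (a+2),
    Fin.prod_univ_succAbove _ q', Fin.prod_univ_succAbove _ p', hqp, if_pos rfl, one_mul] at e4
  have hP : ∀ i : Fin a, (if ((q'.succAbove (p'.succAbove i) : Fin (a+2)) : ℕ) = (p'':ℕ) then (1:ℝ) else |((q'.succAbove (p'.succAbove i) : Fin (a+2)):ℝ) - (p'':ℕ)|)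
     = |((q'.succAbove (p'.succAbove i) : Fin (a+2)):ℝ) - (p'':ℕ)| := by
    intro i
    rw [if_neg]
    intro h
    have h2 : q'.succAbove (p'.succAbove i) = q'.succAbove p' := by rw [hqp]; exact Fin.ext h
    exact Fin.succAbove_ne p' i (Fin.succAbove_right_injective h2)
  simp only [hP] at e4
  simp only [Function.comp, hqp] at e2
  have hv : (fun i : Fin a => (((q'.succAbove (p'.succAbove i) : Fin (a+2)) : ℕ) : ℝ)) = fun i : Fin a => (sk2 p q i : ℝ) := by
    funext i
    rw [sk2_eq a p' q' hpq]
  have e2' : |(Matrix.vandermonde fun i : Fin (a+1) => (((q'.succAbove i : Fin (a+2)) : ℕ) : ℝ)).det| = 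
    (∏ i : Fin a, |((q'.succAbove (p'.succAbove i) : Fin (a+2)):ℝ) - (p'':ℕ)|) *
     |(Matrix.vandermonde fun i : Fin a => (sk2 p q i : ℝ)).det| := by
    rw [← hv]; exact e2
  have e1' : |(Matrix.vandermonde fun i : Fin (a+2) => ((i : ℕ) : ℝ)).det| = 
    (∏ i : Fin (a+1), |((q'.succAbove i : ℕ) : ℝ) - (q':ℕ)|) * |(Matrix.vandermonde fun i : Fin (a+1) => (((q'.succAbove i : Fin (a+2)) : ℕ) : ℝ)).det| := e1
  rw [e3, e2'] at e1'
  rw [if_neg (by simp [q', p'']; omega)] at e4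
  have hqq : |((q':ℕ):ℝ) - (p'':ℕ)| = (q:ℝ) - p := by
    have : (p:ℝ) < q := by exact_mod_cast hpq
    simp only [q', p'']
    rw [abs_of_pos (by linarith)]
  rw [hqq] at e4
  have pos1 := vand_pos (fun i : Fin (a+2) => ((i : ℕ) : ℝ)) (fun i j h => by simpa using h)
  have pos2 := vand_pos (fun i : Fin a => (sk2 p q i : ℝ)) (fun i j h => by 
    have := sk2_strictMono p q (show (i:ℕ) < j from h); simpa using this)
  rw [abs_of_pos pos1, abs_of_pos pos2] at e1'
  rw [e1', ← e4]
  simp only [q', p'']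
  ring

lemma vn_fact (a b c M r j : ℕ) (hM : M = b + c + 1) (hr : r ≤ b + a) (hj : j < a) :
    Vn M b r j * ((b + a - r).factorial * (c + r).factorial) =
      M.factorial * ((b + a - r).descFactorial (a - 1 - j) * (c + r).descFactorial j) := by
  unfold Vn
  split_ifs with h1
  · by_cases h2 : j ≤ c + r
    · have e1 := Nat.factorial_mul_descFactorial (n := b + a - r) (k := a - 1 - j) (by omega)
      have e2 := Nat.factorial_mul_descFactorial (n := c + r) (k := j) h2
      have e3 := Nat.choose_mul_factorial_mul_factorial (n := M) (k := b + 1 + j - r) (by omega)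
      rw [show b + a - r - (a - 1 - j) = b + 1 + j - r by omega] at e1
      rw [show M - (b + 1 + j - r) = c + r - j by omega] at e3
      rw [← e1, ← e2, ← e3]; ring
    · rw [Nat.choose_eq_zero_of_lt (by omega), Nat.descFactorial_of_lt (n := c + r) (k := j) (by omega)]
      simp
  · rw [Nat.descFactorial_of_lt (n := b + a - r) (by omega)]; simp

open Polynomial in
lemma det_poly (a b c M : ℕ) (hM : M = b + c + 1) :
    ∃ K : ℝ, ∀ r : Fin a → ℕ, (∀ i, r i ≤ b + a) →
      (Matrix.det (Matrix.of fun i j : Fin a => (Vn M b (r i) j : ℝ))) *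
        ∏ i, (((b + a - r i).factorial * (c + r i).factorial : ℕ) : ℝ) =
      K * (Matrix.vandermonde fun i => (r i : ℝ)).det := by
  set P : Fin a → ℝ[X] := fun j => Polynomial.C (M.factorial : ℝ) * ((descPochhammer ℝ (a - 1 - j)).comp (Polynomial.C ((b + a : ℕ) : ℝ) - X) *
    (descPochhammer ℝ j).comp (X + Polynomial.C (c:ℝ))) with hP
  have hdeg : ∀ j, (P j).natDegree < a := by
    intro j
    have hj := j.2
    refine lt_of_le_of_lt (Polynomial.natDegree_C_mul_le _ _) ?_
    refine lt_of_le_of_lt (Polynomial.natDegree_mul_le) ?_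
    have h1 : ((descPochhammer ℝ (a - 1 - j)).comp (Polynomial.C ((b + a : ℕ) : ℝ) - X)).natDegree ≤ a - 1 - j := by
      refine (Polynomial.natDegree_comp_le).trans ?_
      rw [descPochhammer_natDegree]
      have : (Polynomial.C ((b + a : ℕ) : ℝ) - X).natDegree ≤ 1 := by
        refine (Polynomial.natDegree_sub_le _ _).trans ?_
        rw [Polynomial.natDegree_C, Polynomial.natDegree_X]; simp
      calc _ ≤ (a - 1 - j) * 1 := Nat.mul_le_mul_left _ this
        _ = _ := mul_one _
    have h2 : ((descPochhammer ℝ (j:ℕ)).comp (X + Polynomial.C (c:ℝ))).natDegree ≤ j := by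
      refine (Polynomial.natDegree_comp_le).trans ?_
      rw [descPochhammer_natDegree, Polynomial.natDegree_X_add_C, mul_one]
    omega
  refine ⟨Matrix.det (Matrix.of fun k j : Fin a => (P j).coeff k), fun r hr => ?_⟩
  have hval : ∀ i j : Fin a, (((b + a - r i).factorial * (c + r i).factorial : ℕ) : ℝ) * (Vn M b (r i) j : ℝ) = (P j).eval (r i : ℝ) := by
    intro i j
    have := vn_fact a b c M (r i) j hM (hr i) j.2
    simp only [hP, Polynomial.eval_mul, Polynomial.eval_C, Polynomial.eval_comp, Polynomial.eval_sub, Polynomial.eval_X, Polynomial.eval_add]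
    rw [← Nat.cast_sub (hr i), add_comm (r i : ℝ), ← Nat.cast_add, descPochhammer_eval_eq_descFactorial, descPochhammer_eval_eq_descFactorial]
    rw [mul_comm]
    exact_mod_cast this
  have h1 : (Matrix.of fun i j : Fin a => (P j).eval (r i : ℝ)) = (Matrix.vandermonde fun i => (r i : ℝ)) * (Matrix.of fun k j : Fin a => (P j).coeff k) := by
    ext i j
    rw [Matrix.mul_apply, Matrix.of_apply, Polynomial.eval_eq_sum_range' (hdeg j), ← Fin.sum_univ_eq_sum_range (fun k => (P j).coeff k * (r i : ℝ) ^ k)]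
    refine Finset.sum_congr rfl fun k _ => ?_
    simp [Matrix.vandermonde, mul_comm]
  have h2 := Matrix.det_mul_column (fun i : Fin a => (((b + a - r i).factorial * (c + r i).factorial : ℕ) : ℝ)) (Matrix.of fun i j : Fin a => (Vn M b (r i) j : ℝ))
  rw [mul_comm, ← h2, mul_comm (Matrix.det _), ← Matrix.det_mul, ← h1]
  congr 1
  ext i j
  simp only [Matrix.of_apply]
  exact hval i j

def gf (a b c r : ℕ) : ℝ := (((b + a - r).factorial * (c + r).factorial : ℕ) : ℝ)

lemma prod_sk2 (a p q : ℕ) (hpq : p < q) (hq : q ≤ a + 1) (g : ℕ → ℝ) :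
    (∏ i : Fin a, g (sk2 p q i)) * (g p * g q) = ∏ r ∈ range (a+2), g r := by
  set q' : Fin (a+2) := ⟨q, by omega⟩
  set p' : Fin (a+1) := ⟨p, by omega⟩
  set p'' : Fin (a+2) := ⟨p, by omega⟩
  have hqp : q'.succAbove p' = p'' := by
    rw [Fin.succAbove_of_castSucc_lt]
    · rfl
    · exact hpq
  rw [← Fin.prod_univ_eq_prod_range g (a+2), Fin.prod_univ_succAbove _ q', Fin.prod_univ_succAbove _ p', hqp]
  simp only [sk2_eq a p' q' hpq]
  simp only [q', p', p'']
  ring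

/-- product formula for the two-gap minors -/
lemma Dd_formula (a b c M : ℕ) (hM : M = b + c + 1) (hb : 1 ≤ b) :
    ∃ K : ℝ, ∀ p q, p < q → q ≤ a + 1 →
      (Dd a M b p q : ℝ) = K * (gf a b c p * gf a b c q * ((q : ℝ) - p) /
        ((p.factorial * (a + 1 - p).factorial) * (q.factorial * (a + 1 - q).factorial))) := by
  obtain ⟨K, hK⟩ := det_poly a b c M hM
  refine ⟨K * (Matrix.vandermonde fun i : Fin (a+2) => ((i : ℕ) : ℝ)).det / ∏ r ∈ range (a+2), gf a b c r, fun p q hpq hq => ?_⟩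
  have h1 := hK (fun i => sk2 p q i) (by
    intro i
    have := i.2
    simp only [sk2]; split_ifs <;> omega)
  have h2 := prod_sk2 a p q hpq hq (gf a b c)
  have h3 := vand_sk2 a p q hpq hq
  have h4 : (Dd a M b p q : ℝ) = (Matrix.det (Matrix.of fun i j : Fin a => (Vn M b (sk2 p q i) j : ℝ))) := Dd_cast a M b p q
  have hg : ∀ r, gf a b c r ≠ 0 := by
    intro r; unfold gf; exact_mod_cast (Nat.mul_pos (Nat.factorial_pos _) (Nat.factorial_pos _)).ne'
  have hpr : ∏ i : Fin a, gf a b c (sk2 p q i) ≠ 0 := Finset.prod_ne_zero_iff.2 fun i _ => hg _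
  change _ * ∏ i : Fin a, gf a b c (sk2 p q i) = _ at h1
  rw [← h4] at h1
  rw [← h2]
  have hf : ((p.factorial * (a + 1 - p).factorial : ℝ) * (q.factorial * (a + 1 - q).factorial)) ≠ 0 := by
    have := Nat.factorial_ne_zero
    simp [this]
  have := hg p
  have := hg q
  field_simp
  field_simp at h3
  linear_combination ((p.factorial * (a + 1 - p).factorial : ℝ) * (q.factorial * (a + 1 - q).factorial)) * h1 + K * h3

end

section
open Finset
open scoped Nat

lemma lim_base (A B C : ℕ → ℝ) (t : ℝ) (hA : Filter.Tendsto A Filter.atTop Filter.atTop)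
    (hB : Filter.Tendsto B Filter.atTop Filter.atTop) (hC : Filter.Tendsto C Filter.atTop Filter.atTop)
    (h : Filter.Tendsto (fun n => A n * B n / C n) Filter.atTop (nhds t)) (x y z e : ℝ) :
    Filter.Tendsto (fun n => (A n + x) * (B n + y) / (C n + e * A n + z)) Filter.atTop (nhds t) := by
  have hAC : Filter.Tendsto (fun n => A n * B n / C n * (B n)⁻¹) Filter.atTop (nhds (t * 0)) :=
    h.mul hB.inv_tendsto_atTop
  have hx := (hA.inv_tendsto_atTop).const_mul x
  have hy := (hB.inv_tendsto_atTop).const_mul y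
  have hz := (hC.inv_tendsto_atTop).const_mul z
  have hnum := (h.mul (hx.const_add 1)).mul (hy.const_add 1)
  have hden := ((hAC.const_mul e).const_add 1).add hz
  have hall := hnum.div hden (by simp)
  have e1 : t * (1 + x * 0) * (1 + y * 0) / (1 + e * (t * 0) + z * 0) = t := by simp
  rw [e1] at hall
  refine hall.congr' ?_
  filter_upwards [hA.eventually_gt_atTop 0, hB.eventually_gt_atTop 0, hC.eventually_gt_atTop 0] with n h1 h2 h3
  simp only [Pi.inv_apply, Pi.div_apply]
  have e2 : 1 + e * (A n * B n / C n * (B n)⁻¹) + z * (C n)⁻¹ = (C n + e * A n + z) / C n := by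
    field_simp
  rw [e2, div_div_eq_mul_div]
  congr 1
  field_simp

lemma lim_fact (a b c : ℕ → ℕ) (t : ℝ) (hA : Filter.Tendsto a Filter.atTop Filter.atTop)
    (hB : Filter.Tendsto b Filter.atTop Filter.atTop) (hC : Filter.Tendsto c Filter.atTop Filter.atTop)
    (h : Filter.Tendsto (fun n => (a n * b n : ℝ) / c n) Filter.atTop (nhds t)) (u v k : ℕ) :
    Filter.Tendsto (fun n => (((a n + u).descFactorial k : ℕ) : ℝ) * (((b n + v).ascFactorial k : ℕ) : ℝ) /
      (((c n + a n + u).descFactorial k : ℕ) : ℝ)) Filter.atTop (nhds (t ^ k)) := by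
  have hA' : Filter.Tendsto (fun n => (a n : ℝ)) Filter.atTop Filter.atTop := tendsto_natCast_atTop_atTop.comp hA
  have hB' : Filter.Tendsto (fun n => (b n : ℝ)) Filter.atTop Filter.atTop := tendsto_natCast_atTop_atTop.comp hB
  have hC' : Filter.Tendsto (fun n => (c n : ℝ)) Filter.atTop Filter.atTop := tendsto_natCast_atTop_atTop.comp hC
  have := tendsto_finsetProd (range k) (fun i _ => lim_base _ _ _ t hA' hB' hC' h ((u:ℝ) - i) ((v:ℝ) + i) ((u:ℝ) - i) 1)
  rw [prod_const, card_range] at this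
  refine this.congr' ?_
  filter_upwards [hA.eventually_ge_atTop k] with n hn
  rw [Nat.descFactorial_eq_prod_range, Nat.descFactorial_eq_prod_range, Nat.ascFactorial_eq_prod_range]
  push_cast
  rw [← prod_mul_distrib, ← prod_div_distrib]
  refine prod_congr rfl fun i hi => ?_
  have hi := mem_range.1 hi
  rw [Nat.cast_sub (by omega), Nat.cast_sub (by omega)]
  push_cast
  congr 1
  · ring
  · ring

lemma telesc (j k : ℕ) :
    ∑ β ∈ range (min j k + 1), ((j + k - 2 * β + 1 : ℝ) / (((j + k - β + 1)! : ℕ) * (β ! : ℕ))) =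
      1 / ((j ! : ℕ) * (k ! : ℕ) : ℝ) := by
  wlog hjk : j ≤ k
  · have := this k j (by omega)
    rw [min_comm, mul_comm (k ! : ℝ)] at this
    rw [← this]
    refine sum_congr rfl fun β _ => ?_
    rw [add_comm k j, add_comm (k:ℝ)]
  rw [min_eq_left hjk]
  have key : ∀ m, m ≤ j → ∑ β ∈ range (m + 1), ((j + k - 2 * β + 1 : ℝ) / (((j + k - β + 1)! : ℕ) * (β ! : ℕ))) =
      1 / (((j + k - m)! : ℕ) * (m ! : ℕ) : ℝ) := by
    intro m
    induction m with
    | zero => 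
      intro _
      have h0 : ((j + k)! : ℝ) ≠ 0 := by positivity
      simp [Nat.factorial_succ]
      field_simp
    | succ m ih => 
      intro hm
      rw [sum_range_succ, ih (by omega)]
      obtain ⟨d, rfl⟩ : ∃ d, j = m + 1 + d := ⟨j - (m+1), by omega⟩
      rw [show m + 1 + d + k - (m + 1) + 1 = d + k + 1 by omega, show m + 1 + d + k - m = d + k + 1 by omega,
        show m + 1 + d + k - (m + 1) = d + k by omega, Nat.factorial_succ, Nat.factorial_succ]
      have h0 : ((d + k)! : ℝ) ≠ 0 := by positivity
      have h1 : (m ! : ℝ) ≠ 0 := by positivity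
      push_cast
      field_simp
      ring
  rw [key j le_rfl, show j + k - j = k by omega, mul_comm]

/-- normalised two-point weight -/
noncomputable def Wt (a b c u v k : ℕ) : ℝ := 
  (((a + u).descFactorial k : ℕ) : ℝ) * (((b + v).ascFactorial k : ℕ) : ℝ) /
      (((c + a + u).descFactorial k : ℕ) : ℝ)

lemma desc_fac (n k : ℕ) (h : k ≤ n) : (n ! : ℝ) = ((n - k)! : ℕ) * (n.descFactorial k : ℕ) := by
  exact_mod_cast (Nat.factorial_mul_descFactorial h).symm

lemma dd_one (a b c α β : ℕ) (hb : 1 ≤ b) (h1 : β ≤ α) (h2 : α ≤ a) :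
    gf a b c (a - α) * gf a b c (a + 1 - β) * (((a + 1 - β : ℕ):ℝ) - (a - α : ℕ)) / 
      ((((a - α)! : ℕ) * ((a + 1 - (a - α))! : ℕ)) * (((a + 1 - β)! : ℕ) * ((a + 1 - (a + 1 - β))! : ℕ)) : ℝ)
    = (gf a b c a * gf a b c (a + 1) / ((a ! : ℕ) * ((a + 1)! : ℕ))) * 
      (((α:ℝ) - β + 1) / (((α + 1)! : ℕ) * (β ! : ℕ)) * (Wt a b c 0 1 α * Wt a b c 1 0 β)) := by
  obtain ⟨b, rfl⟩ : ∃ d, b = d + 1 := ⟨b - 1, by omega⟩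
  unfold gf Wt
  rw [show b + 1 + a - (a - α) = b + 1 + α by omega, show b + 1 + a - (a + 1 - β) = b + β by omega,
    show b + 1 + a - a = b + 1 by omega, show b + 1 + a - (a + 1) = b by omega, show a + 1 - (a - α) = α + 1 by omega,
    show a + 1 - (a + 1 - β) = β by omega]
  rw [← Nat.factorial_mul_ascFactorial (b + 1) α, ← Nat.factorial_mul_ascFactorial b β]
  have e1 := desc_fac (c + a) α (by omega)
  have e2 := desc_fac (c + (a + 1)) β (by omega)
  have e3 := desc_fac a α (by omega)
  have e4 := desc_fac (a + 1) β (by omega)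
  rw [show c + a - α = c + (a - α) by omega] at e1
  rw [show c + (a + 1) - β = c + (a + 1 - β) by omega] at e2
  have p1 : ((c + a).descFactorial α : ℝ) ≠ 0 := by
    have := Nat.descFactorial_pos (n := c + a) (k := α) |>.2 (by omega)
    positivity
  have p2 : ((c + (a+1)).descFactorial β : ℝ) ≠ 0 := by
    have := Nat.descFactorial_pos (n := c + (a+1)) (k := β) |>.2 (by omega)
    positivity
  have p3 : (a.descFactorial α : ℝ) ≠ 0 := by
    have := Nat.descFactorial_pos (n := a) (k := α) |>.2 (by omega)
    positivity
  have p4 : ((a+1).descFactorial β : ℝ) ≠ 0 := by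
    have := Nat.descFactorial_pos (n := a+1) (k := β) |>.2 (by omega)
    positivity
  rw [Nat.cast_sub (by omega), Nat.cast_sub (by omega)]
  simp only [add_zero, add_assoc]
  push_cast
  rw [e1, e2, e3, e4]
  have q1 : ((a - α)! : ℝ) ≠ 0 := by positivity
  have q2 : ((a + 1 - β)! : ℝ) ≠ 0 := by positivity
  have q3 : ((α + 1)! : ℝ) ≠ 0 := by positivity
  have q4 : (β ! : ℝ) ≠ 0 := by positivity
  field_simp
  ring


namespace PlanePartition

/-- two-point count -/
noncomputable def Q2 (a b c : ℕ) (l : Fin 2 → ℕ) (j k : ℕ) : ℕ :=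
  ((PPfin a b c).filter fun p => ∀ i, p.cCol (l i) = ![j, k] i).card

lemma Q2_formula (a b c : ℕ) (hb : 1 ≤ b) (l : Fin 2 → ℕ)
    (hl : Function.Injective l) (hc : ∀ i, 1 ≤ l i ∧ l i ≤ c + 2) (j k : ℕ) (hjk : j + k ≤ a) :
    (Q2 a (b+1) (c+2) l j k : ℝ) = (Q2 a (b+1) (c+2) l 0 0 : ℝ) *
      ∑ β ∈ range (min j k + 1), (((j + k - 2 * β + 1 : ℝ) / (((j + k - β + 1)! : ℕ) * (β ! : ℕ))) *
        (Wt a b c 0 1 (j + k - β) * Wt a b c 1 0 β)) := by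
  obtain ⟨K, hK⟩ := Dd_formula a b c (b + c + 1) rfl hb
  have main : ∀ j k : ℕ, j + k ≤ a → (Q2 a (b+1) (c+2) l j k : ℝ) = 
      (K * (gf a b c a * gf a b c (a + 1) / ((a ! : ℕ) * ((a + 1)! : ℕ)))) * 
      ∑ β ∈ range (min j k + 1), (((j + k - 2 * β + 1 : ℝ) / (((j + k - β + 1)! : ℕ) * (β ! : ℕ))) *
        (Wt a b c 0 1 (j + k - β) * Wt a b c 1 0 β)) := by
    intro j k hjk
    have h := two_point a b (c+2) l hl hc j k hjk
    have h2 : (Q2 a (b+1) (c+2) l j k : ℝ) = ((∑ β ∈ range (min j k + 1), Dd a (b + (c + 2 - 2 + 1)) b (a - j - k + β) (a + 1 - β) : ℤ) : ℝ) := by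
      rw [← h]; simp [Q2]
    rw [h2, show b + (c + 2 - 2 + 1) = b + c + 1 by omega]
    push_cast
    rw [mul_sum]
    refine sum_congr rfl fun β hβ => ?_
    have hβ := mem_range.1 hβ
    rw [show a - j - k + β = a - (j + k - β) by omega, hK _ _ (by omega) (by omega)]
    rw [dd_one a b c (j + k - β) β hb (by omega) (by omega), mul_assoc]
    rw [Nat.cast_sub (by omega)]
    push_cast
    rw [show (j:ℝ) + k - β - β + 1 = j + k - 2 * β + 1 by ring]
  have h0 := main 0 0 (by omega)
  have e0 : (K * (gf a b c a * gf a b c (a + 1) / ((a ! : ℕ) * ((a + 1)! : ℕ)))) = (Q2 a (b+1) (c+2) l 0 0 : ℝ) := by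
    rw [h0]; simp [Wt]
  rw [main j k hjk, e0]

lemma zeroP_mem (a b c : ℕ) : zeroP ∈ PPfin a b c := by
  rw [mem_PPfin]
  refine ⟨?_, ?_, ?_⟩
  · intro i j _; rfl
  · intro i j _; rfl
  · intro i j; exact Nat.zero_le _

lemma zeroP_cCol (l : ℕ) (h : 1 ≤ l) : zeroP.cCol l = 0 := by
  unfold cCol
  have : {j | ∃ i, zeroP.entry i j = l} = ∅ := by
    ext j
    simp only [Set.mem_ofPred_eq, Set.mem_empty_iff_false, iff_false, not_exists]
    intro i hi
    have : zeroP.entry i j = 0 := rfl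
    omega
  rw [this, Set.ncard_empty]

lemma Q2_pos (a b c : ℕ) (l : Fin 2 → ℕ) (hc : ∀ i, 1 ≤ l i) : 0 < Q2 a b c l 0 0 := by
  unfold Q2
  refine card_pos.2 ⟨zeroP, mem_filter.2 ⟨zeroP_mem a b c, fun i => ?_⟩⟩
  rw [zeroP_cCol _ (hc i)]
  fin_cases i <;> rfl

lemma Q2_lim (a b c : ℕ → ℕ) (t : ℝ) (hA : Filter.Tendsto a Filter.atTop Filter.atTop)
    (hB : Filter.Tendsto b Filter.atTop Filter.atTop) (hC : Filter.Tendsto c Filter.atTop Filter.atTop)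
    (h : Filter.Tendsto (fun n => (a n * b n : ℝ) / c n) Filter.atTop (nhds t)) 
    (l : Fin 2 → ℕ) (hl : Function.Injective l) (hl1 : ∀ i, 1 ≤ l i) (j k : ℕ) :
    Filter.Tendsto (fun n => (Q2 (a n) (b n) (c n) l j k : ℝ) / Q2 (a n) (b n) (c n) l 0 0) Filter.atTop
      (nhds (t ^ j / j ! * (t ^ k / k !))) := by
  have hA' : Filter.Tendsto (fun n => (a n : ℝ)) Filter.atTop Filter.atTop := tendsto_natCast_atTop_atTop.comp hA
  have hB' : Filter.Tendsto (fun n => (b n : ℝ)) Filter.atTop Filter.atTop := tendsto_natCast_atTop_atTop.comp hB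
  have hC' : Filter.Tendsto (fun n => (c n : ℝ)) Filter.atTop Filter.atTop := tendsto_natCast_atTop_atTop.comp hC
  have hb1 : Filter.Tendsto (fun n => b n - 1) Filter.atTop Filter.atTop := (Filter.tendsto_sub_atTop_nat 1).comp hB
  have hc1 : Filter.Tendsto (fun n => c n - 2) Filter.atTop Filter.atTop := (Filter.tendsto_sub_atTop_nat 2).comp hC
  have h1 : Filter.Tendsto (fun n => (a n * (b n - 1 : ℕ) : ℝ) / (c n - 2 : ℕ)) Filter.atTop (nhds t) := by
    refine (lim_base _ _ _ t hA' hB' hC' h 0 (-1) (-2) 0).congr' ?_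
    filter_upwards [hB.eventually_ge_atTop 1, hC.eventually_ge_atTop 2] with n h1 h2
    rw [Nat.cast_sub h1, Nat.cast_sub h2]
    push_cast
    congr 1 <;> ring
  have key := tendsto_finsetSum (range (min j k + 1)) (fun β _ => 
    ((lim_fact _ _ _ t hA hb1 hc1 h1 0 1 (j + k - β)).mul (lim_fact _ _ _ t hA hb1 hc1 h1 1 0 β)).const_mul 
     ((j + k - 2 * β + 1 : ℝ) / (((j + k - β + 1)! : ℕ) * (β ! : ℕ))))
  have e : ∑ β ∈ range (min j k + 1), ((j + k - 2 * β + 1 : ℝ) / (((j + k - β + 1)! : ℕ) * (β ! : ℕ))) * (t ^ (j + k - β) * t ^ β)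
     = t ^ j / j ! * (t ^ k / k !) := by
    have : ∀ β ∈ range (min j k + 1), ((j + k - 2 * β + 1 : ℝ) / (((j + k - β + 1)! : ℕ) * (β ! : ℕ))) * (t ^ (j + k - β) * t ^ β)
      = ((j + k - 2 * β + 1 : ℝ) / (((j + k - β + 1)! : ℕ) * (β ! : ℕ))) * t ^ (j + k) := by
      intro β hβ
      have hβ := mem_range.1 hβ
      rw [← pow_add, show j + k - β + β = j + k by omega]
    rw [sum_congr rfl this, ← sum_mul, telesc, pow_add]
    field_simp
  rw [e] at key
  refine key.congr' ?_
  have hlc : ∀ᶠ n in Filter.atTop, ∀ i, l i ≤ c n := by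
    rw [Filter.eventually_all]
    exact fun i => hC.eventually_ge_atTop (l i)
  filter_upwards [hB.eventually_ge_atTop 2, hC.eventually_ge_atTop 2, hA.eventually_ge_atTop (j + k), hlc] with n g1 g2 g3 g4
  obtain ⟨B, hBe⟩ : ∃ B, b n = B + 1 := ⟨b n - 1, by omega⟩
  obtain ⟨C, hCe⟩ : ∃ C, c n = C + 2 := ⟨c n - 2, by omega⟩
  have hp := Q2_pos (a n) (b n) (c n) l hl1
  have g4' : ∀ i, l i ≤ C + 2 := fun i => hCe ▸ g4 i
  rw [hBe, hCe] at hp ⊢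
  rw [Q2_formula (a n) B C (by omega) l hl (fun i => ⟨hl1 i, g4' i⟩) j k g3, mul_div_cancel_left₀ _ (by positivity)]
  rfl

end PlanePartition

end

section
open Finset
open scoped Nat

lemma lim_squeeze (x : ℕ → ℝ) (Lo Hi : ℕ → ℕ → ℝ) (lo hi : ℕ → ℝ) (s : ℝ)
    (h1 : ∀ K, 1 ≤ K → Filter.Tendsto (Lo K) Filter.atTop (nhds (lo K)))
    (h2 : ∀ K, 1 ≤ K → Filter.Tendsto (Hi K) Filter.atTop (nhds (hi K)))
    (h3 : Filter.Tendsto lo Filter.atTop (nhds s)) (h4 : Filter.Tendsto hi Filter.atTop (nhds s))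
    (h5 : ∀ K, 1 ≤ K → ∀ᶠ n in Filter.atTop, Lo K n ≤ x n ∧ x n ≤ Hi K n) :
    Filter.Tendsto x Filter.atTop (nhds s) := by
  rw [tendsto_order]
  constructor
  · intro y hy
    obtain ⟨K, hK1, hK2⟩ := ((h3.eventually (lt_mem_nhds hy)).and (Filter.eventually_ge_atTop 1)).exists
    filter_upwards [(h1 K hK2).eventually (lt_mem_nhds hK1), h5 K hK2] with n g1 g2
    linarith [g2.1]
  · intro y hy
    obtain ⟨K, hK1, hK2⟩ := ((h4.eventually (gt_mem_nhds hy)).and (Filter.eventually_ge_atTop 1)).exists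
    filter_upwards [(h2 K hK2).eventually (gt_mem_nhds hK1), h5 K hK2] with n g1 g2
    linarith [g2.2]

namespace PlanePartition

lemma sum_cCol_le (a b c : ℕ) (p : PlanePartition) (hp : p ∈ PPfin a b c) :
    ∑ l ∈ Icc 1 c, p.cCol l ≤ a * b := by
  classical
  rw [mem_PPfin] at hp
  obtain ⟨h1, h2, h3⟩ := hp
  have key : ∀ l ∈ Icc 1 c, p.cCol l ≤ ((range b ×ˢ range a).filter fun x => p.entry x.1 x.2 = l).card := by
    intro l hl
    have hl := mem_Icc.1 hl
    have : {j | ∃ i, p.entry i j = l} ⊆ ((((range b ×ˢ range a).filter fun x => p.entry x.1 x.2 = l).image Prod.snd : Finset ℕ) : Set ℕ) := by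
      rintro j ⟨i, hi⟩
      simp only [coe_image, Set.mem_image, mem_coe, mem_filter, mem_product, mem_range]
      refine ⟨(i, j), ⟨⟨?_, ?_⟩, hi⟩, rfl⟩
      · by_contra hcon
        have := h2 i j (by simpa using hcon)
        omega
      · by_contra hcon
        have := h1 i j (by simpa using hcon)
        omega
    unfold cCol
    refine (Set.ncard_le_ncard this (finite_toSet _)).trans ?_
    rw [Set.ncard_coe_finset]
    exact card_image_le
  refine (sum_le_sum key).trans ?_
  rw [sum_card_fiberwise_eq_card_filter]
  refine (card_filter_le _ _).trans ?_
  rw [card_product, card_range, card_range, mul_comm]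

lemma sum_cCol_eq (a b c l l' : ℕ) (h : 1 ≤ l ∧ l ≤ c) (h' : 1 ≤ l' ∧ l' ≤ c) :
    ∑ p ∈ PPfin a b c, p.cCol l = ∑ p ∈ PPfin a b c, p.cCol l' := by
  classical
  have bd : ∀ l, (1 ≤ l ∧ l ≤ c) → ∀ p ∈ PPfin a b c, p.cCol l ∈ range (a * b + 1) := by
    intro l hl p hp
    have := single_le_sum (f := fun l => p.cCol l) (fun i _ => Nat.zero_le _) (mem_Icc.2 hl)
    have h2 := sum_cCol_le a b c p hp
    simp only [mem_range]
    have h3 : p.cCol l ≤ ∑ l ∈ Icc 1 c, p.cCol l := this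
    omega
  have e : ∀ l, (1 ≤ l ∧ l ≤ c) → ∑ p ∈ PPfin a b c, p.cCol l =
      ∑ k ∈ range (a * b + 1), ((PPfin a b c).filter fun p => ∀ i : Fin 1, p.cCol ((fun _ => l) i) = (fun _ => k) i).card * k := by
    intro l hl
    rw [← sum_fiberwise_of_maps_to (bd l hl)]
    refine sum_congr rfl fun k _ => ?_
    rw [sum_congr rfl (g := fun _ => k) (fun p hp => (mem_filter.1 hp).2), sum_const, smul_eq_mul]
    simp
  rw [e l h, e l' h']
  refine sum_congr rfl fun k _ => ?_
  rw [exch a b c 1 (fun _ => l) (fun _ => l') (fun i j _ => Subsingleton.elim _ _) (fun _ => h) 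
    (fun i j _ => Subsingleton.elim _ _) (fun _ => h') (fun _ => k)]

lemma markov (a b c l K : ℕ) (h : 1 ≤ l ∧ l ≤ c) :
    c * (K * ((PPfin a b c).filter fun p => K ≤ p.cCol l).card) ≤ (PPfin a b c).card * (a * b) := by
  have h1 : K * ((PPfin a b c).filter fun p => K ≤ p.cCol l).card ≤ ∑ p ∈ PPfin a b c, p.cCol l := by
    refine le_trans ?_ (sum_le_sum_of_subset (filter_subset (fun p => K ≤ p.cCol l) _))
    rw [mul_comm, ← smul_eq_mul]
    exact card_nsmul_le_sum _ _ _ (fun p hp => (mem_filter.1 hp).2)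
  calc _ ≤ c * ∑ p ∈ PPfin a b c, p.cCol l := Nat.mul_le_mul_left _ h1
    _ = ∑ l' ∈ Icc 1 c, ∑ p ∈ PPfin a b c, p.cCol l' := by
      rw [sum_congr rfl (g := fun _ => ∑ p ∈ PPfin a b c, p.cCol l) (fun l' hl' => sum_cCol_eq a b c l' l (mem_Icc.1 hl') h)]
      simp
    _ = ∑ p ∈ PPfin a b c, ∑ l' ∈ Icc 1 c, p.cCol l' := sum_comm
    _ ≤ _ := by
      rw [← smul_eq_mul]
      exact sum_le_card_nsmul _ _ _ (fun p hp => sum_cCol_le a b c p hp)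

/-- tail count -/
noncomputable def Tl (a b c l K : ℕ) : ℕ := ((PPfin a b c).filter fun p => K ≤ p.cCol l).card

/-- one-point count -/
noncomputable def Q1 (a b c l k : ℕ) : ℕ := ((PPfin a b c).filter fun p => p.cCol l = k).card

lemma Q2_eq (a b c : ℕ) (l : Fin 2 → ℕ) (j k : ℕ) :
    Q2 a b c l j k = ((PPfin a b c).filter fun p => p.cCol (l 0) = j ∧ p.cCol (l 1) = k).card := by
  unfold Q2
  congr 1
  refine filter_congr fun p _ => ?_
  simp [Fin.forall_fin_two]

lemma sum_Q2 (a b c : ℕ) (l : Fin 2 → ℕ) (j K : ℕ) :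
    ∑ k ∈ range K, Q2 a b c l j k = ((PPfin a b c).filter fun p => p.cCol (l 0) = j ∧ p.cCol (l 1) < K).card := by
  classical
  simp only [Q2_eq]
  have := sum_card_fiberwise_eq_card_filter ((PPfin a b c).filter fun p => p.cCol (l 0) = j) (range K) (fun p => p.cCol (l 1))
  simpa only [filter_filter, mem_range] using this

lemma Q1_bounds (a b c : ℕ) (l : Fin 2 → ℕ) (j K : ℕ) :
    ∑ k ∈ range K, Q2 a b c l j k ≤ Q1 a b c (l 0) j ∧
    Q1 a b c (l 0) j ≤ ∑ k ∈ range K, Q2 a b c l j k + Tl a b c (l 1) K := by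
  classical
  rw [sum_Q2]
  constructor
  · exact card_le_card (monotone_filter_right _ (fun p _ h => h.1))
  · unfold Q1 Tl
    refine le_trans (card_le_card ?_) (card_union_le _ _)
    intro p
    simp only [mem_filter, mem_union]
    intro h
    by_cases h2 : p.cCol (l 1) < K
    · exact Or.inl ⟨h.1, h.2, h2⟩
    · exact Or.inr ⟨h.1, by omega⟩

lemma sum_Q1 (a b c l K : ℕ) :
    ∑ k ∈ range K, Q1 a b c l k ≤ (PPfin a b c).card ∧ 
      (PPfin a b c).card ≤ ∑ k ∈ range K, Q1 a b c l k + Tl a b c l K := by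
  classical
  have : ∑ k ∈ range K, Q1 a b c l k = ((PPfin a b c).filter fun p => p.cCol l ∈ range K).card := by
    unfold Q1
    exact sum_card_fiberwise_eq_card_filter _ _ _
  rw [this]
  constructor
  · exact card_filter_le _ _
  · unfold Tl
    rw [← card_filter_add_card_filter_not (s := PPfin a b c) (fun p => p.cCol l ∈ range K)]
    simp

lemma all_bounds (a b c : ℕ) (l : Fin 2 → ℕ) (K : ℕ) :
    ∑ j ∈ range K, ∑ k ∈ range K, Q2 a b c l j k ≤ (PPfin a b c).card ∧
    (PPfin a b c).card ≤ ∑ j ∈ range K, ∑ k ∈ range K, Q2 a b c l j k + (Tl a b c (l 0) K + Tl a b c (l 1) K) := by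
  classical
  have e : ∑ j ∈ range K, ∑ k ∈ range K, Q2 a b c l j k = ((PPfin a b c).filter fun p => p.cCol (l 0) < K ∧ p.cCol (l 1) < K).card := by
    simp only [sum_Q2]
    have := sum_card_fiberwise_eq_card_filter ((PPfin a b c).filter fun p => p.cCol (l 1) < K) (range K) (fun p => p.cCol (l 0))
    simpa only [filter_filter, mem_range, and_comm] using this
  rw [e]
  constructor
  · exact card_filter_le _ _
  · unfold Tl
    refine le_trans (card_le_card ?_) ((card_union_le _ _).trans (Nat.add_le_add_left (card_union_le _ _) _))
    intro p
    simp only [mem_filter, mem_union]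
    intro h
    by_cases h2 : p.cCol (l 1) < K
    · by_cases h3 : p.cCol (l 0) < K
      · exact Or.inl ⟨h, h3, h2⟩
      · exact Or.inr (Or.inl ⟨h, by omega⟩)
    · exact Or.inr (Or.inr ⟨h, by omega⟩)

end PlanePartition

end

section
open Finset
open scoped Nat

lemma exp_partial (t : ℝ) : Filter.Tendsto (fun K => ∑ j ∈ range K, t ^ j / (j ! : ℝ)) Filter.atTop (nhds (Real.exp t)) := by
  have := (NormedSpace.expSeries_div_hasSum_exp (𝔸 := ℝ) t).tendsto_sum_nat
  rwa [← Real.exp_eq_exp_ℝ] at this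

lemma le_dsum (F : ℕ → ℕ → ℝ) (hF : ∀ j k, 0 ≤ F j k) (K : ℕ) (hK : 1 ≤ K) :
    F 0 0 ≤ ∑ j ∈ range K, ∑ k ∈ range K, F j k := by
  have h1 : F 0 0 ≤ ∑ k ∈ range K, F 0 k :=
    single_le_sum (f := fun k => F 0 k) (fun i _ => hF 0 i) (mem_range.2 hK)
  have h2 : ∑ k ∈ range K, F 0 k ≤ ∑ j ∈ range K, ∑ k ∈ range K, F j k :=
    single_le_sum (f := fun j => ∑ k ∈ range K, F j k) (fun i _ => sum_nonneg fun k _ => hF i k) (mem_range.2 hK)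
  exact h1.trans h2

namespace PlanePartition

/-- the total count -/
noncomputable def Ntot (a b c : ℕ → ℕ) (n : ℕ) : ℝ := ((PPfin (a n) (b n) (c n)).card : ℝ)

lemma Ntot_pos (a b c : ℕ → ℕ) (n : ℕ) : 0 < Ntot a b c n := by
  unfold Ntot
  have : 0 < (PPfin (a n) (b n) (c n)).card := card_pos.2 ⟨_, zeroP_mem _ _ _⟩
  exact_mod_cast this

lemma tail_ev (a b c : ℕ → ℕ) (t : ℝ) (hC : Filter.Tendsto c Filter.atTop Filter.atTop)
    (h : Filter.Tendsto (fun n => (a n * b n : ℝ) / c n) Filter.atTop (nhds t))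
    (l K : ℕ) (hl : 1 ≤ l) (hK : 1 ≤ K) :
    ∀ᶠ n in Filter.atTop, (Tl (a n) (b n) (c n) l K : ℝ) / Ntot a b c n ≤ (t + 1) / K := by
  filter_upwards [h.eventually (gt_mem_nhds (lt_add_one t)), hC.eventually_ge_atTop l] with n h1 h2
  have hm := markov (a n) (b n) (c n) l K ⟨hl, h2⟩
  have hN := Ntot_pos a b c n
  have hc : (0:ℝ) < c n := by exact_mod_cast (by omega : 0 < c n)
  have hk : (0:ℝ) < K := by exact_mod_cast (by omega : 0 < K)
  have hm' : (c n : ℝ) * (K * Tl (a n) (b n) (c n) l K) ≤ Ntot a b c n * (a n * b n) := by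
    unfold Tl Ntot
    exact_mod_cast hm
  rw [div_lt_iff₀ hc] at h1
  rw [div_le_div_iff₀ hN hk]
  have : Ntot a b c n * (a n * b n) ≤ Ntot a b c n * ((t + 1) * c n) := mul_le_mul_of_nonneg_left h1.le hN.le
  have h3 : (c n : ℝ) * (K * Tl (a n) (b n) (c n) l K) ≤ c n * ((t + 1) * Ntot a b c n) := by linarith
  have := le_of_mul_le_mul_left h3 hc
  linarith

lemma r_lim (a b c : ℕ → ℕ) (t : ℝ) (hA : Filter.Tendsto a Filter.atTop Filter.atTop)
    (hB : Filter.Tendsto b Filter.atTop Filter.atTop) (hC : Filter.Tendsto c Filter.atTop Filter.atTop)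
    (h : Filter.Tendsto (fun n => (a n * b n : ℝ) / c n) Filter.atTop (nhds t))
    (l : Fin 2 → ℕ) (hl : Function.Injective l) (hl1 : ∀ i, 1 ≤ l i) (ht : 0 < t) :
    Filter.Tendsto (fun n => (Q2 (a n) (b n) (c n) l 0 0 : ℝ) / Ntot a b c n) Filter.atTop (nhds (Real.exp (-t) * Real.exp (-t))) := by
  set G : ℕ → ℕ → ℝ := fun K n => ∑ j ∈ range K, ∑ k ∈ range K, (Q2 (a n) (b n) (c n) l j k : ℝ) / Q2 (a n) (b n) (c n) l 0 0 with hG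
  set S : ℕ → ℝ := fun K => (∑ j ∈ range K, t ^ j / (j ! : ℝ)) * (∑ j ∈ range K, t ^ j / (j ! : ℝ)) with hS
  have hSpos : ∀ K, 1 ≤ K → 0 < S K := by
    intro K hK
    have : 0 < ∑ j ∈ range K, t ^ j / (j ! : ℝ) := sum_pos (fun i _ => by positivity) ⟨0, mem_range.2 hK⟩
    positivity
  have hGS : ∀ K, Filter.Tendsto (G K) Filter.atTop (nhds (S K)) := by
    intro K
    simp only [hG, hS, sum_mul_sum]
    exact tendsto_finsetSum _ fun j _ => tendsto_finsetSum _ fun k _ => Q2_lim a b c t hA hB hC h l hl hl1 j k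
  have hSl : Filter.Tendsto S Filter.atTop (nhds (Real.exp t * Real.exp t)) := (exp_partial t).mul (exp_partial t)
  have hC0 : Filter.Tendsto (fun K : ℕ => 2 * ((t + 1) / (K : ℝ))) Filter.atTop (nhds 0) := by
    have := (tendsto_const_div_atTop_nhds_zero_nat (t + 1)).const_mul 2
    simpa using this
  have hne : Real.exp t * Real.exp t ≠ 0 := by positivity
  have e0 : Real.exp (-t) * Real.exp (-t) = (1 - 0) / (Real.exp t * Real.exp t) := by
    rw [Real.exp_neg]; field_simp; norm_num
  refine lim_squeeze _ (fun K n => (1 - 2 * ((t + 1) / (K:ℝ))) / G K n) (fun K n => 1 / G K n) 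
    (fun K => (1 - 2 * ((t + 1) / (K:ℝ))) / S K) (fun K => 1 / S K) _ ?_ ?_ ?_ ?_ ?_
  · intro K hK
    exact tendsto_const_nhds.div (hGS K) (hSpos K hK).ne'
  · intro K hK
    exact tendsto_const_nhds.div (hGS K) (hSpos K hK).ne'
  · rw [e0]
    exact (hC0.const_sub 1).div hSl hne
  · rw [e0, sub_zero]
    exact tendsto_const_nhds.div hSl hne
  · intro K hK
    filter_upwards [tail_ev a b c t hC h (l 0) K (hl1 0) hK, tail_ev a b c t hC h (l 1) K (hl1 1) hK] with n h0 h1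
    obtain ⟨u1, u2⟩ := all_bounds (a n) (b n) (c n) l K
    have hN := Ntot_pos a b c n
    have hq : (0:ℝ) < Q2 (a n) (b n) (c n) l 0 0 := by exact_mod_cast Q2_pos (a n) (b n) (c n) l hl1
    set sq : ℝ := ∑ j ∈ range K, ∑ k ∈ range K, (Q2 (a n) (b n) (c n) l j k : ℝ) with hsq
    have v1 : sq ≤ Ntot a b c n := by
      unfold Ntot; rw [hsq]; exact_mod_cast u1
    have v2 : Ntot a b c n ≤ sq + (Tl (a n) (b n) (c n) (l 0) K + Tl (a n) (b n) (c n) (l 1) K) := by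
      unfold Ntot; rw [hsq]; exact_mod_cast u2
    have hGe : G K n = sq / Q2 (a n) (b n) (c n) l 0 0 := by
      simp only [hG, hsq, sum_div]
    have hsqpos : 0 < sq := by
      have : (Q2 (a n) (b n) (c n) l 0 0 : ℝ) ≤ sq := by
        exact le_dsum (fun j k => (Q2 (a n) (b n) (c n) l j k : ℝ)) (fun j k => Nat.cast_nonneg _) K hK
      linarith
    simp only [hGe]
    rw [div_le_iff₀ hN] at h0 h1
    constructor
    · rw [div_div_eq_mul_div, div_le_div_iff₀ hsqpos hN]
      have : (1 - 2 * ((t + 1) / (K:ℝ))) * Ntot a b c n ≤ sq := by linarith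
      nlinarith [mul_le_mul_of_nonneg_left this hq.le]
    · rw [div_div_eq_mul_div, div_le_div_iff₀ hN hsqpos]
      nlinarith [mul_le_mul_of_nonneg_left v1 hq.le]

/-- the Poisson mass -/
noncomputable def pm (t : ℝ) (k : ℕ) : ℝ := Real.exp (-t) * t ^ k / (k ! : ℝ)

lemma two_lim (a b c : ℕ → ℕ) (t : ℝ) (hA : Filter.Tendsto a Filter.atTop Filter.atTop)
    (hB : Filter.Tendsto b Filter.atTop Filter.atTop) (hC : Filter.Tendsto c Filter.atTop Filter.atTop)
    (h : Filter.Tendsto (fun n => (a n * b n : ℝ) / c n) Filter.atTop (nhds t))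
    (l : Fin 2 → ℕ) (hl : Function.Injective l) (hl1 : ∀ i, 1 ≤ l i) (ht : 0 < t) (j k : ℕ) :
    Filter.Tendsto (fun n => (Q2 (a n) (b n) (c n) l j k : ℝ) / Ntot a b c n) Filter.atTop (nhds (pm t j * pm t k)) := by
  have := (Q2_lim a b c t hA hB hC h l hl hl1 j k).mul (r_lim a b c t hA hB hC h l hl hl1 ht)
  have e : t ^ j / (j ! : ℝ) * (t ^ k / (k ! : ℝ)) * (Real.exp (-t) * Real.exp (-t)) = pm t j * pm t k := by
    unfold pm; ring
  rw [e] at this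
  refine this.congr fun n => ?_
  have hq : (0:ℝ) < Q2 (a n) (b n) (c n) l 0 0 := by exact_mod_cast Q2_pos (a n) (b n) (c n) l hl1
  field_simp

lemma one_lim (a b c : ℕ → ℕ) (t : ℝ) (hA : Filter.Tendsto a Filter.atTop Filter.atTop)
    (hB : Filter.Tendsto b Filter.atTop Filter.atTop) (hC : Filter.Tendsto c Filter.atTop Filter.atTop)
    (h : Filter.Tendsto (fun n => (a n * b n : ℝ) / c n) Filter.atTop (nhds t))
    (l : ℕ) (hl1 : 1 ≤ l) (ht : 0 < t) (j : ℕ) :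
    Filter.Tendsto (fun n => (Q1 (a n) (b n) (c n) l j : ℝ) / Ntot a b c n) Filter.atTop (nhds (pm t j)) := by
  set v : Fin 2 → ℕ := ![l, l + 1] with hv
  have hvi : Function.Injective v := by
    intro x y hxy
    fin_cases x <;> fin_cases y <;> simp [hv] at hxy ⊢
  have hv1 : ∀ i, 1 ≤ v i := by
    intro i
    fin_cases i
    · exact hl1
    · simp [hv]
  have hC0 : Filter.Tendsto (fun K : ℕ => ((t + 1) / (K : ℝ))) Filter.atTop (nhds 0) := 
    tendsto_const_div_atTop_nhds_zero_nat (t + 1)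
  have hl2 : Filter.Tendsto (fun K => ∑ k ∈ range K, pm t j * pm t k) Filter.atTop (nhds (pm t j)) := by
    have := ((exp_partial t).const_mul (Real.exp (-t))).const_mul (pm t j)
    rw [← Real.exp_add, neg_add_cancel, Real.exp_zero, mul_one] at this
    refine this.congr fun K => ?_
    rw [mul_sum, mul_sum]
    refine sum_congr rfl fun k _ => ?_
    rw [← mul_div_assoc]; rfl
  have hlK : ∀ K, Filter.Tendsto (fun n => ∑ k ∈ range K, (Q2 (a n) (b n) (c n) v j k : ℝ) / Ntot a b c n) Filter.atTop
      (nhds (∑ k ∈ range K, pm t j * pm t k)) := fun K => 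
    tendsto_finsetSum _ fun k _ => two_lim a b c t hA hB hC h v hvi hv1 ht j k
  refine lim_squeeze _ (fun K n => ∑ k ∈ range K, (Q2 (a n) (b n) (c n) v j k : ℝ) / Ntot a b c n)
    (fun K n => ∑ k ∈ range K, (Q2 (a n) (b n) (c n) v j k : ℝ) / Ntot a b c n + (t + 1) / (K:ℝ))
    (fun K => ∑ k ∈ range K, pm t j * pm t k) (fun K => ∑ k ∈ range K, pm t j * pm t k + (t + 1) / (K:ℝ)) _
    (fun K _ => hlK K) (fun K _ => (hlK K).add_const _) hl2 ?_ ?_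
  · simpa using hl2.add hC0
  · intro K hK
    filter_upwards [tail_ev a b c t hC h (v 1) K (hv1 1) hK] with n h1
    obtain ⟨u1, u2⟩ := Q1_bounds (a n) (b n) (c n) v j K
    have hN := Ntot_pos a b c n
    have w1 : ∑ k ∈ range K, (Q2 (a n) (b n) (c n) v j k : ℝ) ≤ Q1 (a n) (b n) (c n) l j := by exact_mod_cast u1
    have w2 : (Q1 (a n) (b n) (c n) l j : ℝ) ≤ ∑ k ∈ range K, (Q2 (a n) (b n) (c n) v j k : ℝ) + Tl (a n) (b n) (c n) (v 1) K := by exact_mod_cast u2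
    rw [← sum_div]
    constructor
    · exact div_le_div_of_nonneg_right w1 hN.le
    · calc _ ≤ _ := div_le_div_of_nonneg_right w2 hN.le
        _ ≤ _ := by rw [add_div]; linarith

end PlanePartition

end

section
open Finset
open scoped Nat

namespace PlanePartition

/-- joint count -/
noncomputable def Jc (a b c m : ℕ) (l k : Fin m → ℕ) : ℕ :=
  ((PPfin a b c).filter fun p => ∀ i, p.cCol (l i) = k i).card

/-- indicator -/
noncomputable def ind (l k : ℕ) (p : PlanePartition) : ℝ := if p.cCol l = k then 1 else 0

lemma var_sum (S : Finset PlanePartition) (L : ℕ) (f : Fin L → ℕ) (k0 : ℕ) (q : ℝ) :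
    ∑ p ∈ S, (∑ i, ind (f i) k0 p - L * q) ^ 2 =
      ∑ i, ∑ j, ((S.filter fun p => p.cCol (f i) = k0 ∧ p.cCol (f j) = k0).card : ℝ) 
       - 2 * L * q * ∑ i, ((S.filter fun p => p.cCol (f i) = k0).card : ℝ) + L ^ 2 * q ^ 2 * S.card := by
  have e1 : ∀ i j, ((S.filter fun p => p.cCol (f i) = k0 ∧ p.cCol (f j) = k0).card : ℝ) = ∑ p ∈ S, ind (f i) k0 p * ind (f j) k0 p := by
    intro i j
    rw [card_filter]
    push_cast
    refine sum_congr rfl fun p _ => ?_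
    unfold ind
    by_cases h1 : p.cCol (f i) = k0 <;> by_cases h2 : p.cCol (f j) = k0 <;> simp [h1, h2]
  have e2 : ∀ i, ((S.filter fun p => p.cCol (f i) = k0).card : ℝ) = ∑ p ∈ S, ind (f i) k0 p := by
    intro i
    rw [card_filter]
    push_cast
    rfl
  simp only [e1, e2]
  have c1 : ∑ i, ∑ j, ∑ p ∈ S, ind (f i) k0 p * ind (f j) k0 p = ∑ p ∈ S, (∑ i, ind (f i) k0 p) * (∑ i, ind (f i) k0 p) := by
    simp only [sum_mul_sum]
    rw [sum_comm' (s := S) (t := fun _ => univ) (t' := univ) (s' := fun _ => S) (by simp)]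
    refine sum_congr rfl fun i _ => ?_
    rw [sum_comm]
  have c2 : ∑ i, ∑ p ∈ S, ind (f i) k0 p = ∑ p ∈ S, ∑ i, ind (f i) k0 p := sum_comm
  have c3 : (L:ℝ) ^ 2 * q ^ 2 * S.card = ∑ p ∈ S, (L:ℝ) ^ 2 * q ^ 2 := by simp; ring
  rw [c1, c2, c3, mul_sum, ← sum_sub_distrib, ← sum_add_distrib]
  refine sum_congr rfl fun p _ => ?_
  ring

lemma step_bound (a b c m : ℕ) (l k : Fin (m+1) → ℕ) (hl : Function.Injective l) (hc : ∀ i, 1 ≤ l i ∧ l i ≤ c)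
    (L : ℕ) (f : Fin L → ℕ) (hf : ∀ i, 1 ≤ f i ∧ f i ≤ c) (hfl : ∀ i j, f i ≠ l j) (q : ℝ) :
    ((L:ℝ) * (Jc a b c (m+1) l k - q * Jc a b c m (fun i => l i.succ) (fun i => k i.succ))) ^ 2 ≤ 
      (PPfin a b c).card * ∑ p ∈ PPfin a b c, (∑ i, ind (f i) (k 0) p - L * q) ^ 2 := by
  classical
  set B := (PPfin a b c).filter fun p => ∀ i : Fin m, p.cCol (l i.succ) = k i.succ with hB
  have hJ : ∀ i, (Jc a b c (m+1) l k : ℝ) = ∑ p ∈ B, ind (f i) (k 0) p := by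
    intro i
    have hinj : Function.Injective (Fin.cons (f i) (fun i : Fin m => l i.succ) : Fin (m+1) → ℕ) := by
      rw [Fin.cons_injective_iff]
      refine ⟨?_, fun x y hxy => Fin.succ_injective _ (hl hxy)⟩
      rintro ⟨j, hj⟩
      exact hfl i _ hj.symm
    have := exch a b c (m+1) l (Fin.cons (f i) (fun i : Fin m => l i.succ)) hl hc hinj (by
      intro j
      refine Fin.cases ?_ (fun j => ?_) j
      · exact hf i
      · exact hc j.succ) k
    unfold Jc
    rw [this]
    have e2 : ∑ p ∈ B, ind (f i) (k 0) p = ((B.filter fun p => p.cCol (f i) = k 0).card : ℝ) := by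
      rw [card_filter]; push_cast; rfl
    rw [e2, hB, filter_filter]
    congr 2
    refine filter_congr fun p _ => ?_
    rw [Fin.forall_fin_succ]
    simp [and_comm]
  have e1 : (L:ℝ) * (Jc a b c (m+1) l k - q * Jc a b c m (fun i => l i.succ) (fun i => k i.succ)) = ∑ p ∈ B, (∑ i, ind (f i) (k 0) p - L * q) := by
    rw [sum_sub_distrib, sum_comm, ← sum_congr rfl (fun i _ => hJ i)]
    have : (Jc a b c m (fun i => l i.succ) (fun i => k i.succ) : ℝ) = B.card := rfl
    rw [this]
    simp
    ring
  rw [e1]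
  refine (sq_sum_le_card_mul_sum_sq).trans ?_
  have hsub : B ⊆ PPfin a b c := filter_subset _ _
  refine mul_le_mul ?_ ?_ (sum_nonneg fun i _ => sq_nonneg _) (by positivity)
  · exact_mod_cast card_le_card hsub
  · exact sum_le_sum_of_subset_of_nonneg hsub fun i _ _ => sq_nonneg _

lemma var_lim (a b c : ℕ → ℕ) (t : ℝ) (ht : 0 < t) (hA : Filter.Tendsto a Filter.atTop Filter.atTop)
    (hB : Filter.Tendsto b Filter.atTop Filter.atTop) (hC : Filter.Tendsto c Filter.atTop Filter.atTop)
    (h : Filter.Tendsto (fun n => (a n * b n : ℝ) / c n) Filter.atTop (nhds t))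
    (L : ℕ) (hL : 1 ≤ L) (f : Fin L → ℕ) (hfi : Function.Injective f) (hf : ∀ i, 1 ≤ f i) (k0 : ℕ) :
    Filter.Tendsto (fun n => (∑ p ∈ PPfin (a n) (b n) (c n), (∑ i, ind (f i) k0 p - L * pm t k0) ^ 2) / Ntot a b c n / L ^ 2)
      Filter.atTop (nhds ((pm t k0 - pm t k0 ^ 2) / L)) := by
  classical
  have hone := fun i => one_lim a b c t hA hB hC h (f i) (hf i) ht k0
  have htwo : ∀ i j, Filter.Tendsto (fun n => (((PPfin (a n) (b n) (c n)).filter fun p => p.cCol (f i) = k0 ∧ p.cCol (f j) = k0).card : ℝ) / Ntot a b c n) 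
      Filter.atTop (nhds (if i = j then pm t k0 else pm t k0 ^ 2)) := by
    intro i j
    split_ifs with hij
    · subst hij
      simpa [Q1] using hone i
    · have := two_lim a b c t hA hB hC h ![f i, f j] (by
        intro x y hxy
        have hne : f i ≠ f j := fun h => hij (hfi h)
        fin_cases x <;> fin_cases y <;> simp at hxy ⊢
        · exact hne hxy
        · exact hne hxy.symm) (by
        intro x
        fin_cases x
        · exact hf i
        · exact hf j) ht k0 k0
      rw [← sq] at this
      simp only [Q2_eq] at this
      exact this
  have hs1 := tendsto_finsetSum univ (fun i (_ : i ∈ univ) => hone i)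
  have hs2 := tendsto_finsetSum univ (fun i (_ : i ∈ univ) => tendsto_finsetSum univ (fun j (_ : j ∈ univ) => htwo i j))
  have hall := ((hs2.sub (hs1.const_mul (2 * L * pm t k0))).add_const ((L:ℝ) ^ 2 * pm t k0 ^ 2)).div_const ((L:ℝ) ^ 2)
  have hLr : (L:ℝ) ≠ 0 := by positivity
  convert hall using 1
  · funext n
    have hN := Ntot_pos a b c n
    congr 1
    rw [var_sum]
    simp only [← sum_div]
    rw [div_eq_iff hN.ne', add_mul, sub_mul, mul_assoc (2 * (L:ℝ) * pm t k0), div_mul_cancel₀ _ hN.ne', div_mul_cancel₀ _ hN.ne']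
    rfl
  · congr 1
    have : ∀ i : Fin L, ∑ j : Fin L, (if i = j then pm t k0 else pm t k0 ^ 2) = pm t k0 - pm t k0 ^ 2 + L * pm t k0 ^ 2 := by
      intro i
      have : ∀ j : Fin L, (if i = j then pm t k0 else pm t k0 ^ 2) = (if i = j then pm t k0 - pm t k0 ^ 2 else 0) + pm t k0 ^ 2 := by
        intro j; split_ifs <;> ring
      simp only [this, sum_add_distrib, sum_ite_eq]
      simp
    simp only [this]
    simp
    field_simp
    ring

lemma joint_lim (a b c : ℕ → ℕ) (t : ℝ) (ht : 0 < t) (hA : Filter.Tendsto a Filter.atTop Filter.atTop)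
    (hB : Filter.Tendsto b Filter.atTop Filter.atTop) (hC : Filter.Tendsto c Filter.atTop Filter.atTop)
    (h : Filter.Tendsto (fun n => (a n * b n : ℝ) / c n) Filter.atTop (nhds t)) (m : ℕ) :
    ∀ (l k : Fin m → ℕ), Function.Injective l → (∀ i, 1 ≤ l i) → 
    Filter.Tendsto (fun n => (Jc (a n) (b n) (c n) m l k : ℝ) / Ntot a b c n) Filter.atTop (nhds (∏ i, pm t (k i))) := by
  induction m with
  | zero => 
    intro l k _ _
    simp only [univ_eq_empty, prod_empty]
    refine tendsto_const_nhds.congr fun n => ?_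
    have hN := Ntot_pos a b c n
    have : (Jc (a n) (b n) (c n) 0 l k : ℝ) = Ntot a b c n := by simp [Jc, Ntot]
    rw [this, div_self hN.ne']
  | succ m ih => 
    intro l k hl hl1
    have hih := ih (fun i => l i.succ) (fun i => k i.succ) (fun x y hxy => Fin.succ_injective _ (hl hxy)) (fun i => hl1 i.succ)
    set q := pm t (k 0) with hq
    set d : ℕ → ℝ := fun n => (Jc (a n) (b n) (c n) (m+1) l k : ℝ) / Ntot a b c n - 
      q * ((Jc (a n) (b n) (c n) m (fun i => l i.succ) (fun i => k i.succ) : ℝ) / Ntot a b c n) with hd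
    let f : (L : ℕ) → Fin L → ℕ := fun L i => (∑ j, l j) + 1 + i
    have hle : ∀ j, l j ≤ ∑ j, l j := fun j => single_le_sum (f := l) (fun i _ => Nat.zero_le _) (mem_univ j)
    have hd2 : Filter.Tendsto (fun n => d n ^ 2) Filter.atTop (nhds 0) := by
      refine lim_squeeze _ (fun _ _ => 0) 
        (fun L n => (∑ p ∈ PPfin (a n) (b n) (c n), (∑ i, ind (f L i) (k 0) p - L * q) ^ 2) / Ntot a b c n / L ^ 2)
        (fun _ => 0) (fun L => (q - q ^ 2) / L) 0 (fun _ _ => tendsto_const_nhds) ?_ tendsto_const_nhds 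
        (tendsto_const_div_atTop_nhds_zero_nat _) ?_
      · intro L hL
        refine var_lim a b c t ht hA hB hC h L hL (f L) ?_ ?_ (k 0)
        · intro x y hxy
          simp only [f] at hxy
          exact Fin.ext (by omega)
        · intro i; simp only [f]; omega
      · intro L hL
        filter_upwards [hC.eventually_ge_atTop (∑ j, l j + 1 + L)] with n hn
        refine ⟨sq_nonneg _, ?_⟩
        have hN := Ntot_pos a b c n
        have hLr : (0:ℝ) < L := by exact_mod_cast hL
        have := step_bound (a n) (b n) (c n) m l k hl (fun i => ⟨hl1 i, by have := hle i; omega⟩) L (f L)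
          (fun i => by simp only [f]; have := i.2; omega) (fun i j => by simp only [f]; have := hle j; omega) q
        rw [div_div, le_div_iff₀ (by positivity)]
        have e : d n = ((Jc (a n) (b n) (c n) (m+1) l k : ℝ) - q * Jc (a n) (b n) (c n) m (fun i => l i.succ) (fun i => k i.succ)) / Ntot a b c n := by
          simp only [hd]; ring
        rw [e, div_pow]
        rw [show ((PPfin (a n) (b n) (c n)).card : ℝ) = Ntot a b c n from rfl] at this
        set X := ((Jc (a n) (b n) (c n) (m+1) l k : ℝ) - q * Jc (a n) (b n) (c n) m (fun i => l i.succ) (fun i => k i.succ))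
        set V := ∑ p ∈ PPfin (a n) (b n) (c n), (∑ i, ind (f L i) (k 0) p - L * q) ^ 2
        have e2 : X ^ 2 / Ntot a b c n ^ 2 * (Ntot a b c n * (L:ℝ) ^ 2) = (L * X) ^ 2 / Ntot a b c n := by
          field_simp
        rw [e2, div_le_iff₀ hN, mul_comm V]
        exact this
    have hd0 : Filter.Tendsto d Filter.atTop (nhds 0) := by
      have := hd2.sqrt
      simp only [Real.sqrt_sq_eq_abs, Real.sqrt_zero] at this
      exact (tendsto_zero_iff_abs_tendsto_zero _).2 this
    have := hd0.add (hih.const_mul q)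
    rw [zero_add, hq] at this
    rw [Fin.prod_univ_succ]
    refine this.congr fun n => ?_
    simp only [hd]
    ring

end PlanePartition

end

open Filter in
/-- Poisson regime: if `a_n, b_n, c_n → ∞` with `a_n b_n / c_n → t > 0`,
then for distinct positive levels `ℓ_1,…,ℓ_m` and any `k_1,…,k_m ∈ ℕ`, the uniform
probability that `c_{ℓ_i}(π) = k_i` for all `i` converges to `∏_i e^{−t} t^{k_i}/k_i!`. -/
theorem corners_poisson_limit (t : ℝ) (ht : 0 < t) (a b c : ℕ → ℕ)
    (ha : ∀ n, 0 < a n) (hb : ∀ n, 0 < b n) (hc : ∀ n, 0 < c n)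
    (ha' : Tendsto a atTop atTop) (hb' : Tendsto b atTop atTop)
    (hc' : Tendsto c atTop atTop)
    (hlim : Tendsto (fun n => (a n * b n : ℝ) / (c n : ℝ)) atTop (nhds t))
    (m : ℕ) (hm : 0 < m) (ℓ : Fin m → ℕ) (hinj : Function.Injective ℓ)
    (hpos : ∀ i, 1 ≤ ℓ i) (k : Fin m → ℕ) :
    Tendsto (fun n =>
        (({π ∈ PP (a n) (b n) (c n) | ∀ i, π.cCol (ℓ i) = k i}.ncard : ℝ)
          / ((PP (a n) (b n) (c n)).ncard : ℝ)))
      atTop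
      (nhds (∏ i, Real.exp (-t) * t ^ k i / (k i).factorial)) := by
  have main := PlanePartition.joint_lim a b c t ht ha' hb' hc' hlim m ℓ k hinj hpos
  refine main.congr fun n => ?_
  unfold PlanePartition.Ntot PlanePartition.Jc
  rw [← PlanePartition.coe_PPfin, Set.ncard_coe_finset]
  congr 2
  rw [← Set.ncard_coe_finset]
  congr 1
  ext p
  simp
end

section
/- Negative binomial regime: let b be a fixed positive integer, let q ∈ (0,1), and let a_n, c_n be sequences of positive integers tending to infinity with a_n/(a_n + c_n) → q. Fix m ≥ 1, distinct positive integers ℓ_1,…,ℓ_m, and nonnegative integers k_1,…,k_m. Then #{π ∈ PP(a_n,b,c_n) : c_{ℓ_i}(π) = k_i for all i} / |PP(a_n,b,c_n)| → ∏_{i=1}^{m} C(k_i + b − 1, k_i) (1 − q)^b q^{k_i} as n → ∞; i.e. each c_ℓ(π) converges in distribution to the negative binomial distribution NB(b,q), asymptotically independently across levels. -/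
open scoped BigOperators

section Algebra

variable {R : Type*} [CommRing R]

open scoped Classical in
/-- antitone sequences supported on `[0,b)` and bounded by `lam` there. -/
noncomputable def subShapes : ℕ → (ℕ → ℕ) → Finset (ℕ → ℕ)
  | 0, _ => {fun _ => 0}
  | b + 1, lam => (subShapes b (fun i => lam (i + 1))).biUnion fun ν =>
      (Finset.Icc (ν 0) (lam 0)).image fun t => fun i => Nat.casesOn i t ν

lemma mem_subShapes (b : ℕ) : ∀ (lam μ : ℕ → ℕ), μ ∈ subShapes b lam ↔
    (∀ i, μ (i + 1) ≤ μ i) ∧ (∀ i, b ≤ i → μ i = 0) ∧ ∀ i, i < b → μ i ≤ lam i := by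
  induction b with
  | zero =>
    intro lam μ
    simp only [subShapes, Finset.mem_singleton]
    constructor
    · rintro rfl
      simp
    · rintro ⟨_, h, _⟩
      funext i
      exact h i (Nat.zero_le _)
  | succ b ih =>
    intro lam μ
    simp only [subShapes, Finset.mem_biUnion, Finset.mem_image, Finset.mem_Icc]
    constructor
    · rintro ⟨ν, hν, t, ⟨h1, h2⟩, rfl⟩
      obtain ⟨a1, a2, a3⟩ := (ih _ _).1 hν
      refine ⟨?_, ?_, ?_⟩
      · intro i
        cases i with
        | zero => exact h1
        | succ i => exact a1 i
      · intro i hi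
        cases i with
        | zero => omega
        | succ i => exact a2 i (by omega)
      · intro i hi
        cases i with
        | zero => exact h2
        | succ i => exact a3 i (by omega)
    · rintro ⟨a1, a2, a3⟩
      refine ⟨fun i => μ (i + 1), (ih _ _).2 ⟨fun i => a1 _, fun i hi => a2 _ (by omega),
        fun i hi => a3 _ (by omega)⟩, μ 0, ⟨a1 0, a3 0 (by omega)⟩, ?_⟩
      funext i
      cases i <;> rfl

lemma sum_subShapes_succ {M : Type*} [AddCommMonoid M] (b : ℕ) (lam : ℕ → ℕ)
    (f : (ℕ → ℕ) → M) :
    ∑ μ ∈ subShapes (b + 1) lam, f μ =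
      ∑ ν ∈ subShapes b (fun i => lam (i + 1)), ∑ t ∈ Finset.Icc (ν 0) (lam 0),
        f (fun i => Nat.casesOn i t ν) := by
  classical
  rw [subShapes, Finset.sum_biUnion]
  · refine Finset.sum_congr rfl fun ν _ => ?_
    rw [Finset.sum_image]
    intro t _ t' _ h
    exact congrFun h 0
  · intro ν _ ν' _ hne
    rw [Function.onFun, Finset.disjoint_left]
    intro μ h1 h2
    simp only [Finset.mem_image] at h1 h2
    obtain ⟨t, _, rfl⟩ := h1
    obtain ⟨t', _, h⟩ := h2
    apply hne
    funext i
    exact (congrFun h (i + 1)).symm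

lemma alt_curry_sum {V : Type*} [AddCommGroup V] [Module R V] (b : ℕ)
    (D : V [⋀^Fin (b + 1)]→ₗ[R] R) (s : Finset ℕ) (f : ℕ → V) (v : Fin b → V) :
    ∑ t ∈ s, D.curryLeft (f t) v = D.curryLeft (∑ t ∈ s, f t) v := by
  classical
  induction s using Finset.induction_on with
  | empty => simp
  | insert a s ha ih =>
    rw [Finset.sum_insert ha, Finset.sum_insert ha, ih, map_add, AlternatingMap.add_apply]

lemma alt_sum {V : Type*} [AddCommGroup V] [Module R V] (b : ℕ) :
    ∀ (D : V [⋀^Fin b]→ₗ[R] R) (φ : ℕ → ℕ → V) (w : ℕ → ℕ → R) (lam : ℕ → ℕ)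
      (Rv : ℕ → V) (cc : ℕ → R)
      (_ : ∀ i, i < b → ∀ u, u ≤ lam (i + 1) →
        ∑ t ∈ Finset.Icc u (lam i), w i t • φ i t = Rv i - cc i • φ (i + 1) u)
      (_ : φ b 0 = 0),
      ∑ μ ∈ subShapes b lam, (∏ i ∈ Finset.range b, w i (μ i)) * D (fun i => φ i (μ i))
        = D (fun i => Rv i) := by
  induction b with
  | zero =>
    intro D φ w lam Rv cc _ _
    simp only [subShapes, Finset.sum_singleton, Finset.range_zero, Finset.prod_empty, one_mul]
    congr 1
    exact Subsingleton.elim _ _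
  | succ b ih =>
    intro D φ w lam Rv cc h hl
    rw [sum_subShapes_succ]
    have key := ih (D.curryLeft (Rv 0)) (fun i => φ (i + 1)) (fun i => w (i + 1))
      (fun i => lam (i + 1)) (fun i => Rv (i + 1)) (fun i => cc (i + 1))
      (fun i hi u hu => h (i + 1) (by omega) u hu) hl
    have e : (fun i : Fin (b + 1) => Rv i) = Matrix.vecCons (Rv 0) (fun i : Fin b => Rv (i + 1)) := by
      funext i
      refine Fin.cases ?_ (fun i => ?_) i <;> simp
    rw [e, ← AlternatingMap.curryLeft_apply_apply, ← key]
    refine Finset.sum_congr rfl fun ν hν => ?_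
    obtain ⟨a1, a2, a3⟩ := (mem_subShapes _ _ _).1 hν
    have hν0 : ν 0 ≤ lam 1 := by
      rcases Nat.eq_zero_or_pos b with hb | hb
      · rw [a2 0 (by omega)]; exact Nat.zero_le _
      · exact a3 0 hb
    have hsum := h 0 (by omega) (ν 0) hν0
    have h1 : ∀ t, (∏ i ∈ Finset.range (b + 1), w i ((fun i => Nat.casesOn i t ν : ℕ → ℕ) i)) *
        D (fun i => φ i ((fun i => Nat.casesOn i t ν : ℕ → ℕ) i)) =
        (∏ i ∈ Finset.range b, w (i + 1) (ν i)) *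
          D.curryLeft (w 0 t • φ 0 t) (fun i : Fin b => φ (i + 1) (ν i)) := by
      intro t
      rw [Finset.prod_range_succ', map_smul, AlternatingMap.smul_apply,
        AlternatingMap.curryLeft_apply_apply, smul_eq_mul]
      have : (fun i : Fin (b + 1) => φ i ((fun i => Nat.casesOn i t ν : ℕ → ℕ) i)) =
        Matrix.vecCons (φ 0 t) (fun i : Fin b => φ (i + 1) (ν i)) := by
        funext i
        refine Fin.cases ?_ (fun i => ?_) i <;> simp
      rw [this]
      change _ * w 0 t * _ = _
      ring
    have h2 : D.curryLeft (φ 1 (ν 0)) (fun i : Fin b => φ (i + 1) (ν i)) = 0 := by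
      rw [AlternatingMap.curryLeft_apply_apply]
      rcases Nat.eq_zero_or_pos b with hb | hb
      · subst hb
        rw [a2 0 (by omega), hl]
        exact D.map_coord_zero 0 rfl
      · obtain ⟨b', rfl⟩ : ∃ b', b = b' + 1 := ⟨b - 1, by omega⟩
        refine D.map_eq_zero_of_eq _ (i := 0) (j := 1) ?_ (by simp)
        simp [Matrix.cons_val_one]
    rw [Finset.sum_congr rfl (fun t _ => h1 t), ← Finset.mul_sum]
    congr 1
    rw [alt_curry_sum, hsum, map_sub, map_smul,
      AlternatingMap.sub_apply, AlternatingMap.smul_apply, zero_add, h2, smul_zero, sub_zero]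

lemma alt_row_op {V : Type*} [AddCommGroup V] [Module R V] (b : ℕ) :
    ∀ (D : V [⋀^Fin b]→ₗ[R] R) (T : ℕ → V) (cc : ℕ → R) (_ : cc (b - 1) • T b = 0),
      D (fun i => T i - cc i • T (i + 1)) = D (fun i => T i) := by
  induction b with
  | zero =>
    intro D T cc _
    congr 1
    exact Subsingleton.elim _ _
  | succ b ih =>
    intro D T cc h
    have e1 : (fun i : Fin (b + 1) => T i - cc i • T (i + 1)) =
      Matrix.vecCons (T 0 - cc 0 • T 1) (fun i : Fin b => T (i + 1) - cc (i + 1) • T (i + 1 + 1)) := by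
      funext i
      refine Fin.cases ?_ (fun i => ?_) i <;> simp
    have e2 : (fun i : Fin (b + 1) => T i) = Matrix.vecCons (T 0) (fun i : Fin b => T (i + 1)) := by
      funext i
      refine Fin.cases ?_ (fun i => ?_) i <;> simp
    rw [e1, e2, ← AlternatingMap.curryLeft_apply_apply, ← AlternatingMap.curryLeft_apply_apply]
    rcases Nat.eq_zero_or_pos b with hb | hb
    · subst hb
      have : cc 0 • T 1 = 0 := h
      rw [this, sub_zero]
      congr 1
      exact Subsingleton.elim _ _
    · rw [ih (D.curryLeft (T 0 - cc 0 • T 1)) (fun i => T (i + 1)) (fun i => cc (i + 1))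
        (by simpa [Nat.sub_add_cancel hb] using h)]
      rw [map_sub, map_smul, AlternatingMap.sub_apply, AlternatingMap.smul_apply]
      have h2 : D.curryLeft (T 1) (fun i : Fin b => T (i + 1)) = 0 := by
        rw [AlternatingMap.curryLeft_apply_apply]
        obtain ⟨b', rfl⟩ : ∃ b', b = b' + 1 := ⟨b - 1, by omega⟩
        refine D.map_eq_zero_of_eq _ (i := 0) (j := 1) ?_ (by simp)
        simp [Matrix.cons_val_one]
      rw [h2, smul_zero, sub_zero]

/-- coefficient with an integer index. -/
noncomputable def zc (n : ℤ) (f : PowerSeries R) : R :=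
  if 0 ≤ n then PowerSeries.coeff n.toNat f else 0

lemma zc_neg {n : ℤ} (hn : n < 0) (f : PowerSeries R) : zc n f = 0 := by
  rw [zc, if_neg (by omega)]

lemma zc_nat (n : ℕ) (f : PowerSeries R) : zc (n : ℤ) f = PowerSeries.coeff n f := by
  simp [zc]

lemma zc_sub (n : ℤ) (f g : PowerSeries R) : zc n (f - g) = zc n f - zc n g := by
  unfold zc
  split_ifs <;> simp

lemma zc_X_mul (n : ℤ) (f : PowerSeries R) : zc n (PowerSeries.X * f) = zc (n - 1) f := by
  unfold zc
  split_ifs with h1 h2 h2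
  · obtain ⟨k, hk⟩ : ∃ k : ℕ, n = k + 1 := ⟨(n - 1).toNat, by omega⟩
    subst hk
    have e1 : ((k : ℤ) + 1).toNat = k + 1 := by omega
    have e2 : ((k : ℤ) + 1 - 1).toNat = k := by omega
    rw [e1, e2, PowerSeries.coeff_succ_X_mul]
  · have : n.toNat = 0 := by omega
    rw [this, PowerSeries.coeff_zero_X_mul]
  · omega
  · rfl

lemma zc_C_mul (n : ℤ) (y : R) (f : PowerSeries R) :
    zc n (PowerSeries.C y * f) = y * zc n f := by
  unfold zc
  split_ifs <;> simp

/-- the geometric series. -/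
noncomputable def geo (y : R) : PowerSeries R := PowerSeries.mk fun n => y ^ n

lemma zc_geo (n : ℤ) (y : R) (f : PowerSeries R) :
    zc n (geo y * f) - y * zc (n - 1) (geo y * f) = zc n f := by
  have h : geo y - PowerSeries.C y * (PowerSeries.X * geo y) = 1 := by
    ext n
    rw [map_sub, PowerSeries.coeff_C_mul]
    cases n with
    | zero => simp [geo]
    | succ n => 
      rw [PowerSeries.coeff_succ_X_mul]
      simp [geo, PowerSeries.coeff_one, pow_succ, mul_comm]
  rw [← zc_X_mul, ← zc_C_mul, ← zc_sub]
  congr 1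
  calc _ = (geo y - PowerSeries.C y * (PowerSeries.X * geo y)) * f := by ring
    _ = f := by rw [h, one_mul]

lemma one_sub_mul_geo : (1 - PowerSeries.X) * geo (1 : R) = 1 := by
  have : geo (1 : R) = PowerSeries.mk 1 := by
    ext n
    simp [geo]
  rw [this, mul_comm, PowerSeries.mk_one_mul_one_sub_eq_one]

/-- the row vectors of the determinant. -/
noncomputable def rowV (b : ℕ) (F : PowerSeries R) (i t : ℕ) : Fin b → R :=
  fun j => zc ((t : ℤ) - i + (j : ℕ)) ((1 - PowerSeries.X) ^ (j : ℕ) * geo 1 ^ i * F)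

lemma rowV_tele (b : ℕ) (F : PowerSeries R) (i t : ℕ) :
    rowV b F i t = rowV b F (i + 1) (t + 1) - rowV b F (i + 1) t := by
  funext j
  simp only [rowV, Pi.sub_apply]
  have e1 : (((t + 1 : ℕ) : ℤ) - ((i + 1 : ℕ) : ℤ) + (j : ℕ)) = (t : ℤ) - i + (j : ℕ) := by
    push_cast; ring
  have e2 : ((t : ℤ) - ((i + 1 : ℕ) : ℤ) + (j : ℕ)) = (t : ℤ) - i + (j : ℕ) - 1 := by
    push_cast; ring
  rw [e1, e2, ← zc_geo _ (1 : R) ((1 - PowerSeries.X) ^ (j : ℕ) * geo 1 ^ i * F)]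
  have e3 : geo 1 * ((1 - PowerSeries.X) ^ (j : ℕ) * geo 1 ^ i * F) =
    (1 - PowerSeries.X) ^ (j : ℕ) * geo (1 : R) ^ (i + 1) * F := by ring
  rw [e3, one_mul]

lemma rowV_geo (b : ℕ) (F : PowerSeries R) (y : R) (i t : ℕ) :
    rowV b F i (t + 1) = rowV b (geo y * F) i (t + 1) - y • rowV b (geo y * F) i t := by
  funext j
  simp only [rowV, Pi.sub_apply, Pi.smul_apply, smul_eq_mul]
  rw [← zc_geo _ y]
  have e2 : (((t + 1 : ℕ) : ℤ) - i + (j : ℕ) - 1) = (t : ℤ) - i + (j : ℕ) := by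
    push_cast; ring
  have e3 : geo y * ((1 - PowerSeries.X) ^ (j : ℕ) * geo 1 ^ i * F) =
    (1 - PowerSeries.X) ^ (j : ℕ) * geo (1 : R) ^ i * (geo y * F) := by ring
  rw [e2, e3]

lemma rowV_sum (b : ℕ) (F : PowerSeries R) (i u v : ℕ) (h : u ≤ v + 1) :
    ∑ t ∈ Finset.Icc u v, rowV b F i t = rowV b F (i + 1) (v + 1) - rowV b F (i + 1) u := by
  rw [← Finset.Ico_add_one_right_eq_Icc, ← Finset.sum_Ico_sub (rowV b F (i + 1)) h]
  exact Finset.sum_congr rfl fun t _ => rowV_tele _ _ _ _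

lemma rowV_branch (b : ℕ) (F : PowerSeries R) (y : R) (i u p d : ℕ) (hu : u ≤ p) :
    ∑ t ∈ Finset.Icc u (p + d), y ^ (p + d - max p t) • rowV b F i t =
      (rowV b (geo y * F) i (p + d) - ((y - 1) * y ^ d) • rowV b (geo y * F) (i + 1) p)
        - y ^ d • rowV b F (i + 1) u := by
  induction d with
  | zero =>
    have : ∀ t ∈ Finset.Icc u (p + 0), y ^ (p + 0 - max p t) • rowV b F i t = rowV b F i t := by
      intro t ht
      rw [Finset.mem_Icc] at ht
      have : p + 0 - max p t = 0 := by omega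
      rw [this, pow_zero, one_smul]
    rw [Finset.sum_congr rfl this, rowV_sum _ _ _ _ _ (by omega), add_zero,
      rowV_geo b F y, rowV_tele b (geo y * F) i p]
    module
  | succ d ih =>
    rw [← add_assoc, Finset.sum_Icc_succ_top (by omega)]
    have : ∀ t ∈ Finset.Icc u (p + d), y ^ (p + d + 1 - max p t) • rowV b F i t =
        y • (y ^ (p + d - max p t) • rowV b F i t) := by
      intro t ht
      rw [Finset.mem_Icc] at ht
      have : p + d + 1 - max p t = (p + d - max p t) + 1 := by omega
      rw [this, smul_smul, pow_succ']
    rw [Finset.sum_congr rfl this, ← Finset.smul_sum, ih]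
    have : p + d + 1 - max p (p + d + 1) = 0 := by omega
    rw [this, pow_zero, one_smul, rowV_geo b F y, pow_succ]
    module

/-- the determinantal form of the dual Grothendieck polynomial. -/
noncomputable def gDet (b : ℕ) (F : PowerSeries R) (lam : ℕ → ℕ) : R :=
  Matrix.detRowAlternating (fun i : Fin b => rowV b F i (lam i))

lemma gDet_branch (b : ℕ) (F : PowerSeries R) (y : R) (lam : ℕ → ℕ)
    (h1 : ∀ i, lam (i + 1) ≤ lam i) (h2 : lam b = 0) :
    ∑ μ ∈ subShapes b lam,
      (∏ i ∈ Finset.range b, y ^ (lam i - max (lam (i + 1)) (μ i))) * gDet b F μ =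
    gDet b (geo y * F) lam := by
  have hz : ∀ G : PowerSeries R, rowV b G b 0 = 0 := by
    intro G
    funext j
    rw [rowV, zc_neg]
    · rfl
    · have := j.2; omega
  have := alt_sum b (Matrix.detRowAlternating (R := R) (n := Fin b)) (rowV b F)
    (fun i t => y ^ (lam i - max (lam (i + 1)) t)) lam
    (fun i => rowV b (geo y * F) i (lam i) -
      ((y - 1) * y ^ (lam i - lam (i + 1))) • rowV b (geo y * F) (i + 1) (lam (i + 1)))
    (fun i => y ^ (lam i - lam (i + 1)))
    (by
      intro i hi u hu
      have := rowV_branch b F y i u (lam (i + 1)) (lam i - lam (i + 1)) hu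
      rwa [Nat.add_sub_cancel' (h1 i)] at this)
    (hz F)
  unfold gDet
  rw [this]
  apply alt_row_op b _ (fun i => rowV b (geo y * F) i (lam i))
    (fun i => (y - 1) * y ^ (lam i - lam (i + 1)))
  rw [h2, hz, smul_zero]

lemma zc_one_sub_pow (j p : ℕ) : zc (((p + 1 + j : ℕ) : ℤ)) ((1 - PowerSeries.X) ^ j : PowerSeries R) = 0 := by
  induction j generalizing p with
  | zero => 
    rw [zc_nat, pow_zero, PowerSeries.coeff_one, if_neg (by omega)]
  | succ j ih =>
    rw [pow_succ', sub_mul, one_mul, zc_sub, zc_X_mul]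
    have e1 : ((p + 1 + (j + 1) : ℕ) : ℤ) = ((p + 1 + 1 + j : ℕ) : ℤ) := by push_cast; ring
    have e2 : ((p + 1 + (j + 1) : ℕ) : ℤ) - 1 = ((p + 1 + j : ℕ) : ℤ) := by push_cast; ring
    rw [e2, e1, ih, ih, sub_zero]

open scoped Classical in
lemma gDet_one (b : ℕ) (lam : ℕ → ℕ) (h1 : ∀ i, lam (i + 1) ≤ lam i)
    (h2 : ∀ i, b ≤ i → lam i = 0) :
    gDet b (1 : PowerSeries R) lam = if lam = 0 then 1 else 0 := by
  have hanti : Antitone lam := antitone_nat_of_succ_le h1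
  split_ifs with h
  · subst h
    unfold gDet
    change Matrix.det (Matrix.of fun i j : Fin b => rowV b (1 : PowerSeries R) i 0 j) = 1
    rw [Matrix.det_of_isUpperTriangular]
    · apply Finset.prod_eq_one
      intro i _
      simp only [Matrix.of_apply, rowV, mul_one]
      rw [← mul_pow, one_sub_mul_geo, one_pow]
      simp [zc]
    · intro i j hij
      have hij : j < i := hij
      exact zc_neg (by have : (j : ℕ) < i := hij; omega) _
  · have hpos : 0 < lam 0 := by
      by_contra h0
      apply h
      funext i
      have := hanti (Nat.zero_le i)
      simp only [Pi.zero_apply]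
      omega
    have hb : 0 < b := by
      by_contra hb
      have := h2 0 (by omega)
      omega
    refine AlternatingMap.map_coord_zero _ (⟨0, hb⟩ : Fin b) ?_
    funext j
    simp only [rowV, pow_zero, mul_one, Pi.zero_apply]
    have := zc_one_sub_pow (R := R) j (lam 0 - 1)
    convert this using 2
    push_cast
    omega

end Algebra

section Planes

lemma pp_ext {π σ : PlanePartition} (h : ∀ i j, π.entry i j = σ.entry i j) : π = σ := by
  cases π
  cases σ
  congr
  funext i j
  exact h i j

/-- `lam` is a partition with at most `b` parts. -/
def IsPart (b : ℕ) (lam : ℕ → ℕ) : Prop :=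
  (∀ i, lam (i + 1) ≤ lam i) ∧ ∀ i, b ≤ i → lam i = 0

lemma IsPart.anti {b : ℕ} {lam : ℕ → ℕ} (h : IsPart b lam) : Antitone lam :=
  antitone_nat_of_succ_le h.1

/-- `π` has shape `lam`. -/
def HasSh (π : PlanePartition) (lam : ℕ → ℕ) : Prop := ∀ i j, 0 < π.entry i j ↔ j < lam i

lemma HasSh.unique {π : PlanePartition} {lam mu : ℕ → ℕ} (h : HasSh π lam) (h' : HasSh π mu) :
    lam = mu := by
  funext i
  have := fun j => (h i j).symm.trans (h' i j)
  have h1 := this (lam i)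
  have h2 := this (mu i)
  omega

lemma pp_row_anti (π : PlanePartition) (i : ℕ) : Antitone (π.entry i) :=
  antitone_nat_of_succ_le (π.row_decr i)

lemma exists_shape (π : PlanePartition) (b : ℕ) (h : π.rowsLE b) :
    ∃ lam, IsPart b lam ∧ HasSh π lam := by
  have hex : ∀ i, ∃ j, π.entry i j = 0 := by
    intro i
    by_contra hne
    push Not at hne
    have hinf : (Set.range fun j : ℕ => (i, j)).Infinite :=
      Set.infinite_range_of_injective (fun j j' hj => (Prod.mk.inj hj).2)
    apply hinf
    refine π.finite_support.subset ?_
    rintro _ ⟨j, rfl⟩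
    exact hne j
  classical
  have hsh : HasSh π (fun i => Nat.find (hex i)) := by
    intro i j
    constructor
    · intro hpos
      by_contra hlt
      have := pp_row_anti π i (not_lt.1 hlt)
      rw [Nat.find_spec (hex i)] at this
      omega
    · intro hlt
      exact Nat.pos_of_ne_zero (Nat.find_min (hex i) hlt)
  refine ⟨_, ⟨?_, ?_⟩, hsh⟩
  · intro i
    by_contra hlt
    push Not at hlt
    have h1 := (hsh (i + 1) _).2 hlt
    have h2 := π.col_decr i (Nat.find (hex i))
    rw [Nat.find_spec (hex i)] at h2
    omega
  · intro i hi
    rw [Nat.find_eq_zero]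
    exact h i 0 hi

/-- subtract one from every positive entry. -/
def ppDec (π : PlanePartition) : PlanePartition where
  entry i j := π.entry i j - 1
  row_decr i j := Nat.sub_le_sub_right (π.row_decr i j) 1
  col_decr i j := Nat.sub_le_sub_right (π.col_decr i j) 1
  finite_support := by
    refine π.finite_support.subset ?_
    intro p hp
    simp only [Set.mem_ofPred_eq] at hp ⊢
    omega

/-- add one to every entry of the shape `lam`. -/
def ppInc (b : ℕ) (lam : ℕ → ℕ) (h : IsPart b lam) (π : PlanePartition) : PlanePartition where
  entry i j := if j < lam i then π.entry i j + 1 else 0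
  row_decr i j := by
    have := π.row_decr i j
    split_ifs <;> omega
  col_decr i j := by
    have := π.col_decr i j
    have := h.1 i
    split_ifs <;> omega
  finite_support := by
    refine ((Finset.range b ×ˢ Finset.range (lam 0)).finite_toSet).subset ?_
    intro p hp
    simp only [Set.mem_ofPred_eq, ne_eq, ite_eq_right_iff, Nat.add_eq_zero_iff, one_ne_zero,
      and_false, imp_false, not_not] at hp
    simp only [Finset.coe_product, Set.mem_prod, Finset.mem_coe, Finset.mem_range]
    refine ⟨?_, lt_of_lt_of_le hp (h.anti (Nat.zero_le _))⟩
    by_contra hb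
    have := h.2 p.1 (by omega)
    omega

lemma ppDec_ppInc (b : ℕ) (lam mu : ℕ → ℕ) (h : IsPart b lam) (π : PlanePartition)
    (hπ : HasSh π mu) (hle : ∀ i, mu i ≤ lam i) : ppDec (ppInc b lam h π) = π := by
  apply pp_ext
  intro i j
  simp only [ppDec, ppInc]
  have := hπ i j
  have := hle i
  split_ifs <;> omega

lemma ppInc_ppDec (b : ℕ) (lam : ℕ → ℕ) (h : IsPart b lam) (π : PlanePartition)
    (hπ : HasSh π lam) : ppInc b lam h (ppDec π) = π := by
  apply pp_ext
  intro i j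
  simp only [ppDec, ppInc]
  have := hπ i j
  split_ifs <;> omega

lemma cCol_ppInc_succ (b : ℕ) (lam mu : ℕ → ℕ) (h : IsPart b lam) (π : PlanePartition)
    (hπ : HasSh π mu) (hle : ∀ i, mu i ≤ lam i) (l : ℕ) :
    (ppInc b lam h π).cCol (l + 1 + 1) = π.cCol (l + 1) := by
  unfold PlanePartition.cCol
  congr 1
  ext j
  simp only [Set.mem_ofPred_eq]
  refine exists_congr fun i => ?_
  simp only [ppInc]
  by_cases hj : j < lam i
  · rw [if_pos hj]
    omega
  · have e : π.entry i j = 0 := by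
      by_contra h0
      have h1 := (hπ i j).1 (Nat.pos_of_ne_zero h0)
      have h2 := hle i
      omega
    rw [if_neg hj, e]
    constructor <;> intro h3 <;> omega

lemma cCol_ppInc_one (b : ℕ) (lam mu : ℕ → ℕ) (h : IsPart b lam) (hmu : IsPart b mu)
    (π : PlanePartition) (hπ : HasSh π mu) :
    (ppInc b lam h π).cCol 1 = ∑ i ∈ Finset.range b, (lam i - max (lam (i + 1)) (mu i)) := by
  classical
  have hset : {j | ∃ i, (ppInc b lam h π).entry i j = 1} =
      (((Finset.range b).biUnion fun i => Finset.Ico (max (lam (i + 1)) (mu i)) (lam i) :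
        Finset ℕ) : Set ℕ) := by
    ext j
    simp only [Set.mem_ofPred_eq, Finset.mem_coe, Finset.mem_biUnion, Finset.mem_range,
      Finset.mem_Ico, ppInc]
    constructor
    · rintro ⟨i, hi⟩
      have hjl : j < lam i := by
        by_contra hh
        rw [if_neg hh] at hi
        omega
      rw [if_pos hjl] at hi
      have hmi : mu i ≤ j := by
        have := hπ i j
        omega
      have hex : ∃ i', lam (i' + 1) ≤ j ∧ i ≤ i' := ⟨max b i, by
        rw [h.2 _ (by omega)]; omega, by omega⟩
      have hs := Nat.find_spec hex
      have hlt : j < lam (Nat.find hex) := by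
        by_contra hh
        rcases Nat.lt_or_ge i (Nat.find hex) with hc | hc
        · refine Nat.find_min hex (m := Nat.find hex - 1) (by omega) ⟨?_, by omega⟩
          rw [Nat.sub_add_cancel (by omega)]
          omega
        · have : Nat.find hex = i := by omega
          rw [this] at hh
          exact hh hjl
      refine ⟨Nat.find hex, ?_, ?_, hlt⟩
      · by_contra hh
        have := h.2 (Nat.find hex) (by omega)
        omega
      · have := hmu.anti hs.2
        omega
    · rintro ⟨i, hi, h1, h2⟩
      refine ⟨i, ?_⟩
      rw [if_pos h2]
      have := hπ i j
      omega
  unfold PlanePartition.cCol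
  rw [hset, Set.ncard_coe_finset, Finset.card_biUnion]
  · simp
  · intro i _ i' _ hne
    rw [Function.onFun, Finset.disjoint_left]
    intro j hj hj'
    rw [Finset.mem_Ico] at hj hj'
    rcases Nat.lt_or_gt_of_ne hne with hc | hc
    · have := h.anti (show i + 1 ≤ i' by omega)
      omega
    · have := h.anti (show i' + 1 ≤ i by omega)
      omega

lemma isPart_of_mem {b : ℕ} {lam mu : ℕ → ℕ} (_ : IsPart b lam) (hm : mu ∈ subShapes b lam) :
    IsPart b mu ∧ ∀ i, mu i ≤ lam i := by
  obtain ⟨a1, a2, a3⟩ := (mem_subShapes _ _ _).1 hm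
  refine ⟨⟨a1, a2⟩, fun i => ?_⟩
  rcases Nat.lt_or_ge i b with hi | hi
  · exact a3 i hi
  · rw [a2 i hi]; exact Nat.zero_le _

variable {R : Type*} [CommRing R]

theorem shape_sum (b c : ℕ) : ∀ (x : ℕ → R) (lam : ℕ → ℕ), IsPart b lam →
    ∃ S : Finset PlanePartition, (∀ π, π ∈ S ↔ π.entriesLE c ∧ HasSh π lam) ∧
      ∑ π ∈ S, ∏ l ∈ Finset.range c, x l ^ π.cCol (l + 1) =
        gDet b (∏ l ∈ Finset.range c, geo (x l)) lam := by
  classical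
  induction c with
  | zero =>
    intro x lam hlam
    let Z : PlanePartition := ⟨fun _ _ => 0, fun _ _ => le_rfl, fun _ _ => le_rfl, by simp⟩
    refine ⟨if lam = 0 then {Z} else ∅, ?_, ?_⟩
    · intro π
      split_ifs with h
      · subst h
        rw [Finset.mem_singleton]
        constructor
        · rintro rfl
          exact ⟨fun i j => le_rfl, fun i j => by simp [Z]⟩
        · rintro ⟨h1, _⟩
          apply pp_ext
          intro i j
          have := h1 i j
          simp only [Z]
          omega
      · simp only [Finset.notMem_empty, false_iff, not_and]
        intro h1 h2
        apply h
        funext i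
        have a := h1 i 0
        have b := h2 i 0
        simp only [Pi.zero_apply]
        omega
    · rw [Finset.range_zero, Finset.prod_empty, gDet_one b lam hlam.1 hlam.2]
      split_ifs <;> simp
  | succ c ih =>
    intro x lam hlam
    have ih' : ∀ mu : ℕ → ℕ, ∃ S : Finset PlanePartition, IsPart b mu →
      ((∀ π, π ∈ S ↔ π.entriesLE c ∧ HasSh π mu) ∧
      ∑ π ∈ S, ∏ l ∈ Finset.range c, x (l + 1) ^ π.cCol (l + 1) =
        gDet b (∏ l ∈ Finset.range c, geo (x (l + 1))) mu) := by
      intro mu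
      by_cases hmu : IsPart b mu
      · obtain ⟨S, hS⟩ := ih (fun l => x (l + 1)) mu hmu
        exact ⟨S, fun _ => hS⟩
      · exact ⟨∅, fun h => absurd h hmu⟩
    choose S hS using ih'
    refine ⟨(subShapes b lam).biUnion fun mu => (S mu).image (ppInc b lam hlam), ?_, ?_⟩
    · intro π
      simp only [Finset.mem_biUnion, Finset.mem_image]
      constructor
      · rintro ⟨mu, hmu, σ, hσ, rfl⟩
        obtain ⟨p1, p2⟩ := isPart_of_mem hlam hmu
        obtain ⟨q1, q2⟩ := ((hS mu p1).1 σ).1 hσ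
        refine ⟨fun i j => ?_, fun i j => ?_⟩
        · simp only [ppInc]
          have := q1 i j
          split_ifs <;> omega
        · simp only [ppInc]
          split_ifs <;> omega
      · rintro ⟨h1, h2⟩
        have hr : (ppDec π).rowsLE b := by
          intro i j hi
          have := h2 i j
          have := hlam.2 i hi
          simp only [ppDec]
          omega
        obtain ⟨mu, m1, m2⟩ := exists_shape (ppDec π) b hr
        refine ⟨mu, (mem_subShapes _ _ _).2 ⟨m1.1, m1.2, fun i _ => ?_⟩, ppDec π,
          ((hS mu m1).1 _).2 ⟨fun i j => ?_, m2⟩, ppInc_ppDec b lam hlam π h2⟩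
        · by_contra hh
          have a := (m2 i (lam i)).2 (by omega)
          have b := h2 i (lam i)
          simp only [ppDec] at a
          omega
        · have := h1 i j
          simp only [ppDec]
          omega
    · rw [Finset.prod_range_succ', mul_comm, ← gDet_branch b _ _ lam hlam.1 (hlam.2 b le_rfl),
        Finset.sum_biUnion]
      · refine Finset.sum_congr rfl fun mu hmu => ?_
        obtain ⟨p1, p2⟩ := isPart_of_mem hlam hmu
        rw [← (hS mu p1).2, Finset.sum_image, Finset.mul_sum]
        · refine Finset.sum_congr rfl fun σ hσ => ?_
          obtain ⟨q1, q2⟩ := ((hS mu p1).1 σ).1 hσ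
          rw [Finset.prod_range_succ', mul_comm, zero_add,
            cCol_ppInc_one b lam mu hlam p1 σ q2, Finset.prod_pow_eq_pow_sum]
          congr 1
          refine Finset.prod_congr rfl fun l _ => ?_
          rw [cCol_ppInc_succ b lam mu hlam σ q2 p2]
        · intro σ hσ σ' hσ' he
          have e1 := ppDec_ppInc b lam mu hlam σ (((hS mu p1).1 σ).1 hσ).2 p2
          have e2 := ppDec_ppInc b lam mu hlam σ' (((hS mu p1).1 σ').1 hσ').2 p2
          rw [← e1, ← e2, he]
      · intro mu hmu mu' hmu' hne
        rw [Function.onFun, Finset.disjoint_left]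
        intro τ h1 h2
        rw [Finset.mem_image] at h1 h2
        obtain ⟨σ, hσ, rfl⟩ := h1
        obtain ⟨σ', hσ', he⟩ := h2
        obtain ⟨p1, p2⟩ := isPart_of_mem hlam hmu
        obtain ⟨p1', p2'⟩ := isPart_of_mem hlam hmu'
        have s1 := (((hS mu p1).1 σ).1 hσ).2
        have s2 := (((hS mu' p1').1 σ').1 hσ').2
        have e1 := ppDec_ppInc b lam mu hlam σ s1 p2
        have e2 := ppDec_ppInc b lam mu' hlam σ' s2 p2'
        rw [he, e1] at e2
        subst e2
        exact hne (s1.unique s2)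

/-- the rectangle as a sequence. -/
def rectSeq (a b : ℕ) : ℕ → ℕ := fun i => if i < b then a else 0

lemma rectSeq_isPart (a b : ℕ) : IsPart b (rectSeq a b) := by
  constructor
  · intro i
    simp only [rectSeq]
    split_ifs <;> omega
  · intro i hi
    simp only [rectSeq]
    split_ifs <;> omega

theorem PP_sum (a b c : ℕ) (x : ℕ → R) :
    ∃ S : Finset PlanePartition, (∀ π, π ∈ S ↔ π ∈ PP a b c) ∧
      ∑ π ∈ S, ∏ l ∈ Finset.range c, x l ^ π.cCol (l + 1) =
        gDet b (geo 1 * ∏ l ∈ Finset.range c, geo (x l)) (rectSeq a b) := by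
  classical
  have ih' : ∀ mu : ℕ → ℕ, ∃ S : Finset PlanePartition, IsPart b mu →
      ((∀ π, π ∈ S ↔ π.entriesLE c ∧ HasSh π mu) ∧
      ∑ π ∈ S, ∏ l ∈ Finset.range c, x l ^ π.cCol (l + 1) =
        gDet b (∏ l ∈ Finset.range c, geo (x l)) mu) := by
    intro mu
    by_cases hmu : IsPart b mu
    · obtain ⟨S, hS⟩ := shape_sum b c x mu hmu
      exact ⟨S, fun _ => hS⟩
    · exact ⟨∅, fun h => absurd h hmu⟩
  choose S hS using ih'
  have hlam := rectSeq_isPart a b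
  refine ⟨(subShapes b (rectSeq a b)).biUnion S, ?_, ?_⟩
  · intro π
    rw [Finset.mem_biUnion]
    constructor
    · rintro ⟨mu, hmu, hπ⟩
      obtain ⟨p1, p2⟩ := isPart_of_mem hlam hmu
      obtain ⟨q1, q2⟩ := ((hS mu p1).1 π).1 hπ
      refine ⟨fun i j hj => ?_, fun i j hi => ?_, q1⟩
      · have a1 := q2 i j
        have a2 := p2 i
        simp only [rectSeq] at a2
        split_ifs at a2 <;> omega
      · have a1 := q2 i j
        have a2 := p1.2 i hi
        omega
    · rintro ⟨h1, h2, h3⟩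
      obtain ⟨mu, m1, m2⟩ := exists_shape π b h2
      refine ⟨mu, (mem_subShapes _ _ _).2 ⟨m1.1, m1.2, fun i hi => ?_⟩,
        ((hS mu m1).1 π).2 ⟨h3, m2⟩⟩
      simp only [rectSeq, if_pos hi]
      by_contra hh
      have e1 := (m2 i a).2 (by omega)
      have e2 := h1 i a le_rfl
      omega
  · rw [← gDet_branch b _ _ _ hlam.1 (hlam.2 b le_rfl), Finset.sum_biUnion]
    · refine Finset.sum_congr rfl fun mu hmu => ?_
      obtain ⟨p1, p2⟩ := isPart_of_mem hlam hmu
      rw [(hS mu p1).2]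
      simp
    · intro mu hmu mu' hmu' hne
      rw [Function.onFun, Finset.disjoint_left]
      intro τ h1 h2
      obtain ⟨p1, p2⟩ := isPart_of_mem hlam hmu
      obtain ⟨p1', p2'⟩ := isPart_of_mem hlam hmu'
      exact hne ((((hS mu p1).1 τ).1 h1).2.unique (((hS mu' p1').1 τ).1 h2).2)

end Planes

section RowOps

variable {R : Type*} [CommRing R]

/-- rows with an adjustable power of the geometric series. -/
noncomputable def rowE (a b : ℕ) (F : PowerSeries R) (e i : ℕ) : Fin b → R :=
  fun j => zc ((a : ℤ) - i + (j : ℕ)) ((1 - PowerSeries.X) ^ (j : ℕ) * geo 1 ^ e * F)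

lemma rowE_succ (a b : ℕ) (F : PowerSeries R) (e i : ℕ) :
    rowE a b F e i = rowE a b F (e + 1) i - rowE a b F (e + 1) (i + 1) := by
  funext j
  simp only [rowE, Pi.sub_apply]
  rw [← zc_geo _ (1 : R) ((1 - PowerSeries.X) ^ (j : ℕ) * geo 1 ^ e * F)]
  have e2 : ((a : ℤ) - ((i + 1 : ℕ) : ℤ) + (j : ℕ)) = (a : ℤ) - i + (j : ℕ) - 1 := by
    push_cast; ring
  have e3 : geo 1 * ((1 - PowerSeries.X) ^ (j : ℕ) * geo 1 ^ e * F) =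
    (1 - PowerSeries.X) ^ (j : ℕ) * geo (1 : R) ^ (e + 1) * F := by ring
  rw [e2, e3, one_mul]

lemma rowE_det (a b : ℕ) (F : PowerSeries R) (k : ℕ) :
    Matrix.detRowAlternating (fun i : Fin b => rowE a b F (b - 1 - min k (b - 1 - i)) i) =
    Matrix.detRowAlternating (fun i : Fin b => rowE a b F (b - 1) i) := by
  induction k with
  | zero => simp
  | succ k ih =>
    rw [← ih]
    have := alt_row_op b (Matrix.detRowAlternating (R := R) (n := Fin b))
      (fun i => rowE a b F (b - 1 - min k (b - 1 - i)) i)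
      (fun i => if k + 1 ≤ b - 1 - i then 1 else 0) (by simp)
    rw [← this]
    congr 1
    funext i
    split_ifs with h
    · have e1 : b - 1 - min k (b - 1 - (i : ℕ)) = b - 1 - (k + 1) + 1 := by omega
      have e2 : b - 1 - min k (b - 1 - ((i : ℕ) + 1)) = b - 1 - (k + 1) + 1 := by omega
      have e3 : b - 1 - min (k + 1) (b - 1 - (i : ℕ)) = b - 1 - (k + 1) := by omega
      rw [e1, e2, e3, one_smul]
      exact rowE_succ _ _ _ _ _
    · have e1 : min k (b - 1 - (i : ℕ)) = min (k + 1) (b - 1 - (i : ℕ)) := by omega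
      rw [e1, zero_smul, sub_zero]

lemma gDet_rect (a b M : ℕ) (hb : 0 < b) (F H : PowerSeries R) (hF : F = geo 1 ^ M * H) :
    gDet b (geo 1 * F) (rectSeq a b) =
      Matrix.det (Matrix.of fun i j : Fin b =>
        zc ((a : ℤ) - (i : ℕ) + (j : ℕ)) (geo 1 ^ (b + M - (j : ℕ)) * H)) := by
  have h1 : gDet b (geo 1 * F) (rectSeq a b) =
      Matrix.detRowAlternating (fun i : Fin b => rowE a b (geo 1 * F) (b - 1) i) := by
    rw [← rowE_det a b (geo 1 * F) b]
    unfold gDet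
    congr 1
    funext i
    have := i.2
    have e : b - 1 - min b (b - 1 - (i : ℕ)) = i := by omega
    rw [e]
    unfold rowV rowE rectSeq
    rw [if_pos this]
  rw [h1]
  change Matrix.det (Matrix.of fun i j : Fin b => rowE a b (geo 1 * F) (b - 1) i j) = _
  congr 1
  ext i j
  simp only [Matrix.of_apply, rowE]
  congr 1
  have hj := j.2
  obtain ⟨N, hN⟩ : ∃ N, b + M = N + j := ⟨b + M - j, by omega⟩
  have e : b + M - (j : ℕ) = N := by omega
  rw [e, hF]
  have : (1 - PowerSeries.X) ^ (j : ℕ) * geo (1 : R) ^ (j : ℕ) = 1 := by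
    rw [← mul_pow, one_sub_mul_geo, one_pow]
  calc (1 - PowerSeries.X) ^ (j : ℕ) * geo 1 ^ (b - 1) * (geo 1 * (geo 1 ^ M * H))
      = (1 - PowerSeries.X) ^ (j : ℕ) * geo (1 : R) ^ (b - 1 + 1 + M) * H := by ring
    _ = ((1 - PowerSeries.X) ^ (j : ℕ) * geo (1 : R) ^ (j : ℕ)) * (geo 1 ^ N * H) := by
      rw [Nat.sub_add_cancel hb, hN]; ring
    _ = _ := by rw [this, one_mul]

lemma zc_mul (n : ℤ) (g H : PowerSeries R) (Q : ℕ) (hQ : n < Q) :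
    zc n (g * H) = ∑ s ∈ Finset.range Q, PowerSeries.coeff s H * zc (n - s) g := by
  rcases lt_or_ge n 0 with hn | hn
  · rw [zc_neg hn]
    symm
    apply Finset.sum_eq_zero
    intro s _
    rw [zc_neg (by omega), mul_zero]
  · obtain ⟨k, rfl⟩ := Int.eq_ofNat_of_zero_le hn
    rw [zc_nat, mul_comm, PowerSeries.coeff_mul,
      Finset.Nat.sum_antidiagonal_eq_sum_range_succ_mk]
    have hsub : Finset.range (k + 1) ⊆ Finset.range Q := by
      intro s hs
      rw [Finset.mem_range] at *
      omega
    rw [← Finset.sum_subset hsub]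
    · refine Finset.sum_congr rfl fun s hs => ?_
      rw [Finset.mem_range] at hs
      have : ((k : ℤ) - s) = ((k - s : ℕ) : ℤ) := by omega
      rw [this, zc_nat]
    · intro s _ hs
      rw [Finset.mem_range] at hs
      rw [zc_neg (by omega), mul_zero]

lemma zc_geo_pow_map {S : Type*} [CommRing S] (f : R →+* S) (n : ℤ) (e : ℕ) :
    zc n ((geo (1 : S)) ^ e) = f (zc n (geo (1 : R) ^ e)) := by
  have h : geo (1 : S) = PowerSeries.map f (geo (1 : R)) := by
    ext n
    simp [geo]
  rw [h, ← map_pow]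
  unfold zc
  split_ifs
  · rw [PowerSeries.coeff_map]
  · exact (map_zero f).symm

end RowOps

section Expand

/-- the numerical determinants. -/
noncomputable def nD (a b N : ℕ) (s : Fin b → ℕ) : ℝ :=
  Matrix.det (Matrix.of fun i j : Fin b =>
    zc ((a : ℤ) - (i : ℕ) + (j : ℕ) - (s i : ℕ)) (geo (1 : ℝ) ^ (N - (j : ℕ))))

/-- complete homogeneous polynomials. -/
noncomputable def hX (m s : ℕ) : MvPolynomial (Fin m) ℝ :=
  PowerSeries.coeff s (∏ i : Fin m, geo (MvPolynomial.X i : MvPolynomial (Fin m) ℝ))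

lemma hX_eq (m s : ℕ) : hX m s =
    ∑ l ∈ (Finset.univ : Finset (Fin m)).finsuppAntidiag s, MvPolynomial.monomial l 1 := by
  rw [hX, PowerSeries.coeff_prod]
  refine Finset.sum_congr rfl fun l _ => ?_
  simp only [geo, PowerSeries.coeff_mk]
  rw [MvPolynomial.monomial_eq, MvPolynomial.C_1, one_mul, Finsupp.prod_fintype _ _ (by simp)]

lemma degree_eq_sum {m : ℕ} (l : Fin m →₀ ℕ) : l.degree = ∑ i, l i := by
  rw [Finsupp.degree_eq_sum]

lemma coeff_hX (m s : ℕ) (l : Fin m →₀ ℕ) :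
    MvPolynomial.coeff l (hX m s) = if l.degree = s then 1 else 0 := by
  classical
  rw [hX_eq, MvPolynomial.coeff_sum]
  simp only [MvPolynomial.coeff_monomial]
  rw [Finset.sum_ite_eq']
  congr 1
  rw [Finset.mem_finsuppAntidiag, degree_eq_sum]
  simp

lemma hX_hom (m s : ℕ) : (hX m s).IsHomogeneous s := by
  rw [hX_eq]
  apply MvPolynomial.IsHomogeneous.sum
  intro l hl
  apply MvPolynomial.isHomogeneous_monomial
  rw [Finset.mem_finsuppAntidiag] at hl
  rw [degree_eq_sum]
  exact hl.1

lemma coeff_prod_hX {m b : ℕ} (s : Fin b → ℕ) (k : Fin m →₀ ℕ) (h : k.degree ≠ ∑ i, s i) :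
    MvPolynomial.coeff k (∏ i, hX m (s i)) = 0 :=
  (MvPolynomial.IsHomogeneous.prod Finset.univ (fun i => hX m (s i)) s
    (fun i _ => hX_hom m (s i))).coeff_eq_zero h

lemma det_sum_expand {R : Type*} [CommRing R] (b : ℕ) (h : ℕ → R) (B : Fin b → Fin b → ℕ → R)
    (A : Finset ℕ) :
    Matrix.det (Matrix.of fun i j : Fin b => ∑ s ∈ A, h s * B i j s) =
      ∑ s ∈ Fintype.piFinset (fun _ : Fin b => A), (∏ i, h (s i)) *
        Matrix.det (Matrix.of fun i j : Fin b => B i j (s i)) := by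
  have := MultilinearMap.map_sum_finset
    (Matrix.detRowAlternating (R := R) (n := Fin b)).toMultilinearMap
    (fun i s => h s • fun j => B i j s) (fun _ => A)
  have e : (fun i : Fin b => ∑ s ∈ A, h s • fun j => B i j s) =
    (fun i j : Fin b => ∑ s ∈ A, h s * B i j s) := by
    funext i j
    simp [Finset.sum_apply]
  rw [e] at this
  refine Eq.trans this ?_
  refine Finset.sum_congr rfl fun s _ => ?_
  rw [MultilinearMap.map_smul_univ]
  rfl

lemma coeff_det (a b m N : ℕ) (k : Fin m →₀ ℕ) :
    MvPolynomial.coeff k (Matrix.det (Matrix.of fun i j : Fin b =>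
      zc ((a : ℤ) - (i : ℕ) + (j : ℕ)) (geo (1 : MvPolynomial (Fin m) ℝ) ^ (N - (j : ℕ)) *
        ∏ i : Fin m, geo (MvPolynomial.X i : MvPolynomial (Fin m) ℝ)))) =
    ∑ s ∈ Fintype.piFinset (fun _ : Fin b => Finset.range (k.degree + 1)),
      MvPolynomial.coeff k (∏ i, hX m (s i)) * nD a b N s := by
  have e : (Matrix.of fun i j : Fin b =>
      zc ((a : ℤ) - (i : ℕ) + (j : ℕ)) (geo (1 : MvPolynomial (Fin m) ℝ) ^ (N - (j : ℕ)) *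
        ∏ i : Fin m, geo (MvPolynomial.X i : MvPolynomial (Fin m) ℝ))) =
      (Matrix.of fun i j : Fin b => ∑ s ∈ Finset.range (a + b + k.degree + 1), hX m s *
        zc ((a : ℤ) - (i : ℕ) + (j : ℕ) - (s : ℕ))
          (geo (1 : MvPolynomial (Fin m) ℝ) ^ (N - (j : ℕ)))) := by
    ext1 i j
    simp only [Matrix.of_apply]
    have := j.2
    rw [zc_mul _ _ _ (a + b + k.degree + 1) (by push_cast; omega)]
    rfl
  rw [e, det_sum_expand, MvPolynomial.coeff_sum]
  have hterm : ∀ s : Fin b → ℕ, MvPolynomial.coeff k ((∏ i, hX m (s i)) *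
      Matrix.det (Matrix.of fun i j : Fin b => zc ((a : ℤ) - (i : ℕ) + (j : ℕ) - (s i : ℕ))
          (geo (1 : MvPolynomial (Fin m) ℝ) ^ (N - (j : ℕ))))) =
      MvPolynomial.coeff k (∏ i, hX m (s i)) * nD a b N s := by
    intro s
    have : Matrix.det (Matrix.of fun i j : Fin b => zc ((a : ℤ) - (i : ℕ) + (j : ℕ) - (s i : ℕ))
          (geo (1 : MvPolynomial (Fin m) ℝ) ^ (N - (j : ℕ)))) = MvPolynomial.C (nD a b N s) := by
      rw [nD, RingHom.map_det]
      congr 1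
      ext1 i j
      simp only [Matrix.of_apply, RingHom.mapMatrix_apply, Matrix.map_apply]
      exact zc_geo_pow_map MvPolynomial.C _ _
    rw [this, mul_comm, MvPolynomial.coeff_C_mul, mul_comm]
  rw [Finset.sum_congr rfl (fun s _ => hterm s)]
  symm
  apply Finset.sum_subset
  · intro s hs
    rw [Fintype.mem_piFinset] at *
    intro i
    have := hs i
    rw [Finset.mem_range] at *
    omega
  · intro s _ hs
    rw [coeff_prod_hX, zero_mul]
    intro hk
    apply hs
    rw [Fintype.mem_piFinset]
    intro i
    rw [Finset.mem_range, hk]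
    have := Finset.single_le_sum (f := s) (fun _ _ => Nat.zero_le _) (Finset.mem_univ i)
    omega

lemma det_poly_s10 {R : Type*} [CommRing R] (b : ℕ) (v : Fin b → R) (P : Fin b → Polynomial R)
    (hP : ∀ j, (P j).natDegree ≤ j) :
    Matrix.det (Matrix.of fun i j : Fin b => (P j).eval (v i)) =
      (∏ j, (P j).coeff j) * (Matrix.vandermonde v).det := by
  rw [Matrix.eval_matrixOfPolynomials_eq_vandermonde_mul_matrixOfPolynomials v P hP,
    Matrix.det_mul, mul_comm]
  congr 1
  rw [Matrix.det_of_isUpperTriangular]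
  · rfl
  · intro i j hij
    have hij : j < i := hij
    exact Polynomial.coeff_eq_zero_of_natDegree_lt (lt_of_le_of_lt (hP j) hij)

lemma sum_vand (m b K : ℕ) :
    ∑ s ∈ Fintype.piFinset (fun _ : Fin b => Finset.range K),
      (∏ i, hX m (s i)) * MvPolynomial.C
        (Matrix.vandermonde fun i : Fin b => (-((i : ℕ) : ℝ) - (s i : ℝ))).det =
    (∑ s ∈ Finset.range K, hX m s) ^ b *
      MvPolynomial.C (Matrix.vandermonde fun i : Fin b => (-((i : ℕ) : ℝ))).det := by
  set v : Fin b → MvPolynomial (Fin m) ℝ := fun i => MvPolynomial.C (-((i : ℕ) : ℝ)) with hv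
  have h1 := det_sum_expand b (hX m)
    (fun i j s => (v i - MvPolynomial.C (s : ℝ)) ^ (j : ℕ)) (Finset.range K)
  let P : Fin b → Polynomial (MvPolynomial (Fin m) ℝ) := fun j =>
    ∑ s ∈ Finset.range K, Polynomial.C (hX m s) *
      (Polynomial.X - Polynomial.C (MvPolynomial.C (s : ℝ))) ^ (j : ℕ)
  have hdeg : ∀ j, (P j).natDegree ≤ j := by
    intro j
    apply Polynomial.natDegree_sum_le_of_forall_le
    intro s _
    refine (Polynomial.natDegree_C_mul_le _ _).trans ?_
    rw [Polynomial.natDegree_pow, Polynomial.natDegree_X_sub_C, mul_one]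
  have hco : ∀ j, (P j).coeff j = ∑ s ∈ Finset.range K, hX m s := by
    intro j
    simp only [P, Polynomial.finsetSum_coeff, Polynomial.coeff_C_mul]
    refine Finset.sum_congr rfl fun s _ => ?_
    have hm : ((Polynomial.X - Polynomial.C (MvPolynomial.C (s : ℝ)) :
      Polynomial (MvPolynomial (Fin m) ℝ)) ^ (j : ℕ)).coeff (j : ℕ) = 1 := by
      have := (Polynomial.monic_X_sub_C (MvPolynomial.C (s : ℝ) : MvPolynomial (Fin m) ℝ)).pow j
      have hd : ((Polynomial.X - Polynomial.C (MvPolynomial.C (s : ℝ)) :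
        Polynomial (MvPolynomial (Fin m) ℝ)) ^ (j : ℕ)).natDegree = j := by
        rw [Polynomial.natDegree_pow, Polynomial.natDegree_X_sub_C, mul_one]
      have h2 := this.coeff_natDegree
      rwa [hd] at h2
    rw [hm, mul_one]
  have h2 := det_poly_s10 b v P hdeg
  have h3 : (Matrix.of fun i j : Fin b => (P j).eval (v i)) =
      (Matrix.of fun i j : Fin b => ∑ s ∈ Finset.range K, hX m s *
        (v i - MvPolynomial.C (s : ℝ)) ^ (j : ℕ)) := by
    ext1 i j
    simp [P, Polynomial.eval_finsetSum]
  rw [h3, h1] at h2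
  simp only [hco, Finset.prod_const, Finset.card_univ, Fintype.card_fin] at h2
  have hvand : (Matrix.vandermonde v).det =
      MvPolynomial.C (Matrix.vandermonde fun i : Fin b => (-((i : ℕ) : ℝ))).det := by
    rw [RingHom.map_det]
    congr 1
    ext1 i j
    simp [hv, Matrix.vandermonde_apply]
  rw [hvand] at h2
  rw [← h2]
  refine Finset.sum_congr rfl fun s _ => ?_
  congr 1
  rw [RingHom.map_det]
  congr 1
  ext1 i j
  simp [hv, Matrix.vandermonde_apply]

lemma sum_multichoose (b k : ℕ) :
    ∑ t ∈ Finset.range (k + 1), b.multichoose t = (b + 1).multichoose k := by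
  induction k with
  | zero => simp
  | succ k ih =>
    rw [Finset.sum_range_succ, ih, Nat.multichoose_succ_succ]
    ring

lemma coeff_pow_hX (m b K : ℕ) : ∀ (l : Fin m →₀ ℕ) (_ : l.degree ≤ K),
    MvPolynomial.coeff l ((∑ s ∈ Finset.range (K + 1), hX m s) ^ b) =
      ∏ i, (b.multichoose (l i) : ℝ) := by
  classical
  induction b with
  | zero =>
    intro l _
    rw [pow_zero, MvPolynomial.coeff_one]
    split_ifs with h
    · subst h
      simp
    · have : ∃ i, l i ≠ 0 := by
        by_contra hh
        push Not at hh
        apply h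
        ext i
        simp [hh i]
      obtain ⟨i, hi⟩ := this
      symm
      apply Finset.prod_eq_zero (Finset.mem_univ i)
      obtain ⟨t, ht⟩ := Nat.exists_eq_succ_of_ne_zero hi
      rw [ht]
      simp [Nat.multichoose_zero_succ]
  | succ b ih =>
    intro l hl
    rw [pow_succ', MvPolynomial.coeff_mul]
    have h1 : ∀ p ∈ Finset.HasAntidiagonal.antidiagonal l,
        MvPolynomial.coeff p.1 (∑ s ∈ Finset.range (K + 1), hX m s) *
        MvPolynomial.coeff p.2 ((∑ s ∈ Finset.range (K + 1), hX m s) ^ b) =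
        ∏ i, (b.multichoose (p.2 i) : ℝ) := by
      intro p hp
      rw [Finset.HasAntidiagonal.mem_antidiagonal] at hp
      have hd : p.1.degree + p.2.degree = l.degree := by
        rw [← hp, map_add]
      rw [ih p.2 (by omega), MvPolynomial.coeff_sum]
      simp only [coeff_hX]
      rw [Finset.sum_ite_eq, if_pos (by rw [Finset.mem_range]; omega), one_mul]
    rw [Finset.sum_congr rfl h1]
    have h2 : ∏ i, ((b + 1).multichoose (l i) : ℝ) =
        ∏ i, ∑ t ∈ Finset.range (l i + 1), (b.multichoose t : ℝ) := by
      refine Finset.prod_congr rfl fun i _ => ?_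
      rw [← sum_multichoose]
      push_cast
      rfl
    rw [h2, Finset.prod_univ_sum]
    refine Finset.sum_bij' (fun p _ => fun i => p.2 i)
      (fun q _ => (l - Finsupp.equivFunOnFinite.symm q, Finsupp.equivFunOnFinite.symm q))
      ?_ ?_ ?_ ?_ ?_
    · intro p hp
      rw [Finset.HasAntidiagonal.mem_antidiagonal] at hp
      rw [Fintype.mem_piFinset]
      intro i
      rw [Finset.mem_range, ← hp]
      simp only [Finsupp.add_apply]
      omega
    · intro q hq
      rw [Fintype.mem_piFinset] at hq
      rw [Finset.HasAntidiagonal.mem_antidiagonal]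
      ext i
      have := hq i
      rw [Finset.mem_range] at this
      simp only [Finsupp.add_apply, Finsupp.tsub_apply, Finsupp.equivFunOnFinite_symm_apply_apply]
      omega
    · intro p hp
      rw [Finset.HasAntidiagonal.mem_antidiagonal] at hp
      have e : Finsupp.equivFunOnFinite.symm (fun i => p.2 i) = p.2 := by
        ext i
        simp
      ext i
      · simp only [e, ← hp]
        simp
      · simp
    · intro q _
      funext i
      simp
    · intro p _
      rfl

end Expand

section Ratio

open Filter

lemma desc_limit (u t : ℕ → ℕ) (r : ℝ) (ht : Tendsto t atTop atTop)
    (hu : Tendsto (fun n => (u n : ℝ) / (t n : ℝ)) atTop (nhds r)) (s : ℕ) :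
    Tendsto (fun n => ((u n).descFactorial s : ℝ) / (t n : ℝ) ^ s) atTop (nhds (r ^ s)) := by
  induction s with
  | zero => simp
  | succ s ih =>
    have h1 : Tendsto (fun n => (s : ℝ) / (t n : ℝ)) atTop (nhds 0) :=
      Tendsto.div_atTop tendsto_const_nhds (tendsto_natCast_atTop_atTop.comp ht)
    have h2 := ih.mul (hu.sub h1)
    rw [sub_zero, ← pow_succ] at h2
    refine h2.congr fun n => ?_
    rw [← descPochhammer_eval_eq_descFactorial ℝ (u n) (s + 1), descPochhammer_succ_eval,
      descPochhammer_eval_eq_descFactorial, pow_succ, ← sub_div, div_mul_div_comm]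

/-- the shifted Vandermonde determinant. -/
noncomputable def vD (b : ℕ) (s : Fin b → ℕ) : ℝ :=
  (Matrix.vandermonde fun i : Fin b => (-((i : ℕ) : ℝ) - (s i : ℝ))).det

lemma zc_geo_one_pow (n d : ℕ) :
    zc (n : ℤ) (geo (1 : ℝ) ^ (d + 1)) = ((d + n).factorial : ℝ) / (d.factorial * n.factorial) := by
  have : geo (1 : ℝ) = PowerSeries.mk 1 := by
    ext n
    simp [geo]
  rw [zc_nat, this, PowerSeries.mk_one_pow_eq_mk_choose_add, PowerSeries.coeff_mk,
    Nat.cast_add_choose]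

lemma nD_formula (a b N : ℕ) (s : Fin b → ℕ) (hN : b ≤ N) (hs : ∀ i : Fin b, (i : ℕ) + s i ≤ a) :
    nD a b N s = ((Equiv.Perm.sign (Fin.revPerm (n := b)) : ℤ) : ℝ) * vD b s *
      ∏ i : Fin b, (((N - 1 + (a - i - s i)).factorial : ℝ) /
        ((a - i - s i + (b - 1)).factorial * (N - 1 - i).factorial)) := by
  have hvd : vD b s = (Matrix.vandermonde fun i : Fin b =>
      ((a - i - s i + (b - 1) : ℕ) : ℝ)).det := by
    have := Matrix.det_vandermonde_add (fun i : Fin b => (-((i : ℕ) : ℝ) - (s i : ℝ)))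
      ((a : ℝ) + ((b - 1 : ℕ) : ℝ))
    rw [vD, ← this]
    congr 2
    funext i
    have h := hs i
    have e : ((a - i - s i : ℕ) : ℝ) = (a : ℝ) - (i : ℕ) - s i := by
      rw [Nat.cast_sub (by omega), Nat.cast_sub (by omega)]
    rw [Nat.cast_add, e]
    ring
  have h1 : (Matrix.of fun i j : Fin b => (descPochhammer ℝ (j : ℕ)).eval
      ((a - i - s i + (b - 1) : ℕ) : ℝ)).det = vD b s := by
    rw [hvd, det_poly_s10 b (fun i : Fin b => ((a - i - s i + (b - 1) : ℕ) : ℝ))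
      (fun j => descPochhammer ℝ (j : ℕ)) (fun j => (descPochhammer_natDegree _ _).le)]
    have : ∀ j : Fin b, (descPochhammer ℝ (j : ℕ)).coeff (j : ℕ) = 1 := by
      intro j
      have h := (monic_descPochhammer ℝ (j : ℕ)).coeff_natDegree
      rwa [descPochhammer_natDegree] at h
    simp [this]
  have h2 := Matrix.det_permute' (Fin.revPerm (n := b))
    (Matrix.of fun i j : Fin b => (descPochhammer ℝ (j : ℕ)).eval
      ((a - i - s i + (b - 1) : ℕ) : ℝ))
  rw [h1] at h2
  rw [← h2, Finset.prod_congr rfl (fun (i : Fin b) _ => (by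
    rw [← div_div, div_eq_mul_one_div _ ((N - 1 - i).factorial : ℝ)] :
      (((N - 1 + (a - i - s i)).factorial : ℝ) /
        ((a - i - s i + (b - 1)).factorial * (N - 1 - i).factorial)) =
      (((N - 1 + (a - i - s i)).factorial : ℝ) /
        ((a - i - s i + (b - 1)).factorial)) * (1 / ((N - 1 - i).factorial : ℝ)))),
    Finset.prod_mul_distrib, mul_comm, mul_comm (∏ i : Fin b, _) (∏ i : Fin b, _), mul_assoc,
    ← Matrix.det_mul_column, ← Matrix.det_mul_row]
  unfold nD
  congr 1
  ext1 i j
  have hi := hs i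
  have hj := j.2
  simp only [Matrix.of_apply, Matrix.submatrix_apply, id_eq, Fin.revPerm_apply, Fin.val_rev]
  have e1 : ((a : ℤ) - (i : ℕ) + (j : ℕ) - (s i : ℕ)) = ((a - i - s i + j : ℕ) : ℤ) := by omega
  have e2 : N - (j : ℕ) = (N - 1 - j) + 1 := by omega
  rw [e1, e2, zc_geo_one_pow, descPochhammer_eval_eq_descFactorial]
  have e3 := Nat.factorial_mul_descFactorial (n := a - i - s i + (b - 1)) (k := b - (j + 1))
    (by omega)
  have e4 : a - i - s i + (b - 1) - (b - (j + 1)) = a - i - s i + j := by omega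
  have e5 : N - 1 - j + (a - i - s i + j) = N - 1 + (a - i - s i) := by omega
  rw [e4] at e3
  rw [e5, ← e3]
  push_cast
  have p1 : ((a - i - s i + j : ℕ).factorial : ℝ) ≠ 0 := by positivity
  have p2 : ((N - 1 - j : ℕ).factorial : ℝ) ≠ 0 := by positivity
  have p3 : ((a - i - s i + (b - 1)).descFactorial (b - (j + 1)) : ℝ) ≠ 0 := by
    have := Nat.pos_of_ne_zero (Nat.descFactorial_eq_zero_iff_lt.not.2
      (show ¬ a - i - s i + (b - 1) < b - (j + 1) by omega))
    positivity
  field_simp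

lemma vD_zero_ne (b : ℕ) : vD b 0 ≠ 0 := by
  rw [vD, Matrix.det_vandermonde_ne_zero_iff]
  intro i j h
  simp at h
  exact Fin.ext h

/-- the ratio factors. -/
noncomputable def rF (a b c m i s : ℕ) : ℝ :=
  ((a + (b - 1 - i)).descFactorial s : ℝ) * ((c + (b - 1 - i)).descFactorial m : ℝ) /
    ((a + c + (b - 1 - i)).descFactorial (s + m) : ℝ)

lemma fact_ratio (A C m s : ℕ) (hs : s ≤ A) (hm : m ≤ C) (T : ℕ) (hT : s + m ≤ T) :
    ((T - (s + m)).factorial : ℝ) / ((A - s).factorial * (C - m).factorial) =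
      (A.descFactorial s : ℝ) * (C.descFactorial m) / (T.descFactorial (s + m)) *
        ((T.factorial : ℝ) / (A.factorial * C.factorial)) := by
  rw [← Nat.factorial_mul_descFactorial hs, ← Nat.factorial_mul_descFactorial hm,
    ← Nat.factorial_mul_descFactorial hT]
  have h : ∀ n k : ℕ, k ≤ n → (n.descFactorial k : ℝ) ≠ 0 := by
    intro n k hk
    have := Nat.pos_of_ne_zero (Nat.descFactorial_eq_zero_iff_lt.not.2
      (show ¬ n < k by omega))
    positivity
  have p1 := h _ _ hs
  have p2 := h _ _ hm
  have p3 := h _ _ hT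
  push_cast
  field_simp

lemma nD_ratio (a b c m : ℕ) (s : Fin b → ℕ) (hm : m ≤ c)
    (hs : ∀ i : Fin b, (i : ℕ) + s i ≤ a) :
    nD a b (b + (c - m)) s / nD a b (b + c) 0 =
      (∏ i : Fin b, rF a b c m i (s i)) * (vD b s / vD b 0) := by
  have hs0 : ∀ i : Fin b, (i : ℕ) + (0 : Fin b → ℕ) i ≤ a := by
    intro i
    have := hs i
    simp
    omega
  rw [nD_formula a b (b + (c - m)) s (by omega) hs, nD_formula a b (b + c) 0 (by omega) hs0]
  have h : ∀ i : Fin b, (((b + (c - m) - 1 + (a - i - s i)).factorial : ℝ) /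
        ((a - i - s i + (b - 1)).factorial * (b + (c - m) - 1 - i).factorial)) =
      rF a b c m i (s i) * (((b + c - 1 + (a - i - (0 : Fin b → ℕ) i)).factorial : ℝ) /
        ((a - i - (0 : Fin b → ℕ) i + (b - 1)).factorial * (b + c - 1 - i).factorial)) := by
    intro i
    have h1 := hs i
    have h2 := i.2
    have := fact_ratio (a + (b - 1 - i)) (c + (b - 1 - i)) m (s i) (by omega) (by omega)
      (a + c + (b - 1 - i)) (by omega)
    simp only [Pi.zero_apply]
    unfold rF
    have f1 : b + (c - m) - 1 + (a - i - s i) = a + c + (b - 1 - i) - (s i + m) := by omega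
    have f2 : a - i - s i + (b - 1) = a + (b - 1 - i) - s i := by omega
    have f3 : b + (c - m) - 1 - i = c + (b - 1 - i) - m := by omega
    have f4 : b + c - 1 + (a - i - 0) = a + c + (b - 1 - i) := by omega
    have f5 : a - i - 0 + (b - 1) = a + (b - 1 - i) := by omega
    have f6 : b + c - 1 - i = c + (b - 1 - i) := by omega
    rw [f1, f2, f3, f4, f5, f6]
    exact this
  rw [Finset.prod_congr rfl (fun i _ => h i), Finset.prod_mul_distrib]
  have hne : (∏ i : Fin b, (((b + c - 1 + (a - i - (0 : Fin b → ℕ) i)).factorial : ℝ) /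
        ((a - i - (0 : Fin b → ℕ) i + (b - 1)).factorial * (b + c - 1 - i).factorial))) ≠ 0 := by
    apply Finset.prod_ne_zero_iff.2
    intro i _
    positivity
  have hv := vD_zero_ne b
  have hsg : ((Equiv.Perm.sign (Fin.revPerm (n := b)) : ℤ) : ℝ) ≠ 0 := by
    exact_mod_cast (Equiv.Perm.sign (Fin.revPerm (n := b))).ne_zero
  field_simp

lemma rF_limit (b m i s : ℕ) (q : ℝ) (a c : ℕ → ℕ)
    (ha' : Tendsto a atTop atTop)
    (hlim : Tendsto (fun n => (a n : ℝ) / ((a n : ℝ) + (c n : ℝ))) atTop (nhds q)) :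
    Tendsto (fun n => rF (a n) b (c n) m i s) atTop (nhds (q ^ s * (1 - q) ^ m)) := by
  set t : ℕ → ℕ := fun n => a n + c n with ht
  have htt : Tendsto t atTop atTop := tendsto_atTop_mono (fun n => by simp [ht]) ha'
  have htr : Tendsto (fun n => (t n : ℝ)) atTop atTop := tendsto_natCast_atTop_atTop.comp htt
  set e : ℕ := b - 1 - i
  have h0 : Tendsto (fun n => (e : ℝ) / (t n : ℝ)) atTop (nhds 0) :=
    Tendsto.div_atTop tendsto_const_nhds htr
  have hne : ∀ᶠ n in atTop, (t n : ℝ) ≠ 0 := htr.eventually_ne_atTop 0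
  have h1 : Tendsto (fun n => (((a n + e : ℕ) : ℝ)) / (t n : ℝ)) atTop (nhds q) := by
    have := hlim.add h0
    rw [add_zero] at this
    refine this.congr fun n => ?_
    simp only [ht]
    push_cast
    ring
  have h3 : Tendsto (fun n => (((a n + c n + e : ℕ) : ℝ)) / (t n : ℝ)) atTop (nhds 1) := by
    have := (tendsto_const_nhds (x := (1 : ℝ))).add h0
    rw [add_zero] at this
    refine this.congr' ?_
    filter_upwards [hne] with n hn
    simp only [ht] at *
    push_cast at *
    field_simp
  have h2 : Tendsto (fun n => (((c n + e : ℕ) : ℝ)) / (t n : ℝ)) atTop (nhds (1 - q)) := by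
    have := h3.sub hlim
    refine this.congr fun n => ?_
    simp only [ht]
    push_cast
    ring
  have H := ((desc_limit _ t q htt h1 s).mul (desc_limit _ t (1 - q) htt h2 m)).div
    (desc_limit _ t 1 htt h3 (s + m)) (by simp)
  rw [one_pow, div_one] at H
  refine H.congr' ?_
  filter_upwards [hne] with n hn
  unfold rF
  rw [Pi.div_apply, div_mul_div_comm, ← pow_add, div_div_div_cancel_right₀ (pow_ne_zero _ hn)]

end Ratio

section Count

lemma prod_split {M : Type*} [CommMonoid M] (m c : ℕ) (f : Fin m → ℕ)
    (hf : Function.Injective f) (hc : ∀ i, f i < c) (g : ℕ → M) (w : M)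
    (hw : ∀ l, (¬ ∃ i, f i = l) → g l = w) :
    ∏ l ∈ Finset.range c, g l = w ^ (c - m) * ∏ i, g (f i) := by
  classical
  have hsub : Finset.univ.image f ⊆ Finset.range c := by
    intro l hl
    rw [Finset.mem_image] at hl
    obtain ⟨i, _, rfl⟩ := hl
    exact Finset.mem_range.2 (hc i)
  rw [← Finset.prod_sdiff hsub, Finset.prod_image (fun i _ j _ h => hf h)]
  congr 1
  rw [Finset.prod_congr rfl (g := fun _ => w)]
  · rw [Finset.prod_const, Finset.card_sdiff_of_subset hsub,
      Finset.card_image_of_injective _ hf, Finset.card_range, Finset.card_univ, Fintype.card_fin]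
  · intro l hl
    apply hw
    rintro ⟨i, rfl⟩
    rw [Finset.mem_sdiff] at hl
    exact hl.2 (Finset.mem_image_of_mem f (Finset.mem_univ i))

lemma den_count (a b c : ℕ) (hb : 0 < b) : ((PP a b c).ncard : ℝ) = nD a b (b + c) 0 := by
  obtain ⟨S, hS, hsum⟩ := PP_sum a b c (fun _ => (1 : ℝ))
  have h1 : PP a b c = (S : Set PlanePartition) := by
    ext π
    exact (hS π).symm
  rw [h1, Set.ncard_coe_finset]
  simp only [one_pow, Finset.prod_const_one, Finset.sum_const, nsmul_eq_mul, mul_one] at hsum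
  rw [hsum, gDet_rect a b c hb _ 1 (by simp)]
  unfold nD
  congr 1
  ext1 i j
  simp

lemma num_count (a b c m : ℕ) (hb : 0 < b) (ℓ : Fin m → ℕ) (hinj : Function.Injective ℓ)
    (hpos : ∀ i, 1 ≤ ℓ i) (hc : ∀ i, ℓ i ≤ c) (k : Fin m → ℕ) :
    (({π ∈ PP a b c | ∀ i, π.cCol (ℓ i) = k i}.ncard : ℕ) : ℝ) =
    ∑ s ∈ Fintype.piFinset (fun _ : Fin b =>
        Finset.range ((Finsupp.equivFunOnFinite.symm k).degree + 1)),
      MvPolynomial.coeff (Finsupp.equivFunOnFinite.symm k) (∏ i, hX m (s i)) *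
        nD a b (b + (c - m)) s := by
  classical
  set f : Fin m → ℕ := fun i => ℓ i - 1 with hfdef
  have hf : Function.Injective f := by
    intro i j h
    apply hinj
    have h1 := hpos i
    have h2 := hpos j
    simp only [hfdef] at h
    omega
  have hfc : ∀ i, f i < c := by
    intro i
    have h1 := hpos i
    have h2 := hc i
    simp only [hfdef]
    omega
  set x : ℕ → MvPolynomial (Fin m) ℝ := Function.extend f MvPolynomial.X 1 with hx
  have hx1 : ∀ i, x (f i) = MvPolynomial.X i := fun i => hf.extend_apply _ _ i
  have hx2 : ∀ l, (¬ ∃ i, f i = l) → x l = 1 := by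
    intro l hl
    rw [hx, Function.extend_apply' _ _ _ hl]
    rfl
  obtain ⟨S, hS, hsum⟩ := PP_sum a b c x
  have hF : ∏ l ∈ Finset.range c, geo (x l) = geo (1 : MvPolynomial (Fin m) ℝ) ^ (c - m) *
      ∏ i, geo (MvPolynomial.X i : MvPolynomial (Fin m) ℝ) := by
    rw [prod_split m c f hf hfc (fun l => geo (x l)) (geo 1) (fun l hl => by rw [hx2 l hl])]
    simp only [hx1]
  rw [gDet_rect a b (c - m) hb _ _ hF] at hsum
  rw [← coeff_det, ← hsum, MvPolynomial.coeff_sum]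
  have hterm : ∀ π : PlanePartition, MvPolynomial.coeff (Finsupp.equivFunOnFinite.symm k)
      (∏ l ∈ Finset.range c, x l ^ π.cCol (l + 1)) =
      if (∀ i, π.cCol (ℓ i) = k i) then (1 : ℝ) else 0 := by
    intro π
    have h1 : ∏ l ∈ Finset.range c, x l ^ π.cCol (l + 1) =
        MvPolynomial.monomial (Finsupp.equivFunOnFinite.symm fun i => π.cCol (ℓ i)) (1 : ℝ) := by
      rw [prod_split m c f hf hfc (fun l => x l ^ π.cCol (l + 1)) 1
        (fun l hl => by rw [hx2 l hl, one_pow]), one_pow, one_mul, MvPolynomial.monomial_eq,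
        MvPolynomial.C_1, one_mul, Finsupp.prod_fintype _ _ (by simp)]
      refine Finset.prod_congr rfl fun i _ => ?_
      have h1 := hpos i
      have h2 : f i + 1 = ℓ i := by
        simp only [hfdef]
        omega
      rw [hx1, h2]
      rfl
    rw [h1, MvPolynomial.coeff_monomial]
    congr 1
    rw [Equiv.apply_eq_iff_eq, funext_iff]
  rw [Finset.sum_congr rfl (fun π _ => hterm π), Finset.sum_boole]
  have h1 : {π ∈ PP a b c | ∀ i, π.cCol (ℓ i) = k i} =
      ((S.filter fun π => ∀ i, π.cCol (ℓ i) = k i : Finset PlanePartition) :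
        Set PlanePartition) := by
    ext π
    simp [hS π]
  rw [h1, Set.ncard_coe_finset]

end Count

lemma final_sum (b m : ℕ) (q : ℝ) (k : Fin m → ℕ) (hb : 0 < b) :
    ∑ s ∈ Fintype.piFinset (fun _ : Fin b =>
        Finset.range ((Finsupp.equivFunOnFinite.symm k).degree + 1)),
      MvPolynomial.coeff (Finsupp.equivFunOnFinite.symm k) (∏ i, hX m (s i)) *
        ((∏ i, (q ^ (s i) * (1 - q) ^ m)) * (vD b s / vD b 0)) =
    ∏ i, ((k i + b - 1).choose (k i) : ℝ) * (1 - q) ^ b * q ^ k i := by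
  set k' : Fin m →₀ ℕ := Finsupp.equivFunOnFinite.symm k with hk'
  have hd : k'.degree = ∑ i, k i := by
    rw [degree_eq_sum]
    rfl
  have h1 := congrArg (MvPolynomial.coeff k') (sum_vand m b (k'.degree + 1))
  rw [MvPolynomial.coeff_sum] at h1
  simp only [mul_comm _ (MvPolynomial.C _), MvPolynomial.coeff_C_mul] at h1
  rw [coeff_pow_hX m b k'.degree k' le_rfl] at h1
  have hv := vD_zero_ne b
  have hv0 : (Matrix.vandermonde fun i : Fin b => (-((i : ℕ) : ℝ))).det = vD b 0 := by
    simp [vD]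
  rw [hv0] at h1
  have hterm : ∀ s : Fin b → ℕ,
      MvPolynomial.coeff k' (∏ i, hX m (s i)) *
        ((∏ i, (q ^ (s i) * (1 - q) ^ m)) * (vD b s / vD b 0)) =
      (q ^ (∑ i, k i) * ((1 - q) ^ m) ^ b / vD b 0) *
        (vD b s * MvPolynomial.coeff k' (∏ i, hX m (s i))) := by
    intro s
    by_cases h : k'.degree = ∑ i, s i
    · rw [Finset.prod_mul_distrib, Finset.prod_pow_eq_pow_sum, ← h, hd, Finset.prod_const,
        Finset.card_univ, Fintype.card_fin]
      ring
    · rw [coeff_prod_hX s k' h]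
      ring
  rw [Finset.sum_congr rfl (fun s _ => hterm s), ← Finset.mul_sum]
  have h2 : ∑ s ∈ Fintype.piFinset (fun _ : Fin b => Finset.range (k'.degree + 1)),
      (vD b s * MvPolynomial.coeff k' (∏ i, hX m (s i))) =
      vD b 0 * ∏ i, (b.multichoose (k' i) : ℝ) := h1
  rw [h2, Finset.prod_mul_distrib, Finset.prod_mul_distrib, Finset.prod_pow_eq_pow_sum,
    Finset.prod_pow_eq_pow_sum, Finset.sum_const, Finset.card_univ, Fintype.card_fin, smul_eq_mul]
  have h3 : ∏ i, (b.multichoose (k' i) : ℝ) = ∏ i, ((k i + b - 1).choose (k i) : ℝ) := by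
    refine Finset.prod_congr rfl fun i _ => ?_
    rw [Nat.multichoose_eq, add_comm b]
    rfl
  rw [h3, ← pow_mul]
  field_simp

open Filter in
/-- Negative binomial regime: for fixed `b`, if `a_n, c_n → ∞` with
`a_n/(a_n + c_n) → q ∈ (0,1)`, then for distinct positive levels `ℓ_1,…,ℓ_m` and any
`k_1,…,k_m ∈ ℕ`, the uniform probability that `c_{ℓ_i}(π) = k_i` for all `i` converges to
`∏_i C(k_i + b − 1, k_i) (1 − q)^b q^{k_i}`. -/
theorem corners_negBinomial_limit (b : ℕ) (hb : 0 < b) (q : ℝ) (hq : q ∈ Set.Ioo (0 : ℝ) 1)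
    (a c : ℕ → ℕ) (ha : ∀ n, 0 < a n) (hc : ∀ n, 0 < c n)
    (ha' : Tendsto a atTop atTop) (hc' : Tendsto c atTop atTop)
    (hlim : Tendsto (fun n => (a n : ℝ) / ((a n : ℝ) + (c n : ℝ))) atTop (nhds q))
    (m : ℕ) (hm : 0 < m) (ℓ : Fin m → ℕ) (hinj : Function.Injective ℓ)
    (hpos : ∀ i, 1 ≤ ℓ i) (k : Fin m → ℕ) :
    Tendsto (fun n =>
        (({π ∈ PP (a n) b (c n) | ∀ i, π.cCol (ℓ i) = k i}.ncard : ℝ)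
          / ((PP (a n) b (c n)).ncard : ℝ)))
      atTop
      (nhds (∏ i, ((k i + b - 1).choose (k i) : ℝ) * (1 - q) ^ b * q ^ k i)) := by
  have hden : ∀ n, ((PP (a n) b (c n)).ncard : ℝ) = nD (a n) b (b + c n) 0 :=
    fun n => den_count (a n) b (c n) hb
  rw [← final_sum b m q k hb]
  set k' : Fin m →₀ ℕ := Finsupp.equivFunOnFinite.symm k with hk'
  have hT : Tendsto (fun n => ∑ s ∈ Fintype.piFinset (fun _ : Fin b =>
        Finset.range (k'.degree + 1)),
      MvPolynomial.coeff k' (∏ i, hX m (s i)) *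
        ((∏ i : Fin b, rF (a n) b (c n) m i (s i)) * (vD b s / vD b 0))) atTop
      (nhds (∑ s ∈ Fintype.piFinset (fun _ : Fin b => Finset.range (k'.degree + 1)),
      MvPolynomial.coeff k' (∏ i, hX m (s i)) *
        ((∏ i, (q ^ (s i) * (1 - q) ^ m)) * (vD b s / vD b 0)))) := by
    refine tendsto_finsetSum _ fun s _ => ?_
    refine Tendsto.const_mul _ (Tendsto.mul_const _ ?_)
    exact tendsto_finsetProd _ fun i _ => rF_limit b m i (s i) q a c ha' hlim
  refine hT.congr' ?_
  filter_upwards [ha'.eventually_ge_atTop (b + k'.degree),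
    hc'.eventually_ge_atTop (m + ∑ i, ℓ i)] with n hn1 hn2
  have hl : ∀ i, ℓ i ≤ c n := by
    intro i
    have := Finset.single_le_sum (f := ℓ) (fun _ _ => Nat.zero_le _) (Finset.mem_univ i)
    omega
  rw [hden, num_count (a n) b (c n) m hb ℓ hinj hpos hl k, Finset.sum_div]
  refine Finset.sum_congr rfl fun s hs => ?_
  rw [mul_div_assoc, nD_ratio (a n) b (c n) m s (by omega)]
  intro i
  have h1 := Finset.mem_range.1 ((Fintype.mem_piFinset.1 hs) i)
  have h2 := i.2
  rw [← hk'] at h1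
  omega
end
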